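/- Let Ω be a pseudoconvex domain in ℂⁿ, let p be a strictly pseudoconvex boundary point of Ω of class C², and let V be a bounded neighborhood of p. Then there exist a neighborhood U ⊆ V of p and a constant C > 0 such that for every z ∈ Ω ∩ U and every nonzero X ∈ ℂⁿ, 1 ≥ J¹_Ω(z;X)/J¹_{Ω∩V}(z;X) ≥ 1 + C·δ_Ω(z)·log δ_Ω(z). -/

import Mathlib

open Metric MeasureTheory Set
open scoped NNReal ENNReal

noncomputable section

/-- Complex Euclidean `n`-space. -/
abbrev Cn (n : ℕ) := EuclideanSpace ℂ (Fin n)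

variable {n : ℕ}

instance : MeasurableSpace (Cn n) := borel _
instance : BorelSpace (Cn n) := ⟨rfl⟩
instance : InnerProductSpace ℝ (Cn n) := InnerProductSpace.rclikeToReal ℂ _

/-- `δ_Ω(z)`: the Euclidean distance from `z` to the boundary of `Ω`. -/
def bdist (Ω : Set (Cn n)) (z : Cn n) : ℝ := Metric.infDist z (frontier Ω)

/-- The squeezing function `σ_Ω(z)` of a (bounded) domain `Ω`. -/
def squeezing (Ω : Set (Cn n)) (z : Cn n) : ℝ :=
  sSup {r : ℝ | 0 < r ∧ ∃ f : Cn n → Cn n,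
    DifferentiableOn ℂ f Ω ∧ Set.InjOn f Ω ∧ Set.MapsTo f Ω (Metric.ball 0 1) ∧
    f z = 0 ∧ Metric.ball (0 : Cn n) r ⊆ f '' Ω}

/-- The Kobayashi metric `κ_Ω(z;X)`. -/
def kobayashi (Ω : Set (Cn n)) (z X : Cn n) : ℝ :=
  sInf {r : ℝ | ∃ (α : ℂ) (φ : ℂ → Cn n),
    DifferentiableOn ℂ φ (Metric.ball 0 1) ∧ Set.MapsTo φ (Metric.ball 0 1) Ω ∧
    φ 0 = z ∧ α • deriv φ 0 = X ∧ r = ‖α‖}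

/-- The Carathéodory metric `γ_Ω(z;X)`. -/
def caratheodory (Ω : Set (Cn n)) (z X : Cn n) : ℝ :=
  sSup {r : ℝ | ∃ f : Cn n → ℂ,
    DifferentiableOn ℂ f Ω ∧ Set.MapsTo f Ω (Metric.ball 0 1) ∧
    r = ‖fderiv ℂ f z X‖}

/-- `⟨∂ρ(q),X⟩ = Σ_j (∂ρ/∂z_j)(q) X_j`, expressed via the real differential:
`⟨∂ρ(q),X⟩ = (Dρ(q)X - i·Dρ(q)(iX))/2`. -/
def cderiv (ρ : Cn n → ℝ) (q X : Cn n) : ℂ :=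
  (((fderiv ℝ ρ q X : ℝ) : ℂ) - Complex.I * ((fderiv ℝ ρ q (Complex.I • X) : ℝ) : ℂ)) / 2

/-- The Levi form `L_ρ(q;X) = Σ_{j,k} (∂²ρ/∂z_j∂z̄_k)(q) X_j X̄_k`, expressed via the real
second differential: `L_ρ(q;X) = (D²ρ(q)[X,X] + D²ρ(q)[iX,iX])/4`. -/
def leviForm (ρ : Cn n → ℝ) (q X : Cn n) : ℝ :=
  (fderiv ℝ (fun w => fderiv ℝ ρ w X) q X
    + fderiv ℝ (fun w => fderiv ℝ ρ w (Complex.I • X)) q (Complex.I • X)) / 4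

/-- `p` is a strictly pseudoconvex boundary point of `Ω` of class `C^{m,ε}`. -/
def IsStrictPscPtHolder (Ω : Set (Cn n)) (p : Cn n) (m : ℕ) (ε : ℝ) : Prop :=
  p ∈ frontier Ω ∧ ∃ W : Set (Cn n), IsOpen W ∧ p ∈ W ∧ ∃ ρ : Cn n → ℝ,
    ContDiffOn ℝ m ρ W ∧
    (∃ C : ℝ≥0, HolderOnWith C ε.toNNReal (iteratedFDeriv ℝ m ρ) W) ∧
    Ω ∩ W = {z ∈ W | ρ z < 0} ∧
    (∀ q ∈ frontier Ω ∩ W, fderiv ℝ ρ q ≠ 0) ∧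
    (∀ q ∈ frontier Ω ∩ W, ∀ X : Cn n, X ≠ 0 → cderiv ρ q X = 0 → 0 < leviForm ρ q X)

/-- `p` is a strictly pseudoconvex boundary point of `Ω` of class `C²`. -/
def IsStrictPscPtC2 (Ω : Set (Cn n)) (p : Cn n) : Prop :=
  p ∈ frontier Ω ∧ ∃ W : Set (Cn n), IsOpen W ∧ p ∈ W ∧ ∃ ρ : Cn n → ℝ,
    ContDiffOn ℝ 2 ρ W ∧
    Ω ∩ W = {z ∈ W | ρ z < 0} ∧
    (∀ q ∈ frontier Ω ∩ W, fderiv ℝ ρ q ≠ 0) ∧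
    (∀ q ∈ frontier Ω ∩ W, ∀ X : Cn n, X ≠ 0 → cderiv ρ q X = 0 → 0 < leviForm ρ q X)

/-- An open set `D ⊆ ℂⁿ` is pseudoconvex: `u = -log dist(·, Dᶜ)` is plurisubharmonic on `D`. -/
def IsPseudoconvex (D : Set (Cn n)) : Prop :=
  IsOpen D ∧
  UpperSemicontinuousOn (fun z => -Real.log (Metric.infDist z Dᶜ)) D ∧
  ∀ a ∈ D, ∀ w : Cn n, ∀ r : ℝ, 0 < r →
    (∀ l : ℂ, ‖l‖ ≤ r → a + l • w ∈ D) →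
    -Real.log (Metric.infDist a Dᶜ) ≤
      (1 / (2 * Real.pi)) * ∫ θ in (0:ℝ)..(2 * Real.pi),
        -Real.log (Metric.infDist (a + ((r : ℂ) * Complex.exp (θ * Complex.I)) • w) Dᶜ)

/-- `cl(Ω)` admits a Stein neighborhood basis. -/
def HasSteinBasis (Ω : Set (Cn n)) : Prop :=
  ∀ W : Set (Cn n), IsOpen W → closure Ω ⊆ W →
    ∃ U : Set (Cn n), IsPseudoconvex U ∧ closure Ω ⊆ U ∧ U ⊆ W

/-- The squared `L²`-norm of `f` on `D` (as an extended nonnegative real). -/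
def L2normSq (D : Set (Cn n)) (f : Cn n → ℂ) : ℝ≥0∞ := ∫⁻ w in D, (‖f w‖₊ : ℝ≥0∞) ^ 2

/-- `J⁰_D(z) = sup {|f(z)|² : f ∈ L²_h(D), ‖f‖_D ≤ 1}`; equals the Bergman kernel on the
diagonal. -/
def J0 (D : Set (Cn n)) (z : Cn n) : ℝ :=
  sSup {v : ℝ | ∃ f : Cn n → ℂ, DifferentiableOn ℂ f D ∧ L2normSq D f ≤ 1 ∧ v = ‖f z‖ ^ 2}

/-- `J¹_D(z;X) = sup {|f'(z)X|² : f ∈ L²_h(D), ‖f‖_D ≤ 1, f(z) = 0}`. -/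
def J1 (D : Set (Cn n)) (z X : Cn n) : ℝ :=
  sSup {v : ℝ | ∃ f : Cn n → ℂ, DifferentiableOn ℂ f D ∧ L2normSq D f ≤ 1 ∧ f z = 0 ∧
    v = ‖fderiv ℂ f z X‖ ^ 2}

/-- `J²_D(z;X,Y) = sup {|Σ_{j,k} f_{ζ_jζ_k}(z) X_j Y_k|² : f ∈ L²_h(D), ‖f‖_D ≤ 1,
f(z) = 0, f'(z) = 0}`. -/
def J2 (D : Set (Cn n)) (z X Y : Cn n) : ℝ :=
  sSup {v : ℝ | ∃ f : Cn n → ℂ, DifferentiableOn ℂ f D ∧ L2normSq D f ≤ 1 ∧ f z = 0 ∧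
    fderiv ℂ f z = 0 ∧ v = ‖fderiv ℂ (fun w => fderiv ℂ f w Y) z X‖ ^ 2}

/-- The Bergman metric `β_D(z;X) = (J¹_D(z;X)/J⁰_D(z))^{1/2}`. -/
def bergman (D : Set (Cn n)) (z X : Cn n) : ℝ := Real.sqrt (J1 D z X / J0 D z)

/-- The bisectional curvature of the Bergman metric. -/
def bisect (D : Set (Cn n)) (z X Y : Cn n) : ℝ :=
  2 - J0 D z * J2 D z X Y / (J1 D z X * J1 D z Y)

/-- The holomorphic sectional curvature `s_D(z;X)` of the Bergman metric. -/
def sectCurv (D : Set (Cn n)) (z X : Cn n) : ℝ := bisect D z X X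

/-- The Ricci curvature `r_D(z;X)` of the Bergman metric (w.r.t. the standard basis). -/
def ricciCurv (D : Set (Cn n)) (z X : Cn n) : ℝ :=
  ∑ j : Fin n, bisect D z (EuclideanSpace.single j 1) X

/-- The scalar curvature `t_D(z)` of the Bergman metric. -/
def scalarCurv (D : Set (Cn n)) (z : Cn n) : ℝ :=
  ∑ j : Fin n, ricciCurv D z (EuclideanSpace.single j 1)

/-- `M(z;X) = ( |⟨∂δ_Ω(z),X⟩|²/δ_Ω(z)² + L(z;X)/δ_Ω(z) )^{1/2}`, where `L` is the Levi form
of `-δ_Ω`. -/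
def Mfun (Ω : Set (Cn n)) (z X : Cn n) : ℝ :=
  Real.sqrt (‖cderiv (bdist Ω) z X‖ ^ 2 / (bdist Ω z) ^ 2
    + leviForm (fun w => -(bdist Ω w)) z X / bdist Ω z)

/-- The sesquilinear form of the Bergman metric, recovered from `β²` by polarization. -/
def bergForm (D : Set (Cn n)) (z X Y : Cn n) : ℂ :=
  (((J1 D z (X + Y) / J0 D z : ℝ) : ℂ) - ((J1 D z (X - Y) / J0 D z : ℝ) : ℂ)
    + Complex.I * ((J1 D z (X + Complex.I • Y) / J0 D z : ℝ) : ℂ)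
    - Complex.I * ((J1 D z (X - Complex.I • Y) / J0 D z : ℝ) : ℂ)) / 4

/-- The Hermitian matrix `(B_{jk}(z))` of the Bergman metric in the standard coordinates. -/
def bergMat (D : Set (Cn n)) (z : Cn n) : Matrix (Fin n) (Fin n) ℂ :=
  fun j k => bergForm D z (EuclideanSpace.single j 1) (EuclideanSpace.single k 1)

/-- The canonical Bergman invariant `J_D(z) = Δ_D(z)/K_D(z)`. -/
def canonInvariant (D : Set (Cn n)) (z : Cn n) : ℂ :=
  (bergMat D z).det / ((J0 D z : ℝ) : ℂ)

section Helpers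
open Complex (I)
open scoped ComplexConjugate

section P1

/-- standard basis vector -/
abbrev ee (j : Fin n) : Cn n := EuclideanSpace.single j (1:ℂ)

def dz (j : Fin n) (f : Cn n → ℂ) (x : Cn n) : ℂ :=
  (fderiv ℝ f x (ee j) - I * fderiv ℝ f x (I • ee j)) / 2

def dzb (j : Fin n) (f : Cn n → ℂ) (x : Cn n) : ℂ :=
  (fderiv ℝ f x (ee j) + I * fderiv ℝ f x (I • ee j)) / 2

/-- complex valued version of a real function -/
abbrev toC (φ : Cn n → ℝ) : Cn n → ℂ := fun x => (φ x : ℂ)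

lemma fderiv_conj' (f : Cn n → ℂ) (x v : Cn n) :
    fderiv ℝ (fun y => conj (f y)) x v = conj (fderiv ℝ f x v) := by
  have := Complex.conjCLE.comp_fderiv (f := f) (x := x)
  have h2 := congrArg (fun L => L v) this
  simpa [Function.comp_def] using h2

lemma dz_conj (j : Fin n) (f : Cn n → ℂ) (x : Cn n) :
    dz j (fun y => conj (f y)) x = conj (dzb j f x) := by
  simp [dz, dzb, fderiv_conj', sub_eq_add_neg, Complex.conj_ofNat]

lemma dzb_conj (j : Fin n) (f : Cn n → ℂ) (x : Cn n) :
    dzb j (fun y => conj (f y)) x = conj (dz j f x) := by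
  simp [dz, dzb, fderiv_conj', sub_eq_add_neg, Complex.conj_ofNat]

lemma dz_mul (j : Fin n) {f g : Cn n → ℂ} {x : Cn n} (hf : DifferentiableAt ℝ f x)
    (hg : DifferentiableAt ℝ g x) :
    dz j (fun y => f y * g y) x = dz j f x * g x + f x * dz j g x := by
  simp only [dz, fderiv_fun_mul hf hg]
  simp [smul_eq_mul]; ring

lemma dzb_mul (j : Fin n) {f g : Cn n → ℂ} {x : Cn n} (hf : DifferentiableAt ℝ f x)
    (hg : DifferentiableAt ℝ g x) :
    dzb j (fun y => f y * g y) x = dzb j f x * g x + f x * dzb j g x := by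
  simp only [dzb, fderiv_fun_mul hf hg]
  simp [smul_eq_mul]; ring

lemma dz_sub (j : Fin n) {f g : Cn n → ℂ} {x : Cn n} (hf : DifferentiableAt ℝ f x)
    (hg : DifferentiableAt ℝ g x) :
    dz j (fun y => f y - g y) x = dz j f x - dz j g x := by
  simp only [dz, fderiv_fun_sub hf hg]
  simp; ring

lemma dzb_sub (j : Fin n) {f g : Cn n → ℂ} {x : Cn n} (hf : DifferentiableAt ℝ f x)
    (hg : DifferentiableAt ℝ g x) :
    dzb j (fun y => f y - g y) x = dzb j f x - dzb j g x := by
  simp only [dzb, fderiv_fun_sub hf hg]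
  simp; ring

lemma dz_contDiff (j : Fin n) {f : Cn n → ℂ} {m : WithTop ℕ∞} (hf : ContDiff ℝ (m+1) f) :
    ContDiff ℝ m (dz j f) := by
  have := hf.fderiv_right (m := m) le_rfl
  unfold dz
  fun_prop

lemma dzb_contDiff (j : Fin n) {f : Cn n → ℂ} {m : WithTop ℕ∞} (hf : ContDiff ℝ (m+1) f) :
    ContDiff ℝ m (dzb j f) := by
  have := hf.fderiv_right (m := m) le_rfl
  unfold dzb
  fun_prop

lemma dz_supp (j : Fin n) (f : Cn n → ℂ) : tsupport (dz j f) ⊆ tsupport f := by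
  refine closure_minimal ?_ (isClosed_tsupport f)
  intro x hx
  by_contra h
  apply hx
  have : fderiv ℝ f x = 0 := by
    have := (tsupport_fderiv_subset ℝ (f := f))
    exact image_eq_zero_of_notMem_tsupport (fun h' => h (this h'))
  simp [dz, this]

lemma dzb_supp (j : Fin n) (f : Cn n → ℂ) : tsupport (dzb j f) ⊆ tsupport f := by
  refine closure_minimal ?_ (isClosed_tsupport f)
  intro x hx
  by_contra h
  apply hx
  have : fderiv ℝ f x = 0 := by
    have := (tsupport_fderiv_subset ℝ (f := f))
    exact image_eq_zero_of_notMem_tsupport (fun h' => h (this h'))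
  simp [dzb, this]

lemma dz_cs (j : Fin n) {f : Cn n → ℂ} (h : HasCompactSupport f) : HasCompactSupport (dz j f) :=
  h.of_isClosed_subset (isClosed_tsupport _) (dz_supp j f)

lemma fderiv_zero_off {f : Cn n → ℂ} {K : Set (Cn n)} (hK : IsClosed K) (h : ∀ x ∉ K, f x = 0)
    {x : Cn n} (hx : x ∉ K) : fderiv ℝ f x = 0 := by
  have : f =ᶠ[nhds x] fun _ => 0 :=
    Filter.eventually_of_mem (hK.isOpen_compl.mem_nhds hx) (fun y hy => h y hy)
  rw [this.fderiv_eq]; simp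

lemma dz_zero_off (j : Fin n) {f : Cn n → ℂ} {K : Set (Cn n)} (hK : IsClosed K)
    (h : ∀ x ∉ K, f x = 0) : ∀ x ∉ K, dz j f x = 0 := fun x hx => by
  simp [dz, fderiv_zero_off hK h hx]

lemma dzb_zero_off (j : Fin n) {f : Cn n → ℂ} {K : Set (Cn n)} (hK : IsClosed K)
    (h : ∀ x ∉ K, f x = 0) : ∀ x ∉ K, dzb j f x = 0 := fun x hx => by
  simp [dzb, fderiv_zero_off hK h hx]

lemma cont_off {F : Type*} [NormedAddCommGroup F] {h : Cn n → F} {O K : Set (Cn n)} (hO : IsOpen O)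
    (hc : ContinuousOn h O) (hK : IsCompact K) (hKO : K ⊆ O) (h0 : ∀ x ∉ K, h x = 0) :
    Continuous h ∧ HasCompactSupport h := by
  have hs : tsupport h ⊆ K := closure_minimal (fun x hx => by
    by_contra h'; exact hx (h0 x h')) hK.isClosed
  exact ⟨hc.continuous_of_tsupport_subset hO (hs.trans hKO),
    hK.of_isClosed_subset (isClosed_tsupport _) hs⟩

lemma int_off {F : Type*} [NormedAddCommGroup F] {h : Cn n → F} {O K : Set (Cn n)} (hO : IsOpen O)
    (hc : ContinuousOn h O) (hK : IsCompact K) (hKO : K ⊆ O) (h0 : ∀ x ∉ K, h x = 0) :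
    Integrable h := by
  obtain ⟨h1, h2⟩ := cont_off hO hc hK hKO h0
  exact h1.integrable_of_hasCompactSupport h2

lemma dz_contDiffOn (j : Fin n) {f : Cn n → ℂ} {m : WithTop ℕ∞} {O : Set (Cn n)} (hO : IsOpen O)
    (hf : ContDiffOn ℝ (m+1) f O) : ContDiffOn ℝ m (dz j f) O := by
  have := hf.fderiv_of_isOpen (m := m) hO le_rfl
  unfold dz
  fun_prop

lemma dzb_contDiffOn (j : Fin n) {f : Cn n → ℂ} {m : WithTop ℕ∞} {O : Set (Cn n)} (hO : IsOpen O)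
    (hf : ContDiffOn ℝ (m+1) f O) : ContDiffOn ℝ m (dzb j f) O := by
  have := hf.fderiv_of_isOpen (m := m) hO le_rfl
  unfold dzb
  fun_prop

lemma ibp_v (v : Cn n) {f g : Cn n → ℂ} {O K : Set (Cn n)} (hO : IsOpen O)
    (hf : ContDiffOn ℝ 1 f O) (hg : ContDiff ℝ 1 g) (hK : IsCompact K) (hKO : K ⊆ O)
    (h0 : ∀ x ∉ K, g x = 0) :
    Integrable (fun x => f x * fderiv ℝ g x v) ∧ Integrable (fun x => fderiv ℝ f x v * g x) ∧
    ∫ x, f x * fderiv ℝ g x v = - ∫ x, fderiv ℝ f x v * g x := by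
  have c1 : ContinuousOn (fun x => fderiv ℝ f x v) O :=
    (hf.continuousOn_fderiv_of_isOpen hO le_rfl).clm_apply continuousOn_const
  have c2 : Continuous (fun x => fderiv ℝ g x v) :=
    (hg.continuous_fderiv (by simp)).clm_apply continuous_const
  have i1 : Integrable (fun x => f x * fderiv ℝ g x v) :=
    int_off hO (hf.continuousOn.mul c2.continuousOn) hK hKO
      (fun x hx => by simp [fderiv_zero_off hK.isClosed h0 hx])
  have i2 : Integrable (fun x => fderiv ℝ f x v * g x) :=
    int_off hO (c1.mul hg.continuous.continuousOn) hK hKO (fun x hx => by simp [h0 x hx])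
  refine ⟨i1, i2, ?_⟩
  refine integral_mul_fderiv_eq_neg_fderiv_mul_of_integrable i2 i1
    (int_off hO (hf.continuousOn.mul hg.continuous.continuousOn) hK hKO
      (fun x hx => by simp [h0 x hx])) ?_ ?_
  · intro x hx
    have hs : tsupport g ⊆ K := closure_minimal (fun x hx => by
      by_contra h'; exact hx (h0 x h')) hK.isClosed
    exact (hf.differentiableOn (by simp)).differentiableAt (hO.mem_nhds (hKO (hs hx)))
  · intro x _
    exact hg.differentiable (by simp) x

lemma ibp_dz (j : Fin n) {f g : Cn n → ℂ} {O K : Set (Cn n)} (hO : IsOpen O)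
    (hf : ContDiffOn ℝ 1 f O) (hg : ContDiff ℝ 1 g) (hK : IsCompact K) (hKO : K ⊆ O)
    (h0 : ∀ x ∉ K, g x = 0) :
    ∫ x, f x * dz j g x = - ∫ x, dz j f x * g x := by
  obtain ⟨a1, a2, a3⟩ := ibp_v (ee j) hO hf hg hK hKO h0
  obtain ⟨b1, b2, b3⟩ := ibp_v (I • ee j) hO hf hg hK hKO h0
  have e1 : (fun x => f x * dz j g x) = fun x => (1/2 : ℂ) * (f x * fderiv ℝ g x (ee j))
      - (I/2) * (f x * fderiv ℝ g x (I • ee j)) := by funext x; simp only [dz]; ring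
  have e2 : (fun x => dz j f x * g x) = fun x => (1/2 : ℂ) * (fderiv ℝ f x (ee j) * g x)
      - (I/2) * (fderiv ℝ f x (I • ee j) * g x) := by funext x; simp only [dz]; ring
  rw [e1, e2, integral_sub (a1.const_mul _) (b1.const_mul _),
    integral_sub (a2.const_mul _) (b2.const_mul _)]
  simp only [integral_const_mul, a3, b3]; ring

lemma ibp_dzb (j : Fin n) {f g : Cn n → ℂ} {O K : Set (Cn n)} (hO : IsOpen O)
    (hf : ContDiffOn ℝ 1 f O) (hg : ContDiff ℝ 1 g) (hK : IsCompact K) (hKO : K ⊆ O)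
    (h0 : ∀ x ∉ K, g x = 0) :
    ∫ x, f x * dzb j g x = - ∫ x, dzb j f x * g x := by
  obtain ⟨a1, a2, a3⟩ := ibp_v (ee j) hO hf hg hK hKO h0
  obtain ⟨b1, b2, b3⟩ := ibp_v (I • ee j) hO hf hg hK hKO h0
  have e1 : (fun x => f x * dzb j g x) = fun x => (1/2 : ℂ) * (f x * fderiv ℝ g x (ee j))
      + (I/2) * (f x * fderiv ℝ g x (I • ee j)) := by funext x; simp only [dzb]; ring
  have e2 : (fun x => dzb j f x * g x) = fun x => (1/2 : ℂ) * (fderiv ℝ f x (ee j) * g x)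
      + (I/2) * (fderiv ℝ f x (I • ee j) * g x) := by funext x; simp only [dzb]; ring
  rw [e1, e2, integral_add (a1.const_mul _) (b1.const_mul _),
    integral_add (a2.const_mul _) (b2.const_mul _)]
  simp only [integral_const_mul, a3, b3]; ring

lemma fderiv_fderiv_app {F : Type*} [NormedAddCommGroup F] [NormedSpace ℝ F] {f : Cn n → F}
    {x : Cn n} (hf : ContDiffAt ℝ 2 f x) (v w : Cn n) :
    fderiv ℝ (fun y => fderiv ℝ f y v) x w = fderiv ℝ (fderiv ℝ f) x w v := by
  have hd : DifferentiableAt ℝ (fderiv ℝ f) x :=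
    (hf.fderiv_right (m := 1) (by norm_num)).differentiableAt (by simp)
  rw [fderiv_clm_apply hd (by fun_prop)]
  simp

lemma symm2 {F : Type*} [NormedAddCommGroup F] [NormedSpace ℝ F] {f : Cn n → F} {x : Cn n}
    (hf : ContDiffAt ℝ 2 f x) (v w : Cn n) :
    fderiv ℝ (fderiv ℝ f) x v w = fderiv ℝ (fderiv ℝ f) x w v :=
  (hf.isSymmSndFDerivAt (by simp)).eq v w

lemma diff_fapp {F : Type*} [NormedAddCommGroup F] [NormedSpace ℝ F] {f : Cn n → F} {x : Cn n}
    (hf : ContDiffAt ℝ 2 f x) (v : Cn n) :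
    DifferentiableAt ℝ (fun y => fderiv ℝ f y v) x :=
  ((hf.fderiv_right (m := 1) (by norm_num)).differentiableAt (by simp)).clm_apply (by fun_prop)

lemma fderiv_dz {f : Cn n → ℂ} {x : Cn n} (hf : ContDiffAt ℝ 2 f x) (j : Fin n) (v : Cn n) :
    fderiv ℝ (dz j f) x v = (fderiv ℝ (fderiv ℝ f) x v (ee j)
      - I * fderiv ℝ (fderiv ℝ f) x v (I • ee j)) / 2 := by
  have h1 := diff_fapp hf (ee j)
  have h2 := diff_fapp hf (I • ee j)
  have : dz j f = fun y => (1/2:ℂ) * (fderiv ℝ f y (ee j)) - (I/2) * fderiv ℝ f y (I • ee j) := by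
    funext y; simp only [dz]; ring
  rw [this, fderiv_fun_sub (h1.const_mul _) (h2.const_mul _), fderiv_const_mul h1,
    fderiv_const_mul h2]
  simp only [sub_apply, smul_apply, fderiv_fderiv_app hf,
    smul_eq_mul]
  ring

lemma fderiv_dzb {f : Cn n → ℂ} {x : Cn n} (hf : ContDiffAt ℝ 2 f x) (j : Fin n) (v : Cn n) :
    fderiv ℝ (dzb j f) x v = (fderiv ℝ (fderiv ℝ f) x v (ee j)
      + I * fderiv ℝ (fderiv ℝ f) x v (I • ee j)) / 2 := by
  have h1 := diff_fapp hf (ee j)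
  have h2 := diff_fapp hf (I • ee j)
  have : dzb j f = fun y => (1/2:ℂ) * (fderiv ℝ f y (ee j)) + (I/2) * fderiv ℝ f y (I • ee j) := by
    funext y; simp only [dzb]; ring
  rw [this, fderiv_fun_add (h1.const_mul _) (h2.const_mul _), fderiv_const_mul h1,
    fderiv_const_mul h2]
  simp only [add_apply, smul_apply, fderiv_fderiv_app hf,
    smul_eq_mul]
  ring

lemma dz_dzb_comm {f : Cn n → ℂ} {x : Cn n} (hf : ContDiffAt ℝ 2 f x) (j k : Fin n) :
    dzb j (dz k f) x = dz k (dzb j f) x := by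
  rw [dzb, dz, fderiv_dz hf, fderiv_dz hf, fderiv_dzb hf, fderiv_dzb hf,
    symm2 hf (ee j) (ee k), symm2 hf (ee j) (I • ee k), symm2 hf (I • ee j) (ee k),
    symm2 hf (I • ee j) (I • ee k)]
  ring

lemma dzb_dzb_comm {f : Cn n → ℂ} {x : Cn n} (hf : ContDiffAt ℝ 2 f x) (j k : Fin n) :
    dzb j (dzb k f) x = dzb k (dzb j f) x := by
  rw [dzb, dzb, fderiv_dzb hf, fderiv_dzb hf, fderiv_dzb hf, fderiv_dzb hf,
    symm2 hf (ee j) (ee k), symm2 hf (ee j) (I • ee k), symm2 hf (I • ee j) (ee k),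
    symm2 hf (I • ee j) (I • ee k)]
  ring

lemma fderiv_toC (φ : Cn n → ℝ) (x v : Cn n) (h : DifferentiableAt ℝ φ x) :
    fderiv ℝ (toC φ) x v = ((fderiv ℝ φ x v : ℝ) : ℂ) := by
  have := (Complex.ofRealCLM.hasFDerivAt.comp x h.hasFDerivAt).fderiv
  have h2 := congrArg (fun L => L v) this
  simpa [Function.comp_def] using h2

lemma csmul1 (s t : ℝ) (a : Cn n) : ((⟨s, t⟩ : ℂ) • a : Cn n) = s • a + t • (I • a) := by
  ext i; simp; apply Complex.ext <;> (simp; try ring)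

lemma csmul2 (s t : ℝ) (a : Cn n) : (I • (⟨s, t⟩ : ℂ) • a : Cn n) = s • (I • a) - t • a := by
  ext i; simp; apply Complex.ext <;> (simp; try ring)

lemma sum_ee (X : Cn n) : X = ∑ j, X j • ee j := by
  ext i; simp [Finset.sum_apply, Pi.single_apply]

lemma cderiv_eq (φ : Cn n → ℝ) {x : Cn n} (h : DifferentiableAt ℝ φ x) (X : Cn n) :
    cderiv φ x X = ∑ j, dz j (toC φ) x * X j := by
  let L : Cn n →ₗ[ℂ] ℂ :=
    { toFun := fun X => cderiv φ x X
      map_add' := fun a b => by simp [cderiv, smul_add]; ring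
      map_smul' := fun c a => by
        obtain ⟨s, t⟩ := c
        rw [RingHom.id_apply, cderiv, cderiv, csmul2, csmul1]
        simp only [map_add, map_sub, map_smul, smul_eq_mul]
        have h3 : (⟨s, t⟩ : ℂ) = s + t * I := by apply Complex.ext <;> simp
        rw [h3]; push_cast
        linear_combination ((t:ℂ) / 2 * (fderiv ℝ φ x (I • a) : ℂ)) * Complex.I_mul_I }
  have hX := sum_ee X
  have : L X = ∑ j, X j * L (ee j) := by
    conv_lhs => rw [hX]
    simp [map_sum]
  change L X = _
  rw [this]
  refine Finset.sum_congr rfl fun j _ => ?_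
  rw [mul_comm]
  congr 1
  simp only [L, LinearMap.coe_mk, AddHom.coe_mk, cderiv, dz, fderiv_toC φ x _ h]

/-- hermitian form of a real bilinear form -/
def herm (B : Cn n →L[ℝ] Cn n →L[ℝ] ℝ) (X Y : Cn n) : ℂ :=
  ((B Y X : ℂ) + (B (I • Y) (I • X) : ℂ) + I * ((B (I • Y) X : ℂ) - (B Y (I • X) : ℂ))) / 4

lemma herm_smul_left (B : Cn n →L[ℝ] Cn n →L[ℝ] ℝ) (c : ℂ) (X Y : Cn n) :
    herm B (c • X) Y = c * herm B X Y := by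
  obtain ⟨s, t⟩ := c
  have h3 : (⟨s, t⟩ : ℂ) = s + t * I := by apply Complex.ext <;> simp
  simp only [herm, csmul2]; simp only [csmul1]
  rw [h3]
  simp only [map_add, map_sub, map_smul, smul_eq_mul]
  push_cast
  linear_combination (-(t:ℂ)/4 * ((B (I • Y) X : ℂ) - (B Y (I • X) : ℂ))) * Complex.I_mul_I

lemma herm_smul_right (B : Cn n →L[ℝ] Cn n →L[ℝ] ℝ) (c : ℂ) (X Y : Cn n) :
    herm B X (c • Y) = conj c * herm B X Y := by
  obtain ⟨s, t⟩ := c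
  have h3 : conj (⟨s, t⟩ : ℂ) = s - t * I := by apply Complex.ext <;> simp
  simp only [herm, csmul2]; simp only [csmul1]
  rw [h3]
  simp only [map_add, map_sub, map_smul, smul_eq_mul, add_apply, sub_apply, smul_apply]
  push_cast
  linear_combination ((t:ℂ)/4 * ((B (I • Y) X : ℂ) - (B Y (I • X) : ℂ))) * Complex.I_mul_I

lemma herm_add_left (B : Cn n →L[ℝ] Cn n →L[ℝ] ℝ) (X X' Y : Cn n) :
    herm B (X + X') Y = herm B X Y + herm B X' Y := by
  simp only [herm, smul_add, map_add]; push_cast; ring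

lemma herm_add_right (B : Cn n →L[ℝ] Cn n →L[ℝ] ℝ) (X Y Y' : Cn n) :
    herm B X (Y + Y') = herm B X Y + herm B X Y' := by
  simp only [herm, smul_add, map_add, add_apply]; push_cast; ring

lemma herm_sum (B : Cn n →L[ℝ] Cn n →L[ℝ] ℝ) (X : Cn n) :
    herm B X X = ∑ j, ∑ k, herm B (ee j) (ee k) * X j * conj (X k) := by
  let L (Y : Cn n) : Cn n →ₗ[ℂ] ℂ :=
    { toFun := fun X => herm B X Y
      map_add' := fun a b => herm_add_left B a b Y
      map_smul' := fun c a => herm_smul_left B c a Y }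
  let R (X : Cn n) : Cn n →ₛₗ[starRingEnd ℂ] ℂ :=
    { toFun := fun Y => herm B X Y
      map_add' := fun a b => herm_add_right B X a b
      map_smul' := fun c a => herm_smul_right B c X a }
  have h1 : ∀ Y, herm B X Y = ∑ j, X j * herm B (ee j) Y := by
    intro Y
    change L Y X = _
    conv_lhs => rw [sum_ee X]
    rw [map_sum]; simp only [map_smul, smul_eq_mul]; rfl
  have h2 : ∀ Z, herm B Z X = ∑ j, conj (X j) * herm B Z (ee j) := by
    intro Z
    change R Z X = _
    conv_lhs => rw [sum_ee X]
    rw [map_sum]; simp only [map_smulₛₗ, smul_eq_mul]; rfl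
  rw [h1]
  refine Finset.sum_congr rfl fun j _ => ?_
  rw [h2, Finset.mul_sum]
  refine Finset.sum_congr rfl fun k _ => ?_
  ring

lemma fderiv2_toC {φ : Cn n → ℝ} {x : Cn n} (h : ContDiffAt ℝ 2 φ x) (v w : Cn n) :
    fderiv ℝ (fderiv ℝ (toC φ)) x v w = ((fderiv ℝ (fderiv ℝ φ) x v w : ℝ) : ℂ) := by
  have hC : ContDiffAt ℝ 2 (toC φ) x := Complex.ofRealCLM.contDiff.contDiffAt.comp x h
  rw [← fderiv_fderiv_app hC, ← fderiv_fderiv_app h, ← fderiv_toC _ _ _ (diff_fapp h w)]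
  have : (fun y => fderiv ℝ (toC φ) y w) =ᶠ[nhds x] toC (fun y => fderiv ℝ φ y w) := by
    have h1 : ∀ᶠ y in nhds x, ContDiffAt ℝ 2 φ y := h.eventually (by simp)
    filter_upwards [h1] with y hy
    exact fderiv_toC _ _ _ (hy.differentiableAt (by simp))
  rw [this.fderiv_eq]

lemma levi_herm {φ : Cn n → ℝ} {x : Cn n} (h : ContDiffAt ℝ 2 φ x) (X : Cn n) :
    (leviForm φ x X : ℂ) = herm (fderiv ℝ (fderiv ℝ φ) x) X X := by
  rw [leviForm, herm, fderiv_fderiv_app h, fderiv_fderiv_app h, symm2 h (I • X) X]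
  push_cast; ring

lemma levi_eq {φ : Cn n → ℝ} {x : Cn n} (h : ContDiffAt ℝ 2 φ x) (X : Cn n) :
    (leviForm φ x X : ℂ) = ∑ j, ∑ k, dzb k (dz j (toC φ)) x * X j * conj (X k) := by
  rw [levi_herm h, herm_sum]
  have hC : ContDiffAt ℝ 2 (toC φ) x := Complex.ofRealCLM.contDiff.contDiffAt.comp x h
  refine Finset.sum_congr rfl fun j _ => Finset.sum_congr rfl fun k _ => ?_
  rw [dzb, fderiv_dz hC, fderiv_dz hC]
  simp only [fderiv2_toC h, herm]
  congr 2
  linear_combination (1/4 * (fderiv ℝ (fderiv ℝ φ) x (I • ee k) (I • ee j) : ℂ)) * Complex.I_mul_I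

end P1

section P2

lemma two_of {F : Type*} [NormedAddCommGroup F] [NormedSpace ℝ F] {f : Cn n → F}
    {O : Set (Cn n)} (h : ContDiffOn ℝ 2 f O) : ContDiffOn ℝ (1+1) f O := by
  rw [one_add_one_eq_two]; exact h

lemma two_of' {F : Type*} [NormedAddCommGroup F] [NormedSpace ℝ F] {f : Cn n → F}
    (h : ContDiff ℝ 2 f) : ContDiff ℝ (1+1) f := by
  rw [one_add_one_eq_two]; exact h

/-- the weight e^{-φ} as a complex function -/
abbrev wt (φ : Cn n → ℝ) : Cn n → ℂ := fun x => ((Real.exp (-φ x) : ℝ) : ℂ)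

lemma toC_cd {φ : Cn n → ℝ} {m : WithTop ℕ∞} {O : Set (Cn n)} (h : ContDiffOn ℝ m φ O) :
    ContDiffOn ℝ m (toC φ) O := Complex.ofRealCLM.contDiff.comp_contDiffOn h

lemma wt_cd {φ : Cn n → ℝ} {m : WithTop ℕ∞} {O : Set (Cn n)} (h : ContDiffOn ℝ m φ O) :
    ContDiffOn ℝ m (wt φ) O := toC_cd (φ := fun x => Real.exp (-φ x)) h.neg.exp

lemma dz_wt (j : Fin n) {φ : Cn n → ℝ} {x : Cn n} (h : DifferentiableAt ℝ φ x) :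
    dz j (wt φ) x = - dz j (toC φ) x * wt φ x := by
  have h1 : HasFDerivAt (fun y => Real.exp (-φ y)) (Real.exp (-φ x) • (-(fderiv ℝ φ x))) x :=
    h.hasFDerivAt.neg.exp
  have e : ∀ v, fderiv ℝ (wt φ) x v = (wt φ x) * -(fderiv ℝ (toC φ) x v) := by
    intro v
    have : fderiv ℝ (wt φ) x v = ((fderiv ℝ (fun y => Real.exp (-φ y)) x v : ℝ) : ℂ) :=
      fderiv_toC (fun y => Real.exp (-φ y)) x v h1.differentiableAt
    rw [this, h1.fderiv, fderiv_toC _ _ _ h]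
    simp
  simp only [dz, e]; ring

/-- formal weighted adjoint -/
def del (φ : Cn n → ℝ) (j : Fin n) (f : Cn n → ℂ) (x : Cn n) : ℂ :=
  dz j f x - dz j (toC φ) x * f x

lemma diffAt_of {F : Type*} [NormedAddCommGroup F] [NormedSpace ℝ F] {f : Cn n → F}
    {O : Set (Cn n)} (hO : IsOpen O) {m : WithTop ℕ∞} (hm : m ≠ 0) (h : ContDiffOn ℝ m f O)
    {x : Cn n} (hx : x ∈ O) : DifferentiableAt ℝ f x :=
  (h.differentiableOn hm).differentiableAt (hO.mem_nhds hx)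

lemma adj (j : Fin n) {φ : Cn n → ℝ} {f g : Cn n → ℂ} {O K : Set (Cn n)} (hO : IsOpen O)
    (hφ : ContDiffOn ℝ 2 φ O) (hf : ContDiff ℝ 1 f) (hg : ContDiffOn ℝ 1 g O)
    (hK : IsCompact K) (hKO : K ⊆ O) (h0 : ∀ x ∉ K, f x = 0) :
    ∫ x, del φ j f x * conj (g x) * wt φ x = - ∫ x, f x * conj (dzb j g x) * wt φ x := by
  have hφ1 : ContDiffOn ℝ 1 φ O := hφ.of_le (by norm_num)
  have hgc : ContDiffOn ℝ 1 (fun x => conj (g x)) O :=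
    Complex.conjCLE.contDiff.comp_contDiffOn hg
  have hw := wt_cd hφ1
  have hF : ContDiffOn ℝ 1 (fun x => conj (g x) * wt φ x) O := hgc.mul hw
  have key := ibp_dz j hO hF hf hK hKO h0
  have cφ : ContinuousOn (dz j (toC φ)) O :=
    (dz_contDiffOn (m := 1) j hO (toC_cd (two_of hφ))).continuousOn
  have i1 : Integrable (fun x => conj (g x) * wt φ x * dz j f x) :=
    int_off hO (hF.continuousOn.mul (dz_contDiff (m := 0) j (by simpa using hf)).continuous.continuousOn)
      hK hKO (fun x hx => by simp [dz_zero_off j hK.isClosed h0 x hx])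
  have i2 : Integrable (fun x => conj (g x) * wt φ x * (dz j (toC φ) x * f x)) :=
    int_off hO (hF.continuousOn.mul (cφ.mul hf.continuous.continuousOn))
      hK hKO (fun x hx => by simp [h0 x hx])
  have e1 : (fun x => del φ j f x * conj (g x) * wt φ x) =
      fun x => conj (g x) * wt φ x * dz j f x - conj (g x) * wt φ x * (dz j (toC φ) x * f x) := by
    funext x; simp only [del]; ring
  rw [e1, integral_sub i1 i2, key]
  have e2 : ∀ x, dz j (fun x => conj (g x) * wt φ x) x * f x =
      f x * conj (dzb j g x) * wt φ x - conj (g x) * wt φ x * (dz j (toC φ) x * f x) := by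
    intro x
    by_cases hx : x ∈ K
    · rw [dz_mul j (diffAt_of hO (by simp) hgc (hKO hx)) (diffAt_of hO (by simp) hw (hKO hx)), dz_conj,
        dz_wt j (diffAt_of hO (by simp) hφ1 (hKO hx))]
      ring
    · simp [h0 x hx]
  have i3 : Integrable (fun x => f x * conj (dzb j g x) * wt φ x) := by
    refine int_off hO ((hf.continuous.continuousOn.mul ?_).mul hw.continuousOn) hK hKO
      (fun x hx => by simp [h0 x hx])
    exact Complex.continuous_conj.comp_continuousOn
      (dzb_contDiffOn (m := 0) j hO (by simpa using hg)).continuousOn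
  simp only [e2]
  rw [integral_sub i3 i2]; ring

lemma boch_jk (j k : Fin n) {φ : Cn n → ℝ} {f g : Cn n → ℂ} {O K : Set (Cn n)} (hO : IsOpen O)
    (hφ : ContDiffOn ℝ 2 φ O) (hf : ContDiff ℝ 2 f) (hg : ContDiff ℝ 2 g)
    (hK : IsCompact K) (hKO : K ⊆ O) (hf0 : ∀ x ∉ K, f x = 0) (hg0 : ∀ x ∉ K, g x = 0) :
    ∫ x, del φ j f x * conj (del φ k g x) * wt φ x =
      (∫ x, dzb k f x * conj (dzb j g x) * wt φ x)
      + ∫ x, dzb k (dz j (toC φ)) x * f x * conj (g x) * wt φ x := by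
  have hφ1 : ContDiffOn ℝ 1 φ O := hφ.of_le (by norm_num)
  have hf1 : ContDiff ℝ 1 f := hf.of_le (by norm_num)
  have hg1 : ContDiff ℝ 1 g := hg.of_le (by norm_num)
  have hw := wt_cd hφ1
  have cφ : ContDiffOn ℝ 1 (dz k (toC φ)) O := dz_contDiffOn k hO (toC_cd (two_of hφ))
  have cdg : ContDiff ℝ 1 (dz k g) := dz_contDiff k (two_of' hg)
  have cdbg : ContDiff ℝ 1 (dzb j g) := dzb_contDiff j (two_of' hg)
  have hδ : ContDiffOn ℝ 1 (del φ k g) O := cdg.contDiffOn.sub (cφ.mul hg1.contDiffOn)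
  rw [adj j hO hφ hf1 hδ hK hKO hf0]
  have a2 := adj k hO hφ cdbg hf1.contDiffOn hK hKO (dzb_zero_off j hK.isClosed hg0)
  have a3 : ∫ x, f x * conj (del φ k (dzb j g) x) * wt φ x
      = - ∫ x, dzb k f x * conj (dzb j g x) * wt φ x := by
    have := congrArg conj a2
    rw [map_neg, ← integral_conj, ← integral_conj] at this
    simp only [map_mul, Complex.conj_conj, Complex.conj_ofReal] at this
    have e1 : (fun x => f x * conj (del φ k (dzb j g) x) * wt φ x) =
        fun x => conj (del φ k (dzb j g) x) * f x * wt φ x := by funext x; ring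
    have e2 : (fun x => dzb k f x * conj (dzb j g x) * wt φ x) =
        fun x => conj (dzb j g x) * dzb k f x * wt φ x := by funext x; ring
    rw [e1, e2, this]
  have e : ∀ x, f x * conj (dzb j (del φ k g) x) * wt φ x
      = f x * conj (del φ k (dzb j g) x) * wt φ x
        - dzb k (dz j (toC φ)) x * f x * conj (g x) * wt φ x := by
    intro x
    by_cases hx : x ∈ K
    · have hxO := hKO hx
      have hφx : ContDiffAt ℝ 2 (toC φ) x := (toC_cd hφ).contDiffAt (hO.mem_nhds hxO)
      have d1 : dzb j (del φ k g) x = del φ k (dzb j g) x - dzb j (dz k (toC φ)) x * g x := by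
        have : del φ k g = fun y => dz k g y - (dz k (toC φ) y * g y) := rfl
        rw [this, dzb_sub j (cdg.differentiable (by simp) x)
          ((diffAt_of hO (by simp) cφ hxO).fun_mul (hg1.differentiable (by simp) x)),
          dzb_mul j (diffAt_of hO (by simp) cφ hxO) (hg1.differentiable (by simp) x),
          dz_dzb_comm hg.contDiffAt j k, del]
        ring
      have d2 : conj (dzb j (dz k (toC φ)) x) = dzb k (dz j (toC φ)) x := by
        rw [← dz_conj, dz_dzb_comm hφx k j]
        congr 1
        funext y
        rw [← dzb_conj]; congr 1; funext z; simp
      rw [d1, map_sub, map_mul, d2]; ring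
    · simp [hf0 x hx]
  simp only [e]
  have cw : ContinuousOn (dz k (toC φ)) O := cφ.continuousOn
  rw [integral_sub, a3]
  · ring
  · refine int_off hO ((hf.continuous.continuousOn.mul ?_).mul hw.continuousOn) hK hKO
      (fun x hx => by simp [hf0 x hx])
    refine Complex.continuous_conj.comp_continuousOn ?_
    exact (dz_contDiff (m := 0) k (by simpa using cdbg)).continuous.continuousOn.sub
      (cw.mul cdbg.continuous.continuousOn)
  · refine int_off hO ?_ hK hKO (fun x hx => by simp [hf0 x hx])
    have c3 : ContinuousOn (dzb k (dz j (toC φ))) O :=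
      (dzb_contDiffOn (m := 0) k hO (by
        simpa using dz_contDiffOn (m := 1) j hO (toC_cd (two_of hφ)))).continuousOn
    exact ((c3.mul hf.continuous.continuousOn).mul
      (Complex.continuous_conj.comp_continuousOn hg.continuous.continuousOn)).mul hw.continuousOn


/-- assemble a vector field from components -/
abbrev vec (G : Fin n → Cn n → ℂ) (x : Cn n) : Cn n := WithLp.toLp 2 (fun j => G j x)

lemma re_int {f : Cn n → ℂ} (hf : Integrable f) : (∫ x, f x).re = ∫ x, (f x).re :=
  (Complex.reCLM.integral_comp_comm hf).symm

lemma dsum {f : Fin n → Fin n → Cn n → ℂ} (h : ∀ j k, Integrable (f j k)) :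
    ∫ x, ∑ j, ∑ k, f j k x = ∑ j, ∑ k, ∫ x, f j k x := by
  rw [integral_finsetSum _ fun j _ => integrable_finsetSum _ fun k _ => h j k]
  refine Finset.sum_congr rfl fun j _ => ?_
  rw [integral_finsetSum _ fun k _ => h j k]

lemma pair_ineq (a b : ℂ) : 0 ≤ (b * conj a).re + 1/2 * ‖a - b‖^2 := by
  rw [Complex.sq_norm, Complex.normSq_apply]
  simp
  nlinarith [sq_nonneg a.re, sq_nonneg a.im, sq_nonneg b.re, sq_nonneg b.im]

lemma del_cont (φ : Cn n → ℝ) (j : Fin n) {f : Cn n → ℂ} {O : Set (Cn n)} (hO : IsOpen O)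
    (hφ : ContDiffOn ℝ 2 φ O) (hf : ContDiff ℝ 2 f) : ContinuousOn (del φ j f) O := by
  refine (dz_contDiff (m := 1) j (two_of' hf)).continuous.continuousOn.sub
    ((dz_contDiffOn (m := 1) j hO (toC_cd (two_of hφ))).continuousOn.mul
      hf.continuous.continuousOn)

lemma bochner {φ : Cn n → ℝ} {G : Fin n → Cn n → ℂ} {O K : Set (Cn n)} (hO : IsOpen O)
    (hφ : ContDiffOn ℝ 2 φ O) (hG : ∀ j, ContDiff ℝ 2 (G j))
    (hK : IsCompact K) (hKO : K ⊆ O) (hG0 : ∀ j, ∀ x ∉ K, G j x = 0) :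
    Integrable (fun x => leviForm φ x (vec G x) * Real.exp (-φ x)) ∧
    Integrable (fun x => ‖∑ j, del φ j (G j) x‖^2 * Real.exp (-φ x)) ∧
    Integrable (fun x => (∑ j, ∑ k, ‖dzb j (G k) x - dzb k (G j) x‖^2) * Real.exp (-φ x)) ∧
    ∫ x, leviForm φ x (vec G x) * Real.exp (-φ x) ≤
      (∫ x, ‖∑ j, del φ j (G j) x‖^2 * Real.exp (-φ x))
      + 1/2 * ∫ x, (∑ j, ∑ k, ‖dzb j (G k) x - dzb k (G j) x‖^2) * Real.exp (-φ x) := by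
  have hw : ContinuousOn (wt φ) O := (wt_cd hφ).continuousOn
  have hwr : ContinuousOn (fun x => Real.exp (-φ x)) O := hφ.continuousOn.neg.rexp
  have cG : ∀ j, ContinuousOn (G j) O := fun j => (hG j).continuous.continuousOn
  have cd : ∀ j, ContinuousOn (del φ j (G j)) O := fun j => del_cont φ j hO hφ (hG j)
  have cdb : ∀ j k, ContinuousOn (dzb j (G k)) O := fun j k =>
    (dzb_contDiff (m := 1) j (two_of' (hG k))).continuous.continuousOn
  have cl : ∀ j k, ContinuousOn (dzb k (dz j (toC φ))) O := fun j k =>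
    (dzb_contDiffOn (m := 0) k hO (by
        simpa using dz_contDiffOn (m := 1) j hO (toC_cd (two_of hφ)))).continuousOn
  have cj : ∀ {f : Cn n → ℂ}, ContinuousOn f O → ContinuousOn (fun x => conj (f x)) O :=
    fun h => Complex.continuous_conj.comp_continuousOn h
  have d0 : ∀ j, ∀ x ∉ K, del φ j (G j) x = 0 := fun j x hx => by
    simp [del, hG0 j x hx, dz_zero_off j hK.isClosed (hG0 j) x hx]
  have db0 : ∀ j k, ∀ x ∉ K, dzb j (G k) x = 0 := fun j k x hx =>
    dzb_zero_off j hK.isClosed (hG0 k) x hx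
  have i1 : ∀ j k, Integrable (fun x => del φ j (G j) x * conj (del φ k (G k) x) * wt φ x) :=
    fun j k => int_off hO (((cd j).mul (cj (cd k))).mul hw) hK hKO
      (fun x hx => by simp [d0 j x hx])
  have i2 : ∀ j k, Integrable (fun x => dzb k (G j) x * conj (dzb j (G k) x) * wt φ x) :=
    fun j k => int_off hO (((cdb k j).mul (cj (cdb j k))).mul hw) hK hKO
      (fun x hx => by simp [db0 k j x hx])
  have i3 : ∀ j k, Integrable (fun x => dzb k (dz j (toC φ)) x * G j x * conj (G k x) * wt φ x) :=
    fun j k => int_off hO ((((cl j k).mul (cG j)).mul (cj (cG k))).mul hw) hK hKO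
      (fun x hx => by simp [hG0 j x hx])
  have elev : ∀ x, ((leviForm φ x (vec G x) * Real.exp (-φ x) : ℝ) : ℂ) =
      ∑ j, ∑ k, dzb k (dz j (toC φ)) x * G j x * conj (G k x) * wt φ x := by
    intro x
    by_cases hx : x ∈ K
    · push_cast
      rw [levi_eq (hφ.contDiffAt (hO.mem_nhds (hKO hx)))]
      simp [Finset.sum_mul]
    · have : vec G x = 0 := by ext j; simp [hG0 j x hx]
      rw [this]; simp [hG0 _ x hx, leviForm]
  have edel : ∀ x, ((‖∑ j, del φ j (G j) x‖^2 * Real.exp (-φ x) : ℝ) : ℂ) =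
      ∑ j, ∑ k, del φ j (G j) x * conj (del φ k (G k) x) * wt φ x := by
    intro x
    push_cast
    rw [← Complex.mul_conj', map_sum, Finset.sum_mul_sum, Finset.sum_mul]
    simp [Finset.sum_mul]
  have I1 : Integrable (fun x => ∑ j, ∑ k, del φ j (G j) x * conj (del φ k (G k) x) * wt φ x) :=
    integrable_finsetSum _ fun j _ => integrable_finsetSum _ fun k _ => i1 j k
  have I2 : Integrable (fun x => ∑ j, ∑ k, dzb k (G j) x * conj (dzb j (G k) x) * wt φ x) :=
    integrable_finsetSum _ fun j _ => integrable_finsetSum _ fun k _ => i2 j k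
  have I3 : Integrable (fun x => ∑ j, ∑ k, dzb k (dz j (toC φ)) x * G j x * conj (G k x) * wt φ x) :=
    integrable_finsetSum _ fun j _ => integrable_finsetSum _ fun k _ => i3 j k
  have key : ∫ x, ∑ j, ∑ k, del φ j (G j) x * conj (del φ k (G k) x) * wt φ x =
     (∫ x, ∑ j, ∑ k, dzb k (G j) x * conj (dzb j (G k) x) * wt φ x)
     + ∫ x, ∑ j, ∑ k, dzb k (dz j (toC φ)) x * G j x * conj (G k x) * wt φ x := by
    rw [dsum i1, dsum i2, dsum i3, ← Finset.sum_add_distrib]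
    refine Finset.sum_congr rfl fun j _ => ?_
    rw [← Finset.sum_add_distrib]
    refine Finset.sum_congr rfl fun k _ => ?_
    exact boch_jk j k hO hφ (hG j) (hG k) hK hKO (hG0 j) (hG0 k)
  have R1 : Integrable (fun x => ‖∑ j, del φ j (G j) x‖^2 * Real.exp (-φ x)) := by
    refine int_off hO (((continuousOn_finsetSum _ fun j _ => cd j).norm.pow 2).mul hwr) hK hKO
      (fun x hx => by simp [d0 _ x hx])
  have R3 : Integrable (fun x => (∑ j, ∑ k, ‖dzb j (G k) x - dzb k (G j) x‖^2) * Real.exp (-φ x)) := by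
    refine int_off hO ((continuousOn_finsetSum _ fun j _ => continuousOn_finsetSum _ fun k _ =>
      ((cdb j k).sub (cdb k j)).norm.pow 2).mul hwr) hK hKO
      (fun x hx => by simp [db0 _ _ x hx])
  have R2 : Integrable (fun x => leviForm φ x (vec G x) * Real.exp (-φ x)) := by
    have := I3.re
    refine this.congr (Filter.Eventually.of_forall fun x => ?_)
    change (_ : ℂ).re = _
    rw [← elev]; simp only [Complex.ofReal_re]
  refine ⟨R2, R1, R3, ?_⟩
  have k2 := congrArg Complex.re key
  rw [Complex.add_re, re_int I1, re_int I2, re_int I3] at k2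
  simp only [← elev, ← edel, Complex.ofReal_re] at k2
  rw [k2]
  have : 0 ≤ (∫ x, (∑ j, ∑ k, dzb k (G j) x * conj (dzb j (G k) x) * wt φ x).re) +
      1/2 * ∫ x, (∑ j, ∑ k, ‖dzb j (G k) x - dzb k (G j) x‖^2) * Real.exp (-φ x) := by
    rw [← integral_const_mul, ← integral_add (by exact I2.re) (R3.const_mul _)]
    refine integral_nonneg fun x => ?_
    simp only [Pi.zero_apply, Complex.re_sum, Finset.sum_mul, Finset.mul_sum, ← Finset.sum_add_distrib]
    refine Finset.sum_nonneg fun j _ => Finset.sum_nonneg fun k _ => ?_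
    have h := pair_ineq (dzb j (G k) x) (dzb k (G j) x)
    rw [Complex.re_mul_ofReal, ← mul_assoc, ← add_mul]
    exact mul_nonneg h (Real.exp_pos _).le
  linarith

end P2

section P3

lemma two_le_top : (2 : WithTop ℕ∞) ≤ ((⊤ : ℕ∞) : WithTop ℕ∞) :=
  show ((2 : ℕ∞) : WithTop ℕ∞) ≤ _ from WithTop.coe_le_coe.2 le_top

/-- unnormalised radial kernel -/
def kr (δ : ℝ) (x : Cn n) : ℝ := Real.smoothTransition (2 - 2 * ‖x‖^2 / δ^2)

/-- radial mollifier -/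
def kap (δ : ℝ) (x : Cn n) : ℝ := kr δ x / ∫ y : Cn n, kr δ y

lemma kr_cd (δ : ℝ) : ContDiff ℝ (⊤ : ℕ∞) (kr δ : Cn n → ℝ) := by
  unfold kr
  refine Real.smoothTransition.contDiff.comp ?_
  exact contDiff_const.sub ((contDiff_const.mul (contDiff_norm_sq ℝ)).div_const _)

lemma kr_nonneg (δ : ℝ) (x : Cn n) : 0 ≤ kr δ x := Real.smoothTransition.nonneg _

lemma kr_zero {δ : ℝ} (hδ : 0 < δ) {x : Cn n} (hx : δ ≤ ‖x‖) : kr δ x = 0 := by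
  refine Real.smoothTransition.zero_of_nonpos ?_
  have : 1 ≤ ‖x‖^2 / δ^2 := by
    rw [le_div_iff₀ (by positivity)]; nlinarith
  rw [mul_div_assoc]; linarith

lemma kr_zero_pos {δ : ℝ} : 0 < kr δ (0 : Cn n) := Real.smoothTransition.pos_of_pos (by simp)

lemma kr_cs {δ : ℝ} (hδ : 0 < δ) : HasCompactSupport (kr δ : Cn n → ℝ) :=
  HasCompactSupport.intro (isCompact_closedBall (0 : Cn n) δ) fun x hx => by
    refine kr_zero hδ ?_
    simp at hx; exact hx.le

lemma kr_int_pos {δ : ℝ} (hδ : 0 < δ) : 0 < ∫ y : Cn n, kr δ y :=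
  (kr_cd δ).continuous.integral_pos_of_hasCompactSupport_nonneg_nonzero (kr_cs hδ)
    (kr_nonneg δ) (x := 0) kr_zero_pos.ne'

lemma kap_cd (δ : ℝ) : ContDiff ℝ (⊤ : ℕ∞) (kap δ : Cn n → ℝ) := (kr_cd δ).div_const _

lemma kap_nonneg {δ : ℝ} (hδ : 0 < δ) (x : Cn n) : 0 ≤ kap δ x :=
  div_nonneg (kr_nonneg _ _) (kr_int_pos hδ).le

lemma kap_zero {δ : ℝ} (hδ : 0 < δ) {x : Cn n} (hx : δ ≤ ‖x‖) : kap δ x = 0 := by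
  rw [kap, kr_zero hδ hx, zero_div]

lemma kap_cs {δ : ℝ} (hδ : 0 < δ) : HasCompactSupport (kap δ : Cn n → ℝ) :=
  HasCompactSupport.intro (isCompact_closedBall (0 : Cn n) δ) fun x hx => by
    refine kap_zero hδ ?_
    simp at hx; exact hx.le

lemma kap_int {δ : ℝ} (hδ : 0 < δ) : ∫ y : Cn n, kap δ y = 1 := by
  unfold kap
  rw [integral_div, div_self (kr_int_pos hδ).ne']

lemma kap_integrable {δ : ℝ} (hδ : 0 < δ) : Integrable (kap δ : Cn n → ℝ) :=
  (kap_cd δ).continuous.integrable_of_hasCompactSupport (kap_cs hδ)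

lemma kap_rad (δ : ℝ) {x y : Cn n} (h : ‖x‖ = ‖y‖) : kap δ x = kap δ y := by
  simp [kap, kr, h]

variable {F : Type*} [NormedAddCommGroup F] [NormedSpace ℝ F]

/-- mollification -/
def mol (δ : ℝ) (f : Cn n → F) (x : Cn n) : F := ∫ t, kap δ (x - t) • f t

lemma mol_conv (δ : ℝ) (f : Cn n → F) :
    mol δ f = convolution f (kap δ) (ContinuousLinearMap.lsmul ℝ ℝ).flip volume := by
  funext x; rfl

lemma mol_eq (δ : ℝ) (f : Cn n → F) (x : Cn n) : mol δ f x = ∫ t, kap δ t • f (x - t) := by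
  rw [mol, ← integral_sub_left_eq_self (fun t => kap δ (x - t) • f t) volume x]
  simp

lemma mol_cd {δ : ℝ} (hδ : 0 < δ) {f : Cn n → F} (hf : LocallyIntegrable f) :
    ContDiff ℝ (⊤ : ℕ∞) (mol δ f) := by
  rw [mol_conv]
  exact (kap_cs hδ).contDiff_convolution_right _ hf (kap_cd δ)

lemma mol_zero {δ : ℝ} (hδ : 0 < δ) {f : Cn n → F} {x : Cn n} (h : ∀ t ∈ ball x δ, f t = 0) :
    mol δ f x = 0 := by
  rw [mol]
  refine integral_eq_zero_of_ae (Filter.Eventually.of_forall fun t => ?_)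
  by_cases ht : t ∈ ball x δ
  · simp [h t ht]
  · simp only [mem_ball, not_lt, dist_comm, dist_eq_norm] at ht
    simp [kap_zero hδ ht]

lemma mol_fderiv [CompleteSpace F] {δ : ℝ} (hδ : 0 < δ) {f : Cn n → F} (hf : LocallyIntegrable f) (x v : Cn n) :
    fderiv ℝ (mol δ f) x v = ∫ t, fderiv ℝ (kap δ) (x - t) v • f t := by
  have h := (kap_cs (n := n) hδ).hasFDerivAt_convolution_right (ContinuousLinearMap.lsmul ℝ ℝ (E := F)).flip hf
    ((kap_cd δ).of_le (by exact_mod_cast le_top)) x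
  rw [mol_conv, h.fderiv, convolution_precompR_apply _ hf ((kap_cs hδ).fderiv ℝ)
    ((kap_cd δ).continuous_fderiv (by simp))]
  rfl

lemma li_int {f h : Cn n → ℂ} (hf : LocallyIntegrable f) (hh : Continuous h)
    (hc : HasCompactSupport h) : Integrable (fun t => f t * h t) :=
  (hf.integrable_smul_left_of_hasCompactSupport hh hc).congr
    (Filter.Eventually.of_forall fun t => by simp [mul_comm])

/-- the kernel as a test function -/
abbrev kt (δ : ℝ) (x t : Cn n) : ℂ := ((kap δ (x - t) : ℝ) : ℂ)

lemma kt_cd (δ : ℝ) (x : Cn n) : ContDiff ℝ 2 (kt δ x) := by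
  refine Complex.ofRealCLM.contDiff.comp (((kap_cd δ).of_le ?_).comp (contDiff_const.sub contDiff_id))
  exact two_le_top

lemma kt_zero {δ : ℝ} (hδ : 0 < δ) (x : Cn n) : ∀ t ∉ closedBall x δ, kt δ x t = 0 := by
  intro t ht
  simp only [mem_closedBall, not_le, dist_comm, dist_eq_norm] at ht
  simp [kt, kap_zero hδ ht.le]

lemma kt_cs {δ : ℝ} (hδ : 0 < δ) (x : Cn n) : HasCompactSupport (kt δ x) :=
  HasCompactSupport.intro (isCompact_closedBall x δ) (kt_zero hδ x)

lemma mol_kt (δ : ℝ) (f : Cn n → ℂ) (x : Cn n) : mol δ f x = ∫ t, f t * kt δ x t := by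
  simp [mol, kt, mul_comm]

lemma kt_fderiv (δ : ℝ) (x t v : Cn n) :
    fderiv ℝ (kt δ x) t v = - ((fderiv ℝ (kap δ) (x - t) v : ℝ) : ℂ) := by
  have hk : DifferentiableAt ℝ (kap δ) (x - t) := (kap_cd δ).differentiable (by simp) _
  have h1 : HasFDerivAt (fun t => kap δ (x - t)) (-(fderiv ℝ (kap δ) (x - t))) t := by
    have := hk.hasFDerivAt.comp t ((hasFDerivAt_const x t).sub (hasFDerivAt_id t))
    have e : (fderiv ℝ (kap δ) (x - t)).comp ((0 : Cn n →L[ℝ] Cn n) - ContinuousLinearMap.id ℝ (Cn n))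
        = -(fderiv ℝ (kap δ) (x - t)) := by ext v; simp
    exact e ▸ this
  have := fderiv_toC (fun t => kap δ (x - t)) t v h1.differentiableAt
  rw [h1.fderiv] at this
  simpa [kt, toC] using this

lemma mol_fderiv_kt {δ : ℝ} (hδ : 0 < δ) {f : Cn n → ℂ} (hf : LocallyIntegrable f) (x v : Cn n) :
    Integrable (fun t => f t * fderiv ℝ (kt δ x) t v) ∧
    fderiv ℝ (mol δ f) x v = - ∫ t, f t * fderiv ℝ (kt δ x) t v := by
  constructor
  · refine li_int hf (((kt_cd δ x).continuous_fderiv (by simp)).clm_apply continuous_const) ?_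
    exact (kt_cs hδ x).fderiv_apply ℝ v
  · rw [mol_fderiv hδ hf, ← integral_neg]
    congr 1; funext t; rw [kt_fderiv]; simp [mul_comm]

lemma mol_dz {δ : ℝ} (hδ : 0 < δ) {f : Cn n → ℂ} (hf : LocallyIntegrable f) (j : Fin n) (x : Cn n) :
    dz j (mol δ f) x = - ∫ t, f t * dz j (kt δ x) t := by
  obtain ⟨i1, e1⟩ := mol_fderiv_kt hδ hf x (ee j)
  obtain ⟨i2, e2⟩ := mol_fderiv_kt hδ hf x (I • ee j)
  have : (fun t => f t * dz j (kt δ x) t) = fun t => (1/2 : ℂ) * (f t * fderiv ℝ (kt δ x) t (ee j))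
      - (I/2) * (f t * fderiv ℝ (kt δ x) t (I • ee j)) := by funext t; simp only [dz]; ring
  rw [this, integral_sub (i1.const_mul _) (i2.const_mul _), integral_const_mul, integral_const_mul, dz, e1, e2]
  ring

lemma mol_dzb {δ : ℝ} (hδ : 0 < δ) {f : Cn n → ℂ} (hf : LocallyIntegrable f) (j : Fin n) (x : Cn n) :
    dzb j (mol δ f) x = - ∫ t, f t * dzb j (kt δ x) t := by
  obtain ⟨i1, e1⟩ := mol_fderiv_kt hδ hf x (ee j)
  obtain ⟨i2, e2⟩ := mol_fderiv_kt hδ hf x (I • ee j)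
  have : (fun t => f t * dzb j (kt δ x) t) = fun t => (1/2 : ℂ) * (f t * fderiv ℝ (kt δ x) t (ee j))
      + (I/2) * (f t * fderiv ℝ (kt δ x) t (I • ee j)) := by funext t; simp only [dzb]; ring
  rw [this, integral_add (i1.const_mul _) (i2.const_mul _), integral_const_mul, integral_const_mul, dzb, e1, e2]
  ring

end P3

section P4
set_option linter.unusedSectionVars false
variable {F : Type*} [NormedAddCommGroup F] [NormedSpace ℝ F]

lemma kap_lint {δ : ℝ} (hδ : 0 < δ) : ∫⁻ y : Cn n, ENNReal.ofReal (kap δ y) = 1 := by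
  rw [← ofReal_integral_eq_lintegral_ofReal (kap_integrable hδ)
    (Filter.Eventually.of_forall (kap_nonneg hδ)), kap_int hδ, ENNReal.ofReal_one]

lemma kap_meas (δ : ℝ) : Measurable (fun y : Cn n => ENNReal.ofReal (kap δ y)) :=
  ENNReal.measurable_ofReal.comp (kap_cd δ).continuous.measurable

lemma cs_lint {k g : Cn n → ℝ≥0∞} (hk : Measurable k) (hg : AEMeasurable g) :
    (∫⁻ t, k t * g t)^2 ≤ (∫⁻ t, k t) * ∫⁻ t, k t * (g t)^2 := by
  have h := ENNReal.lintegral_mul_le_Lp_mul_Lq volume Real.HolderConjugate.two_two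
    (f := fun t => (k t)^(1/2:ℝ)) (g := fun t => (k t)^(1/2:ℝ) * g t)
    (hk.pow_const _).aemeasurable ((hk.pow_const _).aemeasurable.mul hg)
  have e1 : ∀ t, ((fun t => (k t)^(1/2:ℝ)) * (fun t => (k t)^(1/2:ℝ) * g t)) t = k t * g t := by
    intro t
    simp only [Pi.mul_apply, ← mul_assoc]
    rw [← ENNReal.rpow_add_of_nonneg _ _ (by norm_num) (by norm_num)]; norm_num
  have e2 : ∀ t, ((k t)^(1/2:ℝ))^(2:ℝ) = k t := by
    intro t; rw [← ENNReal.rpow_mul]; norm_num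
  have e3 : ∀ t, ((k t)^(1/2:ℝ) * g t)^(2:ℝ) = k t * (g t)^2 := by
    intro t; rw [ENNReal.mul_rpow_of_nonneg _ _ (by norm_num), e2]; norm_num
  simp only [e1, e2, e3] at h
  calc (∫⁻ t, k t * g t)^2 ≤ ((∫⁻ t, k t) ^ (1/2:ℝ) * (∫⁻ t, k t * (g t)^2)^(1/2:ℝ))^2 := by gcongr
    _ = _ := by
      rw [mul_pow, ← ENNReal.rpow_natCast, ← ENNReal.rpow_natCast, ← ENNReal.rpow_mul, ← ENNReal.rpow_mul]
      norm_num

lemma eLp2 {α : Type*} [MeasurableSpace α] (μ : Measure α) (f : α → F) :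
    eLpNorm f 2 μ = (∫⁻ x, ‖f x‖ₑ^2 ∂μ)^(1/2:ℝ) := by
  rw [eLpNorm_eq_lintegral_rpow_enorm_toReal (by norm_num) (by norm_num)]
  norm_num

lemma young {δ : ℝ} (hδ : 0 < δ) {f : Cn n → F} (hf : AEStronglyMeasurable f) :
    eLpNorm (mol δ f) 2 volume ≤ eLpNorm f 2 volume := by
  rw [eLp2, eLp2]
  refine ENNReal.rpow_le_rpow ?_ (by norm_num)
  have hm : ∀ x : Cn n, Measurable (fun t => ENNReal.ofReal (kap δ (x - t))) := fun x =>
    (kap_meas δ).comp (measurable_const.sub measurable_id)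
  calc ∫⁻ x, ‖mol δ f x‖ₑ^2 ≤ ∫⁻ x, ∫⁻ t, ENNReal.ofReal (kap δ (x - t)) * ‖f t‖ₑ^2 := by
        refine lintegral_mono fun x => ?_
        calc ‖mol δ f x‖ₑ^2 ≤ (∫⁻ t, ENNReal.ofReal (kap δ (x - t)) * ‖f t‖ₑ)^2 := by
              gcongr
              refine (enorm_integral_le_lintegral_enorm _).trans_eq ?_
              congr 1; funext t
              rw [enorm_smul, Real.enorm_of_nonneg (kap_nonneg hδ _)]
          _ ≤ _ := cs_lint (hm x) hf.enorm
          _ = _ := by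
            rw [lintegral_sub_left_eq_self (fun t => ENNReal.ofReal (kap δ t)) x, kap_lint hδ, one_mul]
    _ = ∫⁻ t, ∫⁻ x, ENNReal.ofReal (kap δ (x - t)) * ‖f t‖ₑ^2 := by
        refine lintegral_lintegral_swap ?_
        have m1 : AEMeasurable (fun p : Cn n × Cn n => ENNReal.ofReal (kap δ (p.1 - p.2)))
            (volume.prod volume) := ((kap_meas δ).comp (measurable_fst.sub measurable_snd)).aemeasurable
        have m2 : AEMeasurable (fun p : Cn n × Cn n => ‖f p.2‖ₑ^2) (volume.prod volume) :=
          (hf.comp_snd (μ := volume)).enorm.pow_const 2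
        exact m1.mul m2
    _ = ∫⁻ t, ‖f t‖ₑ^2 := by
        congr 1; funext t
        have m1 : Measurable (fun x : Cn n => ENNReal.ofReal (kap δ (x - t))) :=
          (kap_meas δ).comp (measurable_id.sub measurable_const)
        rw [lintegral_mul_const _ m1,
          lintegral_sub_right_eq_self (fun x => ENNReal.ofReal (kap δ x)) t, kap_lint hδ, one_mul]

lemma mol_int [CompleteSpace F] {δ : ℝ} (hδ : 0 < δ) {f : Cn n → F} (hf : LocallyIntegrable f) (x : Cn n) :
    Integrable (fun t => kap δ (x - t) • f t) := by
  refine hf.integrable_smul_left_of_hasCompactSupport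
    ((kap_cd δ).continuous.comp (continuous_const.sub continuous_id)) ?_
  refine HasCompactSupport.intro (isCompact_closedBall x δ) fun t ht => ?_
  simp only [mem_closedBall, not_le, dist_comm, dist_eq_norm] at ht
  exact kap_zero hδ ht.le

lemma mol_sub [CompleteSpace F] {δ : ℝ} (hδ : 0 < δ) {f g : Cn n → F} (hf : LocallyIntegrable f)
    (hg : LocallyIntegrable g) : mol δ (f - g) = mol δ f - mol δ g := by
  funext x
  simp only [mol, Pi.sub_apply, smul_sub]
  exact integral_sub (mol_int hδ hf x) (mol_int hδ hg x)

lemma kap_int_x {δ : ℝ} (hδ : 0 < δ) (x : Cn n) : ∫ t, kap δ (x - t) = 1 := by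
  rw [integral_sub_left_eq_self (fun t => kap δ t) volume x, kap_int hδ]

lemma mol_close [CompleteSpace F] {δ η : ℝ} (hδ : 0 < δ) {f : Cn n → F} (hf : LocallyIntegrable f) {x : Cn n} {c : F}
    (h : ∀ t ∈ ball x δ, ‖f t - c‖ ≤ η) : ‖mol δ f x - c‖ ≤ η := by
  have e : mol δ f x - c = ∫ t, kap δ (x - t) • (f t - c) := by
    simp only [smul_sub]
    rw [integral_sub (mol_int hδ hf x)]
    · rw [integral_smul_const, kap_int_x hδ, one_smul]; rfl
    · exact mol_int hδ (locallyIntegrable_const c) x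
  rw [e]
  have i : Integrable (fun t => kap δ (x - t) * η) := ((kap_integrable hδ).comp_sub_left x).mul_const _
  calc _ ≤ ∫ t, kap δ (x - t) * η := by
        refine norm_integral_le_of_norm_le i (Filter.Eventually.of_forall fun t => ?_)
        rw [norm_smul, Real.norm_of_nonneg (kap_nonneg hδ _)]
        by_cases ht : t ∈ ball x δ
        · exact mul_le_mul_of_nonneg_left (h t ht) (kap_nonneg hδ _)
        · simp only [mem_ball, not_lt, dist_comm, dist_eq_norm] at ht
          simp [kap_zero hδ ht]
    _ = η := by rw [integral_mul_const, kap_int_x hδ, one_mul]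

lemma li_of_L2 {f : Cn n → F} (hf : MemLp f 2) : LocallyIntegrable f :=
  hf.locallyIntegrable (by norm_num)

lemma mol_L2 [CompleteSpace F] {f : Cn n → F} (hf : MemLp f 2) :
    Filter.Tendsto (fun δ => eLpNorm (mol δ f - f) 2 volume) (nhdsWithin 0 (Ioi 0)) (nhds 0) := by
  rw [ENNReal.tendsto_nhds_zero]
  intro e he
  have he3 : e / 3 ≠ 0 := by simp [he.ne']
  obtain ⟨g, gcs, hfg, gc, gL⟩ := hf.exists_hasCompactSupport_eLpNorm_sub_le (by norm_num) he3
  obtain ⟨R, hR⟩ := gcs.isBounded.subset_closedBall (0 : Cn n)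
  set B := closedBall (0 : Cn n) (R+1)
  have hB : volume B ≠ ∞ := (isCompact_closedBall _ _).measure_lt_top.ne
  obtain ⟨η, hη, hηe⟩ : ∃ η : ℝ, 0 < η ∧ volume B ^ (1/2:ℝ) * ENNReal.ofReal η ≤ e/3 := by
    by_cases h0 : volume B ^ (1/2:ℝ) = 0
    · exact ⟨1, one_pos, by rw [h0]; simp⟩
    have ht : volume B ^ (1/2:ℝ) ≠ ∞ := ENNReal.rpow_ne_top_of_nonneg (by norm_num) hB
    have h2 : (0 : ℝ≥0∞) < min 1 (e/3 / volume B ^ (1/2:ℝ)) :=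
      lt_min one_pos (ENNReal.div_pos he3 ht)
    refine ⟨(min 1 (e/3 / volume B ^ (1/2:ℝ))).toReal, ENNReal.toReal_pos h2.ne' ?_, ?_⟩
    · exact ((min_le_left _ _).trans_lt ENNReal.one_lt_top).ne
    · rw [ENNReal.ofReal_toReal ((min_le_left _ _).trans_lt ENNReal.one_lt_top).ne]
      calc _ ≤ volume B ^ (1/2:ℝ) * (e/3 / volume B ^ (1/2:ℝ)) := by gcongr; exact min_le_right _ _
        _ = e/3 := ENNReal.mul_div_cancel h0 ht
  have huc := gcs.uniformContinuous_of_continuous gc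
  obtain ⟨d, hd, hgd⟩ := Metric.uniformContinuous_iff.1 huc η hη
  filter_upwards [Ioo_mem_nhdsGT (lt_min hd one_pos)] with δ hδ
  have hδ0 : 0 < δ := hδ.1
  have hδd : δ < d := hδ.2.trans_le (min_le_left _ _)
  have hδ1 : δ < 1 := hδ.2.trans_le (min_le_right _ _)
  have gli := gc.locallyIntegrable (μ := volume)
  have fli := li_of_L2 hf
  have b2 : eLpNorm (mol δ g - g) 2 volume ≤ e/3 := by
    have hs : Function.support (mol δ g - g) ⊆ B := by
      intro x hx
      by_contra hxB
      simp only [B, mem_closedBall, dist_zero_right, not_le] at hxB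
      refine hx ?_
      have g0 : ∀ t ∈ ball x δ, g t = 0 := by
        intro t ht
        by_contra hgt
        have := hR (subset_tsupport _ hgt)
        simp only [mem_closedBall, dist_zero_right] at this
        rw [mem_ball, dist_comm, dist_eq_norm] at ht
        have := norm_sub_norm_le x t
        linarith
      simp [mol_zero hδ0 g0, g0 x (mem_ball_self hδ0)]
    rw [← eLpNorm_restrict_eq_of_support_subset hs]
    refine (eLpNorm_le_of_ae_bound (C := η) (Filter.Eventually.of_forall fun x => ?_)).trans ?_
    · refine mol_close hδ0 gli fun t ht => ?_
      rw [← dist_eq_norm]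
      exact (hgd (lt_trans ht hδd)).le
    · simpa using hηe
  have hfgm : AEStronglyMeasurable (f - g) := hf.1.sub gL.1
  have b1 : eLpNorm (mol δ (f - g)) 2 volume ≤ e/3 := (young hδ0 hfgm).trans hfg
  have b3 : eLpNorm (g - f) 2 volume ≤ e/3 := by rw [eLpNorm_sub_comm]; exact hfg
  have e1 : mol δ f - f = mol δ (f - g) + ((mol δ g - g) + (g - f)) := by
    rw [mol_sub hδ0 fli gli]; abel
  have mg := (mol_cd hδ0 gli).continuous.aestronglyMeasurable (μ := volume)
  have mf : AEStronglyMeasurable (mol δ (f - g)) :=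
    (mol_cd hδ0 (fli.sub gli)).continuous.aestronglyMeasurable
  rw [e1]
  calc _ ≤ e/3 + (e/3 + e/3) := by
        refine (eLpNorm_add_le mf ((mg.sub gL.1).add (gL.1.sub hf.1)) (by norm_num)).trans ?_
        refine add_le_add b1 ?_
        exact (eLpNorm_add_le (mg.sub gL.1) (gL.1.sub hf.1) (by norm_num)).trans (add_le_add b2 b3)
    _ = e := by rw [← add_assoc, ENNReal.add_thirds]

end P4

section P5

open Filter (Tendsto atTop)

/-- convergence in `L²` -/
def L2t (fm : ℕ → Cn n → ℂ) (f : Cn n → ℂ) : Prop :=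
  (∀ m, MemLp (fm m) 2) ∧ MemLp f 2 ∧ Tendsto (fun m => eLpNorm (fm m - f) 2 volume) atTop (nhds 0)

lemma L2t.int {fm : ℕ → Cn n → ℂ} {f : Cn n → ℂ} (h : L2t fm f) :
    Tendsto (fun m => ∫ x, ‖fm m x‖^2) atTop (nhds (∫ x, ‖f x‖^2)) := by
  obtain ⟨h1, h2, h3⟩ := h
  have e : ∀ {g : Cn n → ℂ} (hg : MemLp g 2), ‖hg.toLp g‖^2 = ∫ x, ‖g x‖^2 := by
    intro g hg
    rw [Lp.norm_toLp, eLp2, ← ENNReal.toReal_pow, ← ENNReal.rpow_natCast, ← ENNReal.rpow_mul]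
    norm_num
    rw [← integral_toReal (hg.1.enorm.pow_const 2)
      (by filter_upwards with x; exact ENNReal.pow_lt_top enorm_lt_top)]
    simp
  have := (Lp.tendsto_Lp_iff_tendsto_eLpNorm'' fm h1 f h2).2 h3
  have := (this.norm).pow 2
  simpa only [e] using this

lemma memLp_bmul {w f : Cn n → ℂ} {M : ℝ} (hw : AEStronglyMeasurable w) (hM : ∀ x, ‖w x‖ ≤ M)
    (hf : MemLp f 2) : MemLp (fun x => w x * f x) 2 :=
  hf.of_le_mul (c := M) (hw.mul hf.1) (Filter.Eventually.of_forall fun x => by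
    rw [norm_mul]; exact mul_le_mul_of_nonneg_right (hM x) (norm_nonneg _))

lemma L2t.bmul {fm : ℕ → Cn n → ℂ} {f w : Cn n → ℂ} {M : ℝ} (hw : AEStronglyMeasurable w)
    (hM : ∀ x, ‖w x‖ ≤ M) (h : L2t fm f) : L2t (fun m x => w x * fm m x) (fun x => w x * f x) := by
  obtain ⟨h1, h2, h3⟩ := h
  refine ⟨fun m => memLp_bmul hw hM (h1 m), memLp_bmul hw hM h2, ?_⟩
  have h4 : Tendsto (fun m => ENNReal.ofReal M * eLpNorm (fm m - f) 2 volume) atTop (nhds 0) := by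
    simpa using ENNReal.Tendsto.const_mul h3 (Or.inr ENNReal.ofReal_ne_top)
  refine tendsto_of_tendsto_of_tendsto_of_le_of_le tendsto_const_nhds h4 (fun _ => zero_le) fun m => ?_
  refine eLpNorm_le_mul_eLpNorm_of_ae_le_mul (Filter.Eventually.of_forall fun x => ?_) 2
  simp only [Pi.sub_apply, ← mul_sub, norm_mul]
  exact mul_le_mul_of_nonneg_right (hM x) (norm_nonneg _)

lemma L2t.sub {fm gm : ℕ → Cn n → ℂ} {f g : Cn n → ℂ} (hf : L2t fm f) (hg : L2t gm g) :
    L2t (fun m x => fm m x - gm m x) (fun x => f x - g x) := by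
  refine ⟨fun m => (hf.1 m).sub (hg.1 m), hf.2.1.sub hg.2.1, ?_⟩
  have h4 : Tendsto (fun m => eLpNorm (fm m - f) 2 volume + eLpNorm (gm m - g) 2 volume) atTop (nhds 0) := by
    simpa using hf.2.2.add hg.2.2
  refine tendsto_of_tendsto_of_tendsto_of_le_of_le tendsto_const_nhds h4 (fun _ => zero_le) fun m => ?_
  have : ((fun x => fm m x - gm m x) - fun x => f x - g x) = (fm m - f) - (gm m - g) := by
    funext x; simp; ring
  simp only [this]
  exact eLpNorm_sub_le ((hf.1 m).1.sub hf.2.1.1) ((hg.1 m).1.sub hg.2.1.1) (by norm_num)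

lemma L2t.zero : L2t (fun _ _ => 0) (fun _ : Cn n => (0:ℂ)) :=
  ⟨fun _ => MemLp.zero', MemLp.zero', by
    have : ((fun _ : Cn n => (0:ℂ)) - fun _ => 0) = 0 := by funext; simp
    simp [this]⟩

lemma L2t.sum {ι : Type*} (s : Finset ι) {fm : ι → ℕ → Cn n → ℂ} {f : ι → Cn n → ℂ}
    (h : ∀ i, L2t (fm i) (f i)) : L2t (fun m x => ∑ i ∈ s, fm i m x) (fun x => ∑ i ∈ s, f i x) := by
  classical
  induction s using Finset.induction_on with
  | empty => simpa using L2t.zero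
  | insert a s ha ih =>
    have := (h a).sub (L2t.zero.sub ih)
    simpa [Finset.sum_insert ha] using this

/-- radii -/
abbrev rad (m : ℕ) : ℝ := 1 / ((m:ℝ) + 1)

lemma rad_pos (m : ℕ) : 0 < rad m := by positivity

lemma memLp_mol {f : Cn n → ℂ} (hf : MemLp f 2) {δ : ℝ} (hδ : 0 < δ) : MemLp (mol δ f) 2 :=
  ⟨(mol_cd hδ (li_of_L2 hf)).continuous.aestronglyMeasurable, (young hδ hf.1).trans_lt hf.2⟩

lemma L2t.mol {f : Cn n → ℂ} (hf : MemLp f 2) : L2t (fun m => mol (rad m) f) f :=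
  ⟨fun m => memLp_mol hf (rad_pos m), hf, (mol_L2 hf).comp (tendsto_nhdsWithin_iff.2
    ⟨tendsto_one_div_add_atTop_nhds_zero_nat, Filter.Eventually.of_forall rad_pos⟩)⟩

lemma wbd {O K : Set (Cn n)} (hK : IsCompact K) (hKO : K ⊆ O) {w : Cn n → ℂ} (hw : ContinuousOn w O) :
    AEStronglyMeasurable (K.indicator w) ∧ ∃ M, ∀ x, ‖K.indicator w x‖ ≤ M := by
  have hc := hw.mono hKO
  constructor
  · exact (aestronglyMeasurable_indicator_iff hK.measurableSet).2
      (hc.aestronglyMeasurable hK.measurableSet)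
  · obtain ⟨C, hC⟩ := hK.exists_bound_of_continuousOn hc
    refine ⟨max C 0, fun x => ?_⟩
    by_cases hx : x ∈ K
    · simpa [hx] using Or.inl (hC x hx)
    · simp [hx]

lemma lemma1 {O K : Set (Cn n)} (hO : IsOpen O) {φ φ2 q : Cn n → ℝ}
    (hφ : ContDiffOn ℝ 2 φ O) (hφ2 : ContDiffOn ℝ 2 φ2 O) (hq0 : ∀ x, 0 ≤ q x) {Q : ℝ}
    (hqQ : ∀ x, q x ≤ Q) (hqm : Measurable q)
    (hlev : ∀ x ∈ O, ∀ X : Cn n,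
      q x * ‖X‖^2 + 2 * ‖cderiv (fun y => φ y - φ2 y) x X‖^2 ≤ leviForm φ x X)
    {Y : Fin n → Cn n → ℂ} {y0 : Cn n → ℂ} {yy : Fin n → Fin n → Cn n → ℂ}
    (hK : IsCompact K) (hKO : K ⊆ O) (hY : ∀ j, MemLp (Y j) 2) (hY0 : ∀ j, ∀ x ∉ K, Y j x = 0)
    (hy : MemLp y0 2) (hy0 : ∀ x ∉ K, y0 x = 0)
    (hyy : ∀ j k, MemLp (yy j k) 2) (hyy0 : ∀ j k, ∀ x ∉ K, yy j k x = 0)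
    (weak0 : ∀ h : Cn n → ℂ, ContDiff ℝ 2 h → HasCompactSupport h →
      ∑ j, ∫ x, Y j x * dz j h x = - ∫ x, y0 x * h x)
    (weak1 : ∀ j k, ∀ h : Cn n → ℂ, ContDiff ℝ 2 h → HasCompactSupport h →
      (∫ x, Y k x * dzb j h x) - ∫ x, Y j x * dzb k h x = - ∫ x, yy j k x * h x) :
    ∑ j, ∫ x, ‖Y j x‖^2 * (q x * Real.exp (-φ x)) ≤
      2 * (∫ x, ‖y0 x - ∑ j, dz j (toC φ2) x * Y j x‖^2 * Real.exp (-φ x))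
      + 1/2 * ∑ j, ∑ k, ∫ x, ‖yy j k x‖^2 * Real.exp (-φ x) := by
  obtain ⟨r, hr, hrO⟩ := hK.exists_cthickening_subset_open hO hKO
  set K' := cthickening r K with hK'
  have hK'c : IsCompact K' := hK.cthickening
  have hKK' : K ⊆ K' := self_subset_cthickening K
  -- bounded weights
  set w0 : Cn n → ℂ := fun x => ((Real.exp (-φ x / 2) : ℝ) : ℂ) with hw0
  have cw0 : ContinuousOn w0 O := Complex.continuous_ofReal.comp_continuousOn
    ((hφ.continuousOn.neg.div_const 2).rexp)
  have nw0 : ∀ x, ‖w0 x‖^2 = Real.exp (-φ x) := by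
    intro x
    rw [hw0, Complex.norm_real, Real.norm_of_nonneg (Real.exp_pos _).le, ← Real.exp_nat_mul]
    congr 1; push_cast; ring
  have cφ2 : ∀ j, ContinuousOn (dz j (toC φ2)) O := fun j =>
    (dz_contDiffOn (m := 1) j hO (toC_cd (two_of hφ2))).continuousOn
  set w := K'.indicator w0 with hw
  set wj : Fin n → Cn n → ℂ := fun j => K'.indicator (fun x => w0 x * dz j (toC φ2) x) with hwj
  obtain ⟨mw, Mw, bw⟩ := wbd hK'c hrO cw0
  have bj : ∀ j, AEStronglyMeasurable (wj j) ∧ ∃ M, ∀ x, ‖wj j x‖ ≤ M := fun j =>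
    wbd hK'c hrO (cw0.mul (cφ2 j))
  set wq : Cn n → ℂ := fun x => ((Real.sqrt (q x) : ℝ) : ℂ) * w x with hwq
  have mq : AEStronglyMeasurable wq :=
    (Complex.measurable_ofReal.comp hqm.sqrt).aestronglyMeasurable.mul mw
  have bq : ∀ x, ‖wq x‖ ≤ Real.sqrt Q * Mw := by
    intro x
    rw [hwq, norm_mul, Complex.norm_real, Real.norm_of_nonneg (Real.sqrt_nonneg _)]
    exact mul_le_mul (Real.sqrt_le_sqrt (hqQ x)) (bw x) (norm_nonneg _) (Real.sqrt_nonneg _)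
  -- limits
  have tY : ∀ j, L2t (fun m => mol (rad m) (Y j)) (Y j) := fun j => L2t.mol (hY j)
  have t1 : ∀ j, L2t (fun m x => wq x * mol (rad m) (Y j) x) (fun x => wq x * Y j x) :=
    fun j => (tY j).bmul mq bq
  have t2 : L2t (fun m x => w x * mol (rad m) y0 x - ∑ j, wj j x * mol (rad m) (Y j) x)
      (fun x => w x * y0 x - ∑ j, wj j x * Y j x) :=
    ((L2t.mol hy).bmul mw bw).sub (L2t.sum _ fun j => by
      obtain ⟨a, M, b⟩ := bj j
      exact (tY j).bmul a b)
  have t3 : ∀ j k, L2t (fun m x => w x * mol (rad m) (yy j k) x) (fun x => w x * yy j k x) :=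
    fun j k => (L2t.mol (hyy j k)).bmul mw bw
  have T1 := tendsto_finsetSum Finset.univ fun j _ => (t1 j).int
  have T2 := (t2.int.const_mul 2).add ((tendsto_finsetSum Finset.univ fun j _ =>
    tendsto_finsetSum Finset.univ fun k _ => (t3 j k).int).const_mul (1/2))
  have E1 : ∀ j, (fun x => ‖wq x * Y j x‖^2) = fun x => ‖Y j x‖^2 * (q x * Real.exp (-φ x)) := by
    intro j; funext x
    by_cases hx : x ∈ K
    · simp only [hwq, hw, norm_mul, mul_pow, indicator_of_mem (hKK' hx), nw0, Complex.norm_real,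
        Real.norm_of_nonneg (Real.sqrt_nonneg _), Real.sq_sqrt (hq0 x)]
      ring
    · simp [hY0 j x hx]
  have E2 : (fun x => ‖w x * y0 x - ∑ j, wj j x * Y j x‖^2) =
      fun x => ‖y0 x - ∑ j, dz j (toC φ2) x * Y j x‖^2 * Real.exp (-φ x) := by
    funext x
    by_cases hx : x ∈ K
    · have : w x * y0 x - ∑ j, wj j x * Y j x = w0 x * (y0 x - ∑ j, dz j (toC φ2) x * Y j x) := by
        simp only [hw, hwj, indicator_of_mem (hKK' hx), mul_sub, Finset.mul_sum, mul_assoc]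
      rw [this, norm_mul, mul_pow, nw0]; ring
    · simp [hy0 x hx, hY0 _ x hx]
  have E3 : ∀ j k, (fun x => ‖w x * yy j k x‖^2) = fun x => ‖yy j k x‖^2 * Real.exp (-φ x) := by
    intro j k; funext x
    by_cases hx : x ∈ K
    · simp only [hw, norm_mul, mul_pow, indicator_of_mem (hKK' hx), nw0]; ring
    · simp [hyy0 j k x hx]
  simp only [E1, E2, E3] at T1 T2
  refine le_of_tendsto_of_tendsto T1 T2 ?_
  have hev : ∀ᶠ m : ℕ in atTop, rad m < r :=
    (tendsto_order.1 (tendsto_one_div_add_atTop_nhds_zero_nat (𝕜 := ℝ))).2 r hr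
  filter_upwards [hev] with m hm
  set δ := rad m with hδd
  have hδ : 0 < δ := rad_pos m
  set G : Fin n → Cn n → ℂ := fun j => mol δ (Y j) with hGd
  have offK : ∀ {f : Cn n → ℂ}, (∀ x ∉ K, f x = 0) → ∀ x ∉ K', mol δ f x = 0 := by
    intro f hf x hx
    refine mol_zero hδ fun t ht => hf t fun htK => hx ?_
    exact mem_cthickening_of_dist_le x t r K htK ((mem_ball'.1 ht).le.trans hm.le)
  have hG : ∀ j, ContDiff ℝ 2 (G j) := fun j => (mol_cd hδ (li_of_L2 (hY j))).of_le two_le_top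
  have hG0 : ∀ j, ∀ x ∉ K', G j x = 0 := fun j => offK (hY0 j)
  have D0 : ∀ x, ∑ j, dz j (G j) x = mol δ y0 x := by
    intro x
    have := weak0 (kt δ x) (kt_cd δ x) (kt_cs hδ x)
    simp only [hGd, mol_dz hδ (li_of_L2 (hY _)), Finset.sum_neg_distrib, this, mol_kt, neg_neg]
  have D1 : ∀ j k x, dzb j (G k) x - dzb k (G j) x = mol δ (yy j k) x := by
    intro j k x
    have := weak1 j k (kt δ x) (kt_cd δ x) (kt_cs hδ x)
    simp only [hGd, mol_dzb hδ (li_of_L2 (hY _)), mol_kt]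
    linear_combination -this
  obtain ⟨b1, b2, b3, b4⟩ := bochner hO hφ hG hK'c hrO hG0
  -- pointwise inequality
  have iw2 : Integrable (fun x => ‖w x * mol δ y0 x - ∑ j, wj j x * G j x‖^2) :=
    (t2.1 m).integrable_norm_pow (by norm_num)
  have b12 : Integrable (fun x => leviForm φ x (vec G x) * Real.exp (-φ x) - ‖∑ j, del φ j (G j) x‖^2 * Real.exp (-φ x)) := b1.sub b2
  have iw1 : ∀ j, Integrable (fun x => ‖wq x * mol δ (Y j) x‖^2) := fun j => ((t1 j).1 m).integrable_norm_pow (by norm_num)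
  have iw3 : ∀ j k, Integrable (fun x => ‖w x * mol δ (yy j k) x‖^2) := fun j k => ((t3 j k).1 m).integrable_norm_pow (by norm_num)
  have F2 : ∀ x ∈ K', w x * mol δ y0 x - ∑ j, wj j x * G j x = w0 x * ∑ j, del φ2 j (G j) x := by
    intro x hx
    simp only [hw, hwj, indicator_of_mem hx, del, Finset.sum_sub_distrib, D0, mul_sub, Finset.mul_sum, mul_assoc]
  have c1 : ∑ j, ∫ x, ‖wq x * G j x‖^2 ≤
      (∫ x, leviForm φ x (vec G x) * Real.exp (-φ x)) - (∫ x, ‖∑ j, del φ j (G j) x‖^2 * Real.exp (-φ x))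
      + 2 * ∫ x, ‖w x * mol δ y0 x - ∑ j, wj j x * G j x‖^2 := by
    rw [← integral_finsetSum _ fun j _ => iw1 j, ← integral_sub b1 b2, ← integral_const_mul,
      ← integral_add b12 (iw2.const_mul 2)]
    refine integral_mono (integrable_finsetSum _ fun j _ => iw1 j)
      (b12.add (iw2.const_mul 2)) fun x => ?_
    by_cases hx : x ∈ K'
    · have hxO := hrO hx
      have hl := hlev x hxO (vec G x)
      have hd1 : DifferentiableAt ℝ φ x := diffAt_of hO (by simp) hφ hxO
      have hd2 : DifferentiableAt ℝ φ2 x := diffAt_of hO (by simp) hφ2 hxO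
      have ecd : cderiv (fun y => φ y - φ2 y) x (vec G x) =
          ∑ j, (dz j (toC φ) x - dz j (toC φ2) x) * G j x := by
        rw [cderiv_eq _ (hd1.fun_sub hd2)]
        refine Finset.sum_congr rfl fun j _ => ?_
        rw [← dz_sub j (diffAt_of hO (by simp) (toC_cd hφ) hxO) (diffAt_of hO (by simp) (toC_cd hφ2) hxO)]
        congr 2; funext y; simp [toC]
      have edel : ∑ j, del φ j (G j) x = ∑ j, del φ2 j (G j) x - cderiv (fun y => φ y - φ2 y) x (vec G x) := by
        rw [ecd, ← Finset.sum_sub_distrib]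
        refine Finset.sum_congr rfl fun j _ => ?_
        simp only [del]; ring
      have en : ‖∑ j, del φ j (G j) x‖^2 ≤ 2 * ‖∑ j, del φ2 j (G j) x‖^2
          + 2 * ‖cderiv (fun y => φ y - φ2 y) x (vec G x)‖^2 := by
        rw [edel]
        have := norm_sub_le (∑ j, del φ2 j (G j) x) (cderiv (fun y => φ y - φ2 y) x (vec G x))
        have h0 := norm_nonneg (∑ j, del φ2 j (G j) x - cderiv (fun y => φ y - φ2 y) x (vec G x))
        nlinarith [sq_nonneg (‖∑ j, del φ2 j (G j) x‖ - ‖cderiv (fun y => φ y - φ2 y) x (vec G x)‖)]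
      have e1 : ∑ j, ‖wq x * G j x‖^2 = q x * ‖vec G x‖^2 * Real.exp (-φ x) := by
        rw [EuclideanSpace.norm_sq_eq, Finset.mul_sum, Finset.sum_mul]
        refine Finset.sum_congr rfl fun j _ => ?_
        simp only [hwq, hw, norm_mul, mul_pow, indicator_of_mem hx, nw0, Complex.norm_real,
          Real.norm_of_nonneg (Real.sqrt_nonneg _), Real.sq_sqrt (hq0 x)]
        ring
      change ∑ j, ‖wq x * G j x‖^2 ≤ leviForm φ x (vec G x) * Real.exp (-φ x) - ‖∑ j, del φ j (G j) x‖^2 * Real.exp (-φ x) +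
        2 * ‖w x * mol δ y0 x - ∑ j, wj j x * G j x‖^2
      rw [e1, F2 x hx, norm_mul, mul_pow, nw0]
      have he := Real.exp_pos (-φ x)
      nlinarith
    · have hv : vec G x = 0 := by ext j; simp [hG0 j x hx]
      change ∑ j, ‖wq x * G j x‖^2 ≤ leviForm φ x (vec G x) * Real.exp (-φ x) - ‖∑ j, del φ j (G j) x‖^2 * Real.exp (-φ x) +
        2 * ‖w x * mol δ y0 x - ∑ j, wj j x * G j x‖^2
      rw [hv]
      simp [hG0 _ x hx, del, dz_zero_off _ hK'c.isClosed (hG0 _) x hx, leviForm, offK hy0 x hx]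
  have c3 : ∫ x, (∑ j, ∑ k, ‖dzb j (G k) x - dzb k (G j) x‖^2) * Real.exp (-φ x) =
      ∑ j, ∑ k, ∫ x, ‖w x * mol δ (yy j k) x‖^2 := by
    have : ∀ x, (∑ j, ∑ k, ‖dzb j (G k) x - dzb k (G j) x‖^2) * Real.exp (-φ x)
        = ∑ j, ∑ k, ‖w x * mol δ (yy j k) x‖^2 := by
      intro x
      simp only [D1, Finset.sum_mul]
      refine Finset.sum_congr rfl fun j _ => Finset.sum_congr rfl fun k _ => ?_
      by_cases hx : x ∈ K'
      · simp only [hw, norm_mul, mul_pow, indicator_of_mem hx, nw0]; ring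
      · simp [offK (hyy0 j k) x hx]
    simp only [this]
    rw [integral_finsetSum _ fun j _ => integrable_finsetSum _ fun k _ => iw3 j k]
    refine Finset.sum_congr rfl fun j _ => ?_
    rw [integral_finsetSum _ fun k _ => iw3 j k]
  rw [c3] at b4
  change ∑ j, ∫ x, ‖wq x * G j x‖^2 ≤ 2 * (∫ x, ‖w x * mol δ y0 x - ∑ j, wj j x * G j x‖^2) +
    1/2 * ∑ j, ∑ k, ∫ x, ‖w x * mol δ (yy j k) x‖^2
  linarith

end P5

section P6
open Filter (Tendsto atTop)

lemma hasDerivAt_pos (k : ℕ) (x : ℝ) :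
    HasDerivAt (fun x : ℝ => (max x 0)^(k+2)) (((k+2 : ℕ):ℝ) * (max x 0)^(k+1)) x := by
  have key : ∀ y : ℝ, y ≠ 0 → HasDerivAt (fun x : ℝ => (max x 0)^(k+2)) (((k+2 : ℕ):ℝ) * (max y 0)^(k+1)) y := by
    intro y hy
    rcases lt_or_gt_of_ne hy with h | h
    · have : (fun x : ℝ => (max x 0)^(k+2)) =ᶠ[nhds y] fun _ => 0 := by
        filter_upwards [gt_mem_nhds h] with x hx
        simp [max_eq_right hx.le]
      simpa [max_eq_right h.le] using (hasDerivAt_const y (0:ℝ)).congr_of_eventuallyEq this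
    · have : (fun x : ℝ => (max x 0)^(k+2)) =ᶠ[nhds y] fun x => x^(k+2) := by
        filter_upwards [lt_mem_nhds h] with x hx
        rw [max_eq_left hx.le]
      simpa [max_eq_left h.le] using (hasDerivAt_pow (k+2) y).congr_of_eventuallyEq this
  by_cases hx : x = 0
  · subst hx
    exact hasDerivAt_of_hasDerivAt_of_ne (g := fun y => ((k+2 : ℕ):ℝ) * (max y 0)^(k+1)) key
      (by fun_prop) (by fun_prop)
  · exact key x hx

/-- truncated cube -/
def pc (x : ℝ) : ℝ := (max x 0)^3

lemma pc_d (x : ℝ) : HasDerivAt pc (3 * (max x 0)^2) x := by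
  have := hasDerivAt_pos 1 x
  norm_num at this
  exact this
lemma pc_dd (x : ℝ) : HasDerivAt (fun x => 3 * (max x 0)^2) (6 * max x 0) x := by
  have := (hasDerivAt_pos 0 x).const_mul 3
  have e : 3 * (((0+2:ℕ):ℝ) * max x 0 ^ (0+1)) = 6 * max x 0 := by push_cast; ring
  exact e ▸ this
lemma pc_cd : ContDiff ℝ 2 pc := by
  have e1 : deriv pc = fun x => 3 * (max x 0)^2 := funext fun x => (pc_d x).deriv
  have e2 : deriv (fun x : ℝ => 3 * (max x 0)^2) = fun x => 6 * max x 0 := funext fun x => (pc_dd x).deriv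
  have h1 : ContDiff ℝ 1 (fun x : ℝ => 3 * (max x 0)^2) := by
    rw [contDiff_one_iff_deriv, e2]
    exact ⟨fun x => (pc_dd x).differentiableAt, by fun_prop⟩
  rw [show (2 : WithTop ℕ∞) = 1 + 1 by norm_num, contDiff_succ_iff_deriv, e1]
  exact ⟨fun x => (pc_d x).differentiableAt, by simp, h1⟩
lemma pc_nonneg (x : ℝ) : 0 ≤ pc x := by unfold pc; positivity
lemma pc_neg {x : ℝ} (h : x ≤ 0) : pc x = 0 := by simp [pc, max_eq_right h]

lemma fderiv_chain {P : ℝ → ℝ} {p' : ℝ} {τ : Cn n → ℝ} {x : Cn n} (hP : HasDerivAt P p' (τ x))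
    (hτ : DifferentiableAt ℝ τ x) (v : Cn n) :
    fderiv ℝ (fun y => P (τ y)) x v = p' * fderiv ℝ τ x v := by
  have := (hP.comp_hasFDerivAt x hτ.hasFDerivAt).fderiv
  have e : fderiv ℝ (P ∘ τ) x v = p' * fderiv ℝ τ x v := by rw [this]; simp
  exact e

lemma levi_chain' {P P' : ℝ → ℝ} {q : ℝ} {τ : Cn n → ℝ} {x : Cn n}
    (h1 : ∀ᶠ t in nhds (τ x), HasDerivAt P (P' t) t) (h2 : HasDerivAt P' q (τ x))
    (hτ : ContDiffAt ℝ 2 τ x) (X : Cn n) :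
    leviForm (fun y => P (τ y)) x X = P' (τ x) * leviForm τ x X + q * ‖cderiv τ x X‖^2 := by
  have ev : ∀ᶠ y in nhds x, DifferentiableAt ℝ τ y := by
    filter_upwards [hτ.eventually (by simp)] with y hy
    exact hy.differentiableAt (by simp)
  have key : ∀ v : Cn n, fderiv ℝ (fun w => fderiv ℝ (fun y => P (τ y)) w v) x v =
      q * (fderiv ℝ τ x v)^2 + P' (τ x) * fderiv ℝ (fun w => fderiv ℝ τ w v) x v := by
    intro v
    have e : (fun w => fderiv ℝ (fun y => P (τ y)) w v) =ᶠ[nhds x]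
        fun w => P' (τ w) * fderiv ℝ τ w v := by
      filter_upwards [ev, hτ.continuousAt.eventually h1] with y hy hy'
      exact fderiv_chain hy' hy v
    rw [e.fderiv_eq, fderiv_fun_mul (c := fun w => P' (τ w))
      (h2.differentiableAt.comp x (hτ.differentiableAt (by simp))) (diff_fapp hτ v)]
    simp only [add_apply, smul_apply, smul_eq_mul]
    have := fderiv_chain h2 (hτ.differentiableAt (by simp)) v
    rw [this]; ring
  have hc : ‖cderiv τ x X‖^2 = ((fderiv ℝ τ x X)^2 + (fderiv ℝ τ x (I • X))^2)/4 := by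
    rw [← Complex.normSq_eq_norm_sq, cderiv, Complex.normSq_apply]
    simp; ring
  rw [hc]; unfold leviForm
  rw [key X, key (I • X)]; ring

lemma levi_chain {P P' P'' : ℝ → ℝ} {τ : Cn n → ℝ} {x : Cn n}
    (h1 : ∀ t, HasDerivAt P (P' t) t) (h2 : ∀ t, HasDerivAt P' (P'' t) t)
    (hτ : ContDiffAt ℝ 2 τ x) (X : Cn n) :
    leviForm (fun y => P (τ y)) x X = P' (τ x) * leviForm τ x X + P'' (τ x) * ‖cderiv τ x X‖^2 :=
  levi_chain' (Filter.Eventually.of_forall h1) (h2 _) hτ X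

lemma levi_add {a b : Cn n → ℝ} {x : Cn n} (ha : ContDiffAt ℝ 2 a x) (hb : ContDiffAt ℝ 2 b x)
    (X : Cn n) : leviForm (fun y => a y + b y) x X = leviForm a x X + leviForm b x X := by
  have key : ∀ v : Cn n, fderiv ℝ (fun w => fderiv ℝ (fun y => a y + b y) w v) x v =
      fderiv ℝ (fun w => fderiv ℝ a w v) x v + fderiv ℝ (fun w => fderiv ℝ b w v) x v := by
    intro v
    have e : (fun w => fderiv ℝ (fun y => a y + b y) w v) =ᶠ[nhds x]
        fun w => fderiv ℝ a w v + fderiv ℝ b w v := by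
      filter_upwards [ha.eventually (by simp), hb.eventually (by simp)] with y h1 h2
      rw [fderiv_fun_add (h1.differentiableAt (by simp)) (h2.differentiableAt (by simp))]; rfl
    rw [e.fderiv_eq, fderiv_fun_add (diff_fapp ha v) (diff_fapp hb v)]; rfl
  unfold leviForm; rw [key, key]; ring

lemma levi_sq {ψ : Cn n → ℝ} {x : Cn n} (h : ContDiffAt ℝ 2 ψ x) (X : Cn n) :
    leviForm (fun y => ψ y ^2) x X = 2 * ψ x * leviForm ψ x X + 2 * ‖cderiv ψ x X‖^2 := by
  have := levi_chain (P := fun t => t^2) (P' := fun t => 2 * t) (P'' := fun _ => 2)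
    (fun t => by simpa using hasDerivAt_pow 2 t) (fun t => by simpa using (hasDerivAt_id t).const_mul 2) h X
  exact this

lemma dz_chain {P : ℝ → ℝ} {p' : ℝ} {τ : Cn n → ℝ} {x : Cn n} (j : Fin n) (hP : HasDerivAt P p' (τ x))
    (hτ : DifferentiableAt ℝ τ x) :
    dz j (toC (fun y => P (τ y))) x = p' * dz j (toC τ) x := by
  have hd : DifferentiableAt ℝ (fun y => P (τ y)) x := hP.differentiableAt.comp x hτ
  unfold dz
  rw [fderiv_toC _ _ _ hd, fderiv_toC _ _ _ hd, fderiv_toC _ _ _ hτ, fderiv_toC _ _ _ hτ,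
    fderiv_chain hP hτ, fderiv_chain hP hτ]
  push_cast; ring

lemma dzb_toC (j : Fin n) (τ : Cn n → ℝ) (x : Cn n) : dzb j (toC τ) x = conj (dz j (toC τ) x) := by
  rw [← dzb_conj]; simp [toC]

/-- derivative bound of the transition function -/
lemma st_bd : ∃ C : ℝ, ∀ x, |deriv Real.smoothTransition x| ≤ C := by
  have hc : Continuous (deriv Real.smoothTransition) :=
    (Real.smoothTransition.contDiff (n := 1)).continuous_deriv (by simp)
  obtain ⟨C, hC⟩ := (isCompact_Icc (a := (0:ℝ)) (b := 1)).exists_bound_of_continuousOn hc.continuousOn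
  refine ⟨max C 0, fun x => ?_⟩
  by_cases hx : x ∈ Icc (0:ℝ) 1
  · exact (hC x hx).trans (le_max_left _ _)
  · rw [show deriv Real.smoothTransition x = 0 from ?_]; · simp
    rw [mem_Icc, not_and_or] at hx
    rcases hx with h | h
    · have : Real.smoothTransition =ᶠ[nhds x] fun _ => 0 := by
        filter_upwards [gt_mem_nhds (not_le.1 h)] with y hy
        exact Real.smoothTransition.zero_of_nonpos hy.le
      rw [this.deriv_eq]; simp
    · have : Real.smoothTransition =ᶠ[nhds x] fun _ => 1 := by
        filter_upwards [lt_mem_nhds (not_le.1 h)] with y hy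
        exact Real.smoothTransition.one_of_one_le hy.le
      rw [this.deriv_eq]; simp

end P6

section P7
open Filter (Tendsto atTop)

abbrev Hs (n : ℕ) := PiLp 2 (fun _ : Fin n => Lp ℂ 2 (volume : Measure (Cn n)))

def mkH (f : Fin n → Cn n → ℂ) (hf : ∀ j, MemLp (f j) 2) : Hs n :=
  WithLp.toLp 2 fun j => (hf j).toLp (f j)

lemma mkH_inner {f g : Fin n → Cn n → ℂ} (hf : ∀ j, MemLp (f j) 2) (hg : ∀ j, MemLp (g j) 2) :
    inner ℂ (mkH f hf) (mkH g hg) = ∑ j, ∫ x, conj (f j x) * g j x := by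
  rw [PiLp.inner_apply]
  refine Finset.sum_congr rfl fun j _ => ?_
  rw [L2.inner_def]
  refine integral_congr_ae ?_
  filter_upwards [(hf j).coeFn_toLp, (hg j).coeFn_toLp] with x h1 h2
  simp only [mkH, h1, h2, RCLike.inner_apply]; ring

lemma mkH_surj (F : Hs n) : ∃ f hf, F = mkH f hf := by
  refine ⟨fun j => F j, fun j => Lp.memLp _, ?_⟩
  ext1 j
  simp [mkH]

lemma memLp_mulint {f g : Cn n → ℂ} (hf : MemLp f 2) (hg : MemLp g 2) :
    Integrable (fun x => f x * g x) := hf.integrable_mul hg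

lemma memLp_conj {f : Cn n → ℂ} (hf : MemLp f 2) : MemLp (fun x => conj (f x)) 2 :=
  hf.of_le (Complex.continuous_conj.comp_aestronglyMeasurable hf.1) (by simp)

lemma memLp_off {f : Cn n → ℂ} {O K : Set (Cn n)} (hO : IsOpen O)
    (hc : ContinuousOn f O) (hK : IsCompact K) (hKO : K ⊆ O) (h0 : ∀ x ∉ K, f x = 0) : MemLp f 2 :=
  (cont_off hO hc hK hKO h0).1.memLp_of_hasCompactSupport (cont_off hO hc hK hKO h0).2

/-- generators of the test space -/
def tfun (s : Cn n → ℝ) (h : Cn n → ℂ) (j k : Fin n) (i : Fin n) (x : Cn n) : ℂ :=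
  conj ((s x : ℂ) * ((if i = j then dzb k h x else 0) - (if i = k then dzb j h x else 0)))

/-- admissible test functions -/
def Tst (D : Set (Cn n)) (h : Cn n → ℂ) : Prop :=
  ContDiff ℝ 2 h ∧ ∃ K, IsCompact K ∧ K ⊆ D ∧ ∀ x ∉ K, h x = 0

lemma Tst.dzb {D : Set (Cn n)} {h : Cn n → ℂ} (hh : Tst D h) (j : Fin n) {s : Cn n → ℂ} (hD : IsOpen D)
    (hs : ContinuousOn s D) : MemLp (fun x => s x * dzb j h x) 2 := by
  obtain ⟨h1, K, hK, hKD, h0⟩ := hh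
  refine memLp_off hD (hs.mul (dzb_contDiff j (two_of' h1)).continuous.continuousOn) hK hKD fun x hx => ?_
  rw [dzb_zero_off j hK.isClosed h0 x hx, mul_zero]

lemma Tst.dz {D : Set (Cn n)} {h : Cn n → ℂ} (hh : Tst D h) (j : Fin n) {s : Cn n → ℂ} (hD : IsOpen D)
    (hs : ContinuousOn s D) : MemLp (fun x => s x * dz j h x) 2 := by
  obtain ⟨h1, K, hK, hKD, h0⟩ := hh
  refine memLp_off hD (hs.mul (dz_contDiff j (two_of' h1)).continuous.continuousOn) hK hKD fun x hx => ?_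
  rw [dz_zero_off j hK.isClosed h0 x hx, mul_zero]

lemma Tst.conj {D : Set (Cn n)} {h : Cn n → ℂ} (hh : Tst D h) : Tst D (fun x => conj (h x)) := by
  obtain ⟨h1, K, hK, hKD, h0⟩ := hh
  exact ⟨Complex.conjCLE.contDiff.comp h1, K, hK, hKD, fun x hx => by simp [h0 x hx]⟩

lemma tfun_mem {D : Set (Cn n)} (hD : IsOpen D) {s : Cn n → ℝ} (hs : ContinuousOn s D) {h : Cn n → ℂ}
    (hh : Tst D h) (j k i : Fin n) : MemLp (tfun s h j k i) 2 := by
  have hs' : ContinuousOn (fun x => (s x : ℂ)) D := Complex.continuous_ofReal.comp_continuousOn hs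
  have h1 : MemLp (fun x => (s x : ℂ) * (if i = j then dzb k h x else 0)) 2 := by
    split_ifs
    · exact hh.dzb k hD hs'
    · simp
  have h2 : MemLp (fun x => (s x : ℂ) * (if i = k then dzb j h x else 0)) 2 := by
    split_ifs
    · exact hh.dzb j hD hs'
    · simp
  have := memLp_conj (h1.sub h2)
  simp only [Pi.sub_apply, ← mul_sub] at this
  exact this

lemma tfun_inner {D : Set (Cn n)} (hD : IsOpen D) {s : Cn n → ℝ} (hs : ContinuousOn s D) {h : Cn n → ℂ}
    (hh : Tst D h) (j k : Fin n) {f : Fin n → Cn n → ℂ} (hf : ∀ j, MemLp (f j) 2) :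
    inner ℂ (mkH _ (tfun_mem hD hs hh j k)) (mkH f hf) =
      (∫ x, (s x : ℂ) * dzb k h x * f j x) - ∫ x, (s x : ℂ) * dzb j h x * f k x := by
  have hs' : ContinuousOn (fun x => (s x : ℂ)) D := Complex.continuous_ofReal.comp_continuousOn hs
  rw [mkH_inner, ← integral_finsetSum _ fun i _ => memLp_mulint (memLp_conj (tfun_mem hD hs hh j k i)) (hf i),
    ← integral_sub (memLp_mulint (hh.dzb k hD hs') (hf j)) (memLp_mulint (hh.dzb j hD hs') (hf k))]
  congr 1; funext x
  simp [tfun, mul_sub, sub_mul, Finset.sum_sub_distrib]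

lemma orth_dec {E : Type*} [NormedAddCommGroup E] [InnerProductSpace ℂ E] [CompleteSpace E]
    (M : Submodule ℂ E) (v : E) : ∃ y ∈ Mᗮ, ∃ z ∈ Mᗮᗮ, v = y + z :=
  Mᗮ.exists_add_mem_mem_orthogonal v

lemma proj {D : Set (Cn n)} (hD : IsOpen D) {s : Cn n → ℝ} (hs : ContinuousOn s D) (hs0 : ∀ x, 0 < s x)
    {S : ℝ} (hS : ∀ x ∈ D, (s x)⁻¹ ≤ S)
    {α : Fin n → Cn n → ℂ} (hα : ∀ j, MemLp (α j) 2) (hα0 : ∀ j, ∀ x ∉ D, α j x = 0)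
    (hcl : ∀ h, Tst D h → ∀ j k, ∫ x, α j x * dzb k h x = ∫ x, α k x * dzb j h x)
    {g : Fin n → Cn n → ℂ} (hg : ∀ j, Tst D (g j)) :
    ∃ F : Fin n → Cn n → ℂ, (∀ j, MemLp (F j) 2) ∧
      (∀ h, Tst D h → ∀ j k, ∫ x, (s x : ℂ) * F j x * dzb k h x = ∫ x, (s x : ℂ) * F k x * dzb j h x) ∧
      (∀ v, Tst D v → ∑ j, ∫ x, ((s x : ℂ))⁻¹ * F j x * dz j v x = - ∫ x, conj (∑ j, dzb j (g j) x) * v x) ∧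
      (∑ j, ∫ x, conj (((s x : ℂ))⁻¹ * α j x) * F j x = conj (∑ j, ∫ x, α j x * g j x)) := by
  have hs' : ContinuousOn (fun x => (s x : ℂ)) D := Complex.continuous_ofReal.comp_continuousOn hs
  have sne : ∀ x, (s x : ℂ) ≠ 0 := fun x => by exact_mod_cast (hs0 x).ne'
  have hsi : ContinuousOn (fun x => ((s x : ℂ))⁻¹) D := hs'.inv₀ fun x _ => sne x
  set M : Submodule ℂ (Hs n) := Submodule.span ℂ
    {T | ∃ h, ∃ hh : Tst D h, ∃ j k, T = mkH _ (tfun_mem hD hs hh j k)} with hM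
  have memN : ∀ {f : Fin n → Cn n → ℂ} (hf : ∀ j, MemLp (f j) 2),
      (∀ h, Tst D h → ∀ j k, (∫ x, (s x : ℂ) * dzb k h x * f j x) = ∫ x, (s x : ℂ) * dzb j h x * f k x) →
      mkH f hf ∈ Mᗮ := by
    intro f hf hh
    rw [hM, Submodule.mem_orthogonal]
    intro u hu
    induction hu using Submodule.span_induction with
    | mem x hx =>
      obtain ⟨h, h', j, k, rfl⟩ := hx
      rw [tfun_inner hD hs h' j k, hh h h' j k, sub_self]
    | zero => simp
    | add a b _ _ ha hb => rw [inner_add_left, ha, hb, add_zero]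
    | smul c a _ ha => rw [inner_smul_left, ha, mul_zero]
  have memG : ∀ j, MemLp (fun x => conj (g j x) * s x) 2 := by
    intro j
    obtain ⟨h1, K, hK, hKD, h0⟩ := hg j
    refine memLp_off hD ((Complex.continuous_conj.comp h1.continuous).continuousOn.mul hs') hK hKD fun x hx => ?_
    simp [h0 x hx]
  obtain ⟨y, hy, z, hz, hyz⟩ := orth_dec M (mkH _ memG)
  obtain ⟨F, hF, rfl⟩ := mkH_surj y
  have key : ∀ {f : Fin n → Cn n → ℂ} (hf : ∀ j, MemLp (f j) 2), mkH f hf ∈ Mᗮ →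
      ∑ j, ∫ x, conj (f j x) * F j x = ∑ j, ∫ x, conj (f j x) * (conj (g j x) * s x) := by
    intro f hf hm
    rw [← mkH_inner hf hF, ← mkH_inner hf memG, hyz, inner_add_right,
      Submodule.inner_right_of_mem_orthogonal hm hz, add_zero]
  refine ⟨F, hF, ?_, ?_, ?_⟩
  · intro h hh j k
    have hmem : mkH _ (tfun_mem hD hs hh j k) ∈ M := Submodule.subset_span ⟨h, hh, j, k, rfl⟩
    have := Submodule.inner_right_of_mem_orthogonal hmem hy
    rw [tfun_inner hD hs hh j k, sub_eq_zero] at this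
    simp only [mul_right_comm] at this ⊢
    exact this
  · intro v hv
    have hmv : ∀ j, MemLp (fun x => conj (((s x : ℂ))⁻¹ * dz j v x)) 2 := fun j => memLp_conj (hv.dz j hD hsi)
    have hN : mkH _ hmv ∈ Mᗮ := by
      refine memN hmv fun h hh j k => ?_
      have e : ∀ j k, (∫ x, (s x : ℂ) * dzb k h x * conj (((s x : ℂ))⁻¹ * dz j v x)) =
          - ∫ x, dzb k (dzb j (fun x => conj (v x))) x * h x := by
        intro j k
        obtain ⟨h1, K, hK, hKD, h0⟩ := hh
        rw [← ibp_dzb k isOpen_univ (dzb_contDiff j (two_of' hv.conj.1)).contDiffOn (h1.of_le (by norm_num)) hK (subset_univ _) h0]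
        congr 1; funext x
        rw [dzb_conj, map_mul, map_inv₀, Complex.conj_ofReal]
        field_simp [sne x]
      rw [e, e]
      simp only [dzb_dzb_comm hv.conj.1.contDiffAt j k]
    have := key hmv hN
    have e1 : ∀ j x, conj (conj (((s x : ℂ))⁻¹ * dz j v x)) * F j x = ((s x : ℂ))⁻¹ * F j x * dz j v x := by
      intro j x; rw [Complex.conj_conj]; ring
    have e2 : ∀ j x, conj (conj (((s x : ℂ))⁻¹ * dz j v x)) * (conj (g j x) * s x) = conj (g j x) * dz j v x := by
      intro j x; rw [Complex.conj_conj]; field_simp [sne x]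
    simp only [e1, e2] at this
    rw [this]
    obtain ⟨h1, K, hK, hKD, h0⟩ := hv
    have e3 : ∀ j, ∫ x, conj (g j x) * dz j v x = - ∫ x, conj (dzb j (g j) x) * v x := by
      intro j
      rw [ibp_dz j isOpen_univ ((hg j).conj.1.of_le (by norm_num)).contDiffOn (h1.of_le (by norm_num)) hK (subset_univ _) h0]
      simp only [dz_conj]
    simp only [e3, Finset.sum_neg_distrib, map_sum, Finset.sum_mul]
    rw [integral_finsetSum]
    intro j _
    refine int_off isOpen_univ (Continuous.continuousOn ?_) hK (subset_univ _) fun x hx => by simp [h0 x hx]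
    exact (Complex.continuous_conj.comp (dzb_contDiff j (two_of' (hg j).1)).continuous).mul h1.continuous
  · have hma : ∀ j, MemLp (fun x => ((s x : ℂ))⁻¹ * α j x) 2 := by
      intro j
      have hm : AEStronglyMeasurable (D.indicator fun x => ((s x : ℂ))⁻¹) :=
        (aestronglyMeasurable_indicator_iff hD.measurableSet).2 (hsi.aestronglyMeasurable hD.measurableSet)
      have := memLp_bmul (M := max S 0) hm (fun x => by
        by_cases hx : x ∈ D
        · simp only [indicator_of_mem hx, norm_inv, Complex.norm_real, Real.norm_of_nonneg (hs0 x).le]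
          exact (hS x hx).trans (le_max_left _ _)
        · simp [hx]) (hα j)
      refine (memLp_congr_ae (Filter.Eventually.of_forall fun x => ?_)).1 this
      by_cases hx : x ∈ D
      · simp [hx]
      · simp [hα0 j x hx]
    have hN : mkH _ hma ∈ Mᗮ := by
      refine memN hma fun h hh j k => ?_
      have e : ∀ j k x, (s x : ℂ) * dzb k h x * (((s x : ℂ))⁻¹ * α j x) = α j x * dzb k h x := by
        intro j k x; field_simp [sne x]
      simp only [e]
      exact hcl h hh j k
    rw [key hma hN, map_sum]
    refine Finset.sum_congr rfl fun j _ => ?_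
    rw [← integral_conj]
    congr 1; funext x
    simp only [map_mul, map_inv₀, Complex.conj_ofReal]
    field_simp [sne x]

end P7

section P8
open Filter (Tendsto atTop)

lemma cd_off {F : Type*} [NormedAddCommGroup F] [NormedSpace ℝ F] {f : Cn n → F} {O K : Set (Cn n)}
    {m : WithTop ℕ∞} (hO : IsOpen O)
    (hc : ContDiffOn ℝ m f O) (hK : IsClosed K) (hKO : K ⊆ O) (h0 : ∀ x ∉ K, f x = 0) : ContDiff ℝ m f := by
  rw [contDiff_iff_contDiffAt]
  intro x
  by_cases hx : x ∈ O
  · exact hc.contDiffAt (hO.mem_nhds hx)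
  · have : f =ᶠ[nhds x] fun _ => 0 := by
      filter_upwards [hK.isOpen_compl.mem_nhds (fun h => hx (hKO h))] with y hy
      exact h0 y hy
    exact contDiffAt_const.congr_of_eventuallyEq this

lemma st_d0 {x : ℝ} (hx : 1 ≤ x ∨ x ≤ 0) : deriv Real.smoothTransition x = 0 := by
  rcases hx with h | h
  · refine IsLocalMax.deriv_eq_zero (Filter.Eventually.of_forall fun y => ?_)
    simpa [Real.smoothTransition.one_of_one_le h] using Real.smoothTransition.le_one y
  · refine IsLocalMin.deriv_eq_zero (Filter.Eventually.of_forall fun y => ?_)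
    simpa [Real.smoothTransition.zero_of_nonpos h] using Real.smoothTransition.nonneg y

lemma cutoff {D : Set (Cn n)} (hD : IsOpen D) {τ : Cn n → ℝ} (hτ : ContDiffOn ℝ 2 τ D)
    (hτc : ∀ c, IsCompact {x ∈ D | τ x ≤ c}) {M : ℝ}
    (hgr : ∀ x ∈ D, ∀ j, ‖dz j (toC τ) x‖ ≤ M * τ x^2) (t0 : ℝ) (ht0 : 0 ≤ t0) :
    ∃ C : ℝ, ∀ ν : ℝ, 1 ≤ ν → 2 * t0 ≤ ν → ∃ η : Cn n → ℝ, ContDiff ℝ 2 η ∧ (∀ x, 0 ≤ η x) ∧ (∀ x, η x ≤ 1) ∧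
      (∀ x, ¬ (x ∈ D ∧ τ x ≤ 2 * ν) → η x = 0) ∧ (∀ x ∈ D, τ x ≤ ν → η x = 1) ∧
      (∀ x ∈ D, τ x ≤ ν → ∀ j, dz j (toC η) x = 0) ∧
      (∀ x j, ‖dz j (toC η) x‖^2 * Real.exp (-pc (τ x - t0)) ≤ C / ν) := by
  obtain ⟨C, hC⟩ := st_bd
  have hC0 : 0 ≤ C := (abs_nonneg _).trans (hC 0)
  refine ⟨128 * C^2 * M^2, fun ν hν hνt => ?_⟩
  classical
  set η : Cn n → ℝ := D.indicator fun x => Real.smoothTransition (2 - τ x / ν) with hη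
  have hν0 : 0 < ν := by linarith
  have off : ∀ x, ¬ (x ∈ D ∧ τ x ≤ 2 * ν) → η x = 0 := by
    intro x hx
    by_cases hxD : x ∈ D
    · have : 2 * ν < τ x := by by_contra h; exact hx ⟨hxD, not_lt.1 h⟩
      simp only [hη, indicator_of_mem hxD]
      refine Real.smoothTransition.zero_of_nonpos ?_
      rw [sub_nonpos, le_div_iff₀ hν0]; exact this.le
    · simp [hη, hxD]
  have hdη : ∀ x ∈ D, ∀ j, dz j (toC η) x =
      ((deriv Real.smoothTransition (2 - τ x / ν) * (-(1/ν)) : ℝ) : ℂ) * dz j (toC τ) x := by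
    intro x hx j
    have e : toC η =ᶠ[nhds x] toC (fun y => (fun t => Real.smoothTransition (2 - t / ν)) (τ y)) := by
      filter_upwards [hD.mem_nhds hx] with y hy
      simp [toC, hη, hy]
    have : dz j (toC η) x = dz j (toC (fun y => (fun t => Real.smoothTransition (2 - t / ν)) (τ y))) x := by
      unfold dz; rw [e.fderiv_eq]
    rw [this]
    refine dz_chain (P := fun t => Real.smoothTransition (2 - t / ν)) j ?_ (diffAt_of hD (by simp) hτ hx)
    have h1 : HasDerivAt Real.smoothTransition (deriv Real.smoothTransition (2 - τ x / ν)) (2 - τ x / ν) :=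
      ((Real.smoothTransition.contDiff (n := 1)).differentiable (by simp) _).hasDerivAt
    have h2 : HasDerivAt (fun t : ℝ => 2 - t / ν) (-(1/ν)) (τ x) := by
      simpa using ((hasDerivAt_id (τ x)).div_const ν).const_sub 2
    exact h1.comp (τ x) h2
  have cη : ContDiff ℝ 2 η := by
    refine cd_off hD (K := {x ∈ D | τ x ≤ 2 * ν}) ?_ (hτc _).isClosed (fun x hx => hx.1) off
    refine ContDiffOn.congr (f := fun x => Real.smoothTransition (2 - τ x / ν)) ?_ (fun x hx => by simp [hη, hx])
    exact Real.smoothTransition.contDiff.comp_contDiffOn (contDiffOn_const.sub (hτ.div_const ν))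
  refine ⟨η, cη, ?_, ?_, off, ?_, ?_, ?_⟩
  · intro x; exact indicator_nonneg (fun x _ => Real.smoothTransition.nonneg _) x
  · intro x
    refine indicator_le' (fun x _ => Real.smoothTransition.le_one _) (fun _ _ => zero_le_one) x
  · intro x hx hxν
    simp only [hη, indicator_of_mem hx]
    refine Real.smoothTransition.one_of_one_le ?_
    have : τ x / ν ≤ 1 := by rw [div_le_one hν0]; exact hxν
    linarith
  · intro x hx hxν j
    have : τ x / ν ≤ 1 := by rw [div_le_one hν0]; exact hxν
    rw [hdη x hx, st_d0 (Or.inl (by linarith))]; simp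
  · intro x j
    have hp : 0 ≤ 128 * C^2 * M^2 / ν := by positivity
    by_cases hx : x ∈ D
    swap
    · have : dz j (toC η) x = 0 := dz_zero_off j (K := {x ∈ D | τ x ≤ 2 * ν}) (hτc _).isClosed
        (fun y hy => by simp [toC, off y hy]) x fun h => hx h.1
      simpa [this] using hp
    rw [hdη x hx]
    by_cases h1 : τ x ≤ ν
    · have : τ x / ν ≤ 1 := by rw [div_le_one hν0]; exact h1
      rw [st_d0 (Or.inl (by linarith))]; simpa using hp
    by_cases h2 : 2 * ν ≤ τ x
    · have : 2 ≤ τ x / ν := by rw [le_div_iff₀ hν0]; exact h2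
      rw [st_d0 (Or.inr (by linarith))]; simpa using hp
    push Not at h1 h2
    have hMM := hgr x hx j
    have hM0 : 0 ≤ M * τ x ^2 := (norm_nonneg _).trans hMM
    have hM : 0 ≤ M := nonneg_of_mul_nonneg_left hM0 (by nlinarith)
    have n1 : ‖((deriv Real.smoothTransition (2 - τ x / ν) * (-(1/ν)) : ℝ) : ℂ) * dz j (toC τ) x‖ ≤ C * (1/ν) * (M * (4 * ν^2)) := by
      rw [norm_mul, Complex.norm_real, Real.norm_eq_abs, abs_mul, abs_neg, abs_of_pos (by positivity : 0 < 1/ν)]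
      refine mul_le_mul (mul_le_mul_of_nonneg_right (hC _) (by positivity)) (hMM.trans ?_) (norm_nonneg _) (by positivity)
      exact mul_le_mul_of_nonneg_left (by nlinarith) hM
    have n2 : C * (1/ν) * (M * (4 * ν^2)) = 4 * C * M * ν := by field_simp
    have n3 : ‖((deriv Real.smoothTransition (2 - τ x / ν) * (-(1/ν)) : ℝ) : ℂ) * dz j (toC τ) x‖^2 ≤ 16 * C^2 * M^2 * ν^2 := by
      calc _ ≤ (4 * C * M * ν)^2 := by rw [← n2]; gcongr
        _ = _ := by ring
    have n4 : Real.exp (-pc (τ x - t0)) ≤ 8 / ν^3 := by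
      rw [Real.exp_neg, inv_le_comm₀ (Real.exp_pos _) (by positivity), inv_div]
      have h3 : ν / 2 ≤ max (τ x - t0) 0 := le_max_of_le_left (by linarith)
      have h4 : (ν/2)^3 ≤ pc (τ x - t0) := by unfold pc; gcongr
      have h5 := Real.add_one_le_exp (pc (τ x - t0))
      calc ν^3/8 = (ν/2)^3 := by ring
        _ ≤ _ := by linarith
    calc _ ≤ 16 * C^2 * M^2 * ν^2 * (8 / ν^3) := by
          refine mul_le_mul n3 n4 (Real.exp_pos _).le (by positivity)
      _ = _ := by field_simp; ring

/-- pointwise algebra -/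
lemma nsq_add {a b : ℂ} : ‖a - b‖^2 ≤ 2 * ‖a‖^2 + 2 * ‖b‖^2 := by
  have := norm_sub_le a b
  nlinarith [sq_nonneg (‖a‖ - ‖b‖), norm_nonneg (a - b)]

lemma nsq_sum (a b : Fin n → ℂ) : ‖∑ j, a j * b j‖^2 ≤ (∑ j, ‖a j‖^2) * ∑ j, ‖b j‖^2 := by
  have h1 : ‖∑ j, a j * b j‖ ≤ ∑ j, ‖a j‖ * ‖b j‖ := by
    refine (norm_sum_le _ _).trans (le_of_eq ?_)
    simp
  calc _ ≤ (∑ j, ‖a j‖ * ‖b j‖)^2 := by gcongr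
    _ ≤ _ := Finset.sum_mul_sq_le_sq_mul_sq _ _ _

end P8

section P9
open Filter (Tendsto atTop)

lemma memLp_off_mul {w f : Cn n → ℂ} {O K : Set (Cn n)} (hO : IsOpen O)
    (hc : ContinuousOn w O) (hK : IsCompact K) (hKO : K ⊆ O) (h0 : ∀ x ∉ K, w x = 0) (hf : MemLp f 2) :
    MemLp (fun x => w x * f x) 2 := by
  obtain ⟨c, cs⟩ := cont_off hO hc hK hKO h0
  obtain ⟨M, hM⟩ := cs.exists_bound_of_continuous c
  exact memLp_bmul c.aestronglyMeasurable hM hf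

lemma memLp_csmul {h f : Cn n → ℂ} (hh : Continuous h) (hc : HasCompactSupport h) (hf : MemLp f 2) :
    Integrable (fun x => f x * h x) :=
  memLp_mulint hf (hh.memLp_of_hasCompactSupport hc)

lemma dzb_cs (j : Fin n) {f : Cn n → ℂ} (h : HasCompactSupport f) : HasCompactSupport (dzb j f) :=
  h.of_isClosed_subset (isClosed_tsupport _) (dzb_supp j f)

lemma weakcore {D K : Set (Cn n)} (hD : IsOpen D) {φ φ2 q η : Cn n → ℝ} {s : Cn n → ℝ}
    (hφ : ContDiffOn ℝ 2 φ D) (hφ2 : ContDiffOn ℝ 2 φ2 D) (hq0 : ∀ x, 0 ≤ q x) {Q : ℝ}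
    (hqQ : ∀ x, q x ≤ Q) (hqm : Measurable q)
    (hlev : ∀ x ∈ D, ∀ X : Cn n,
      q x * ‖X‖^2 + 2 * ‖cderiv (fun y => φ y - φ2 y) x X‖^2 ≤ leviForm φ x X)
    (hs : ∀ x, s x = Real.exp (φ2 x / 2))
    {F : Fin n → Cn n → ℂ} {d : Cn n → ℂ} (hF : ∀ j, MemLp (F j) 2) (hd : Continuous d)
    (ha : ∀ h, Tst D h → ∀ j k, ∫ x, (s x : ℂ) * F j x * dzb k h x = ∫ x, (s x : ℂ) * F k x * dzb j h x)
    (hb : ∀ v, Tst D v → ∑ j, ∫ x, ((s x : ℂ))⁻¹ * F j x * dz j v x = - ∫ x, d x * v x)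
    (hη : ContDiff ℝ 2 η) (hK : IsCompact K) (hKD : K ⊆ D) (hη0 : ∀ x ∉ K, η x = 0) :
    ∑ j, ∫ x, ‖(s x * η x : ℂ) * F j x‖^2 * (q x * Real.exp (-φ x)) ≤
      2 * (∫ x, ‖(s x * s x * η x : ℂ) * d x + ∑ j, (s x : ℂ) * dz j (toC η) x * F j x‖^2 * Real.exp (-φ x))
      + 1/2 * ∑ j, ∑ k, ∫ x, ‖(s x : ℂ) * dzb j (toC η) x * F k x - (s x : ℂ) * dzb k (toC η) x * F j x‖^2 * Real.exp (-φ x) := by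
  have hsc : ContDiffOn ℝ 2 (fun x => (s x : ℂ)) D := by
    have : ContDiffOn ℝ 2 (toC fun x => Real.exp (φ2 x / 2)) D := toC_cd (hφ2.div_const 2).exp
    exact this.congr fun x _ => by simp [toC, hs]
  have sne : ∀ x, (s x : ℂ) ≠ 0 := fun x => by rw [hs]; exact_mod_cast (Real.exp_pos _).ne'
  have hηc : ContDiff ℝ 2 (toC η) := Complex.ofRealCLM.contDiff.comp hη
  have hη0' : ∀ x ∉ K, toC η x = 0 := fun x hx => by simp [toC, hη0 x hx]
  have dη0 : ∀ j, ∀ x ∉ K, dz j (toC η) x = 0 := fun j => dz_zero_off j hK.isClosed hη0'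
  have dbη0 : ∀ j, ∀ x ∉ K, dzb j (toC η) x = 0 := fun j => dzb_zero_off j hK.isClosed hη0'
  have cdη : ∀ j, Continuous (dz j (toC η)) := fun j => (dz_contDiff j (two_of' hηc)).continuous
  have cdbη : ∀ j, Continuous (dzb j (toC η)) := fun j => (dzb_contDiff j (two_of' hηc)).continuous
  have cφ2 : ∀ j, ContinuousOn (dz j (toC φ2)) D := fun j =>
    (dz_contDiffOn (m := 1) j hD (toC_cd (two_of hφ2))).continuousOn
  -- pieces
  set Y : Fin n → Cn n → ℂ := fun j x => (s x * η x : ℂ) * F j x with hYd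
  set Z : Fin n → Cn n → ℂ := fun j x => ((s x : ℂ) * (dz j (toC η) x + toC η x * dz j (toC φ2) x)) * F j x with hZd
  set e0 : Cn n → ℂ := fun x => (s x * s x * η x : ℂ) * d x with he0
  set W : Fin n → Fin n → Cn n → ℂ := fun j k x => ((s x : ℂ) * dzb j (toC η) x) * F k x with hWd
  have hY : ∀ j, MemLp (Y j) 2 := fun j => memLp_off_mul hD
    (hsc.continuousOn.mul hηc.continuous.continuousOn) hK hKD (fun x hx => by simp [toC, hη0 x hx]) (hF j)
  have hZ : ∀ j, MemLp (Z j) 2 := fun j => memLp_off_mul hD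
    (hsc.continuousOn.mul ((cdη j).continuousOn.add (hηc.continuous.continuousOn.mul (cφ2 j)))) hK hKD
    (fun x hx => by simp [dη0 j x hx, hη0' x hx]) (hF j)
  have hE : MemLp e0 2 := memLp_off hD
    (((hsc.continuousOn.mul hsc.continuousOn).mul hηc.continuous.continuousOn).mul hd.continuousOn) hK hKD
    (fun x hx => by simp [he0, hη0 x hx])
  have hW : ∀ j k, MemLp (W j k) 2 := fun j k => memLp_off_mul hD
    (hsc.continuousOn.mul (cdbη j).continuousOn) hK hKD (fun x hx => by simp [dbη0 j x hx]) (hF k)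
  have hZs : MemLp (fun x => ∑ j, Z j x) 2 := memLp_finsetSum _ fun j _ => hZ j
  have L := lemma1 hD hφ hφ2 hq0 hqQ hqm hlev (Y := Y) (y0 := fun x => e0 x + ∑ j, Z j x)
    (yy := fun j k x => W j k x - W k j x) hK hKD hY (fun j x hx => by simp [hYd, hη0 x hx])
    (hE.add hZs) (fun x hx => by simp [he0, hZd, hη0 x hx, dη0 _ x hx, hη0' x hx])
    (fun j k => (hW j k).sub (hW k j)) (fun j k x hx => by simp [hWd, dbη0 _ x hx]) ?_ ?_
  · have e1 : ∀ x, e0 x + ∑ j, Z j x - ∑ j, dz j (toC φ2) x * Y j x =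
        (s x * s x * η x : ℂ) * d x + ∑ j, (s x : ℂ) * dz j (toC η) x * F j x := by
      intro x
      rw [add_sub_assoc, ← Finset.sum_sub_distrib]
      simp only [he0]
      congr 1
      refine Finset.sum_congr rfl fun j _ => ?_
      simp only [hZd, hYd, toC]; ring
    simp only [e1] at L
    exact L
  · intro h hh hc
    have ht : Tst D (fun x => (toC η x * ((s x : ℂ) * (s x : ℂ))) * h x) := by
      have h0 : ∀ x ∉ K, (toC η x * ((s x : ℂ) * (s x : ℂ))) * h x = 0 := fun x hx => by simp [hη0' x hx]
      exact ⟨cd_off hD ((hηc.contDiffOn.mul (hsc.mul hsc)).mul hh.contDiffOn) hK.isClosed hKD h0, K, hK, hKD, h0⟩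
    have key : ∀ j x, ((s x : ℂ))⁻¹ * F j x * dz j (fun x => (toC η x * ((s x : ℂ) * (s x : ℂ))) * h x) x =
        Y j x * dz j h x + Z j x * h x := by
      intro j x
      by_cases hx : x ∈ D
      swap
      · have hxK : x ∉ K := fun h => hx (hKD h)
        rw [dz_zero_off j hK.isClosed (fun x hx => by simp [hη0' x hx]) x hxK]
        simp [hYd, hZd, hη0 x hxK, dη0 j x hxK, hη0' x hxK]
      · have ds : DifferentiableAt ℝ (fun x => (s x : ℂ)) x := diffAt_of hD (by simp) hsc hx
        have dη : DifferentiableAt ℝ (toC η) x := hηc.differentiable (by simp) x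
        have hss : dz j (fun x => (s x : ℂ) * (s x : ℂ)) x = dz j (toC φ2) x * ((s x : ℂ) * (s x : ℂ)) := by
          have e : (fun x => (s x : ℂ) * (s x : ℂ)) = toC (fun y => Real.exp (φ2 y)) := by
            funext y
            simp only [toC, hs, ← Complex.ofReal_mul, ← Real.exp_add, add_halves]
          have e' := congrFun e x
          rw [e', e, dz_chain (P := Real.exp) j (Real.hasDerivAt_exp _) (diffAt_of hD (by simp) hφ2 hx)]
          simp only [toC]; ring
        rw [dz_mul j (dη.fun_mul (ds.fun_mul ds)) (hh.differentiable (by simp) x), dz_mul j dη (ds.fun_mul ds), hss]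
        simp only [hYd, hZd]
        have := sne x
        simp only [toC]
        field_simp
        ring
    have hbb := hb _ ht
    simp only [key] at hbb
    have i1 : ∀ j, Integrable (fun x => Y j x * dz j h x) := fun j =>
      memLp_csmul (dz_contDiff j (two_of' hh)).continuous (dz_cs j hc) (hY j)
    have i2 : ∀ j, Integrable (fun x => Z j x * h x) := fun j => memLp_csmul hh.continuous hc (hZ j)
    have i3 : Integrable (fun x => e0 x * h x) := memLp_csmul hh.continuous hc hE
    have s1 : ∀ j, ∫ x, (Y j x * dz j h x + Z j x * h x) = (∫ x, Y j x * dz j h x) + ∫ x, Z j x * h x :=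
      fun j => integral_add (i1 j) (i2 j)
    have s2 : ∫ x, (e0 x + ∑ j, Z j x) * h x = (∫ x, e0 x * h x) + ∑ j, ∫ x, Z j x * h x := by
      rw [← integral_finsetSum _ fun j _ => i2 j, ← integral_add i3 (integrable_finsetSum _ fun j _ => i2 j)]
      congr 1; funext x; rw [add_mul, Finset.sum_mul]
    have s3 : ∫ x, d x * ((toC η x * ((s x : ℂ) * (s x : ℂ))) * h x) = ∫ x, e0 x * h x := by
      congr 1; funext x; simp only [he0, toC]; ring
    simp only [s1, Finset.sum_add_distrib, s3] at hbb
    rw [s2]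
    linear_combination hbb
  · intro j k h hh hc
    have ht : Tst D (fun x => toC η x * h x) := by
      have h0 : ∀ x ∉ K, toC η x * h x = 0 := fun x hx => by simp [hη0' x hx]
      exact ⟨hηc.mul hh, K, hK, hKD, h0⟩
    have key : ∀ j k x, (s x : ℂ) * F j x * dzb k (fun x => toC η x * h x) x = Y j x * dzb k h x + W k j x * h x := by
      intro j k x
      rw [dzb_mul k (hηc.differentiable (by simp) x) (hh.differentiable (by simp) x)]
      simp only [hYd, hWd, toC]; ring
    have haa := ha _ ht j k
    simp only [key] at haa
    have i1 : ∀ j k, Integrable (fun x => Y j x * dzb k h x) := fun j k =>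
      memLp_csmul (dzb_contDiff k (two_of' hh)).continuous (dzb_cs k hc) (hY j)
    have i2 : ∀ j k, Integrable (fun x => W j k x * h x) := fun j k => memLp_csmul hh.continuous hc (hW j k)
    rw [integral_add (i1 _ _) (i2 _ _), integral_add (i1 _ _) (i2 _ _)] at haa
    simp only [sub_mul]
    rw [integral_sub (i2 _ _) (i2 _ _)]
    linear_combination -haa

end P9

section P10
open Filter (Tendsto atTop)

lemma mkH_norm {f : Fin n → Cn n → ℂ} (hf : ∀ j, MemLp (f j) 2) :
    ‖mkH f hf‖^2 = ∑ j, ∫ x, ‖f j x‖^2 := by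
  have h1 : (inner ℂ (mkH f hf) (mkH f hf)) = ((‖mkH f hf‖^2 : ℝ) : ℂ) := by
    rw [inner_self_eq_norm_sq_to_K]; norm_cast
  rw [mkH_inner] at h1
  have h2 : ∀ j, ∫ x, conj (f j x) * f j x = ((∫ x, ‖f j x‖^2 : ℝ) : ℂ) := by
    intro j
    rw [← integral_complex_ofReal]
    congr 1; funext x
    rw [mul_comm, Complex.mul_conj, Complex.normSq_eq_norm_sq]
  simp only [h2] at h1
  exact_mod_cast h1.symm

lemma cs_fields {f g : Fin n → Cn n → ℂ} (hf : ∀ j, MemLp (f j) 2) (hg : ∀ j, MemLp (g j) 2) :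
    ‖∑ j, ∫ x, conj (f j x) * g j x‖^2 ≤ (∑ j, ∫ x, ‖f j x‖^2) * ∑ j, ∫ x, ‖g j x‖^2 := by
  rw [← mkH_inner hf hg, ← mkH_norm hf, ← mkH_norm hg, ← mul_pow]
  gcongr
  exact norm_inner_le_norm _ _

lemma nsq_int {f : Cn n → ℂ} (hf : MemLp f 2) : Integrable (fun x => ‖f x‖^2) :=
  hf.integrable_norm_pow (by norm_num)

lemma core {D : Set (Cn n)} (hD : IsOpen D) {τ φ0 : Cn n → ℝ} (hτ : ContDiffOn ℝ 2 τ D)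
    (hτl : ∀ x ∈ D, ∀ X, 0 ≤ leviForm τ x X)
    (hτc : ∀ c, IsCompact {x ∈ D | τ x ≤ c}) {M : ℝ}
    (hgr : ∀ x ∈ D, ∀ j, ‖dz j (toC τ) x‖ ≤ M * τ x^2)
    (hφ0 : ContDiffOn ℝ 2 φ0 D) (hp0 : ∀ x ∈ D, 0 ≤ φ0 x) {B : ℝ} (hB : ∀ x ∈ D, φ0 x ≤ B)
    {A : Set (Cn n)} (hA : MeasurableSet A) {c : ℝ} (hc : 0 < c)
    (hl : ∀ x ∈ D, ∀ X, A.indicator (fun _ => c) x * ‖X‖^2 ≤ leviForm φ0 x X)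
    {α : Fin n → Cn n → ℂ} (hα : ∀ j, MemLp (α j) 2) (hα0 : ∀ j, ∀ x, x ∉ A ∩ D → α j x = 0)
    (hcl : ∀ h, Tst D h → ∀ j k, ∫ x, α j x * dzb k h x = ∫ x, α k x * dzb j h x)
    {g : Fin n → Cn n → ℂ} (hg : ∀ j, Tst D (g j)) :
    ‖∑ j, ∫ x, α j x * g j x‖^2 ≤ 2 * Real.exp (1 + B) / c * (∑ j, ∫ x, ‖α j x‖^2)
      * ∫ x, ‖∑ j, dzb j (g j) x‖^2 := by
  choose K' hK' hK'D hg0 using fun j => (hg j).2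
  set K := ⋃ j, K' j with hK
  have hKc : IsCompact K := isCompact_iUnion hK'
  have hKD : K ⊆ D := iUnion_subset hK'D
  obtain ⟨t1, ht1⟩ := hKc.exists_bound_of_continuousOn (hτ.continuousOn.mono hKD)
  set t0 := max t1 0 with ht0
  have htK : ∀ x ∈ K, τ x ≤ t0 := fun x hx => ((le_abs_self _).trans (ht1 x hx)).trans (le_max_left _ _)
  set d : Cn n → ℂ := fun x => conj (∑ j, dzb j (g j) x) with hd
  have d0 : ∀ x ∉ K, d x = 0 := by
    intro x hx
    simp only [hd]
    rw [Finset.sum_eq_zero, map_zero]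
    intro j _
    exact dzb_zero_off j (hK' j).isClosed (hg0 j) x fun h => hx (mem_iUnion_of_mem j h)
  have dc : Continuous d := Complex.continuous_conj.comp
    (continuous_finsetSum _ fun j _ => (dzb_contDiff j (two_of' (hg j).1)).continuous)
  have dL : MemLp d 2 := memLp_off isOpen_univ dc.continuousOn hKc (subset_univ _) d0
  set ψ : Cn n → ℝ := fun y => pc (τ y - t0) with hψ
  have hψ0 : ∀ x, 0 ≤ ψ x := fun x => pc_nonneg _
  have hψK : ∀ x ∈ K, ψ x = 0 := fun x hx => pc_neg (by linarith [htK x hx])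
  have hψc : ContDiffOn ℝ 2 ψ D := pc_cd.comp_contDiffOn (hτ.sub contDiffOn_const)
  set φ : Cn n → ℝ := fun y => φ0 y + ψ y^2 with hφ
  set φ2 : Cn n → ℝ := fun y => φ0 y + ψ y^2 - ψ y with hφ2
  have cφ : ContDiffOn ℝ 2 φ D := hφ0.add (hψc.pow 2)
  have cφ2 : ContDiffOn ℝ 2 φ2 D := cφ.sub hψc
  set s : Cn n → ℝ := fun x => Real.exp (φ2 x / 2) with hs
  have s2 : ∀ x, s x ^2 = Real.exp (φ2 x) := fun x => by
    simp only [hs]; rw [← Real.exp_nat_mul]; congr 1; push_cast; ring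
  have spos : ∀ x, 0 < s x := fun x => Real.exp_pos _
  have seφ : ∀ x, s x^2 * Real.exp (-φ x) = Real.exp (-ψ x) := fun x => by
    rw [s2, ← Real.exp_add]; congr 1; simp only [hφ, hφ2]; ring
  obtain ⟨F, hF, Fa, Fb, Fd⟩ := proj hD (s := s) (cφ2.continuousOn.div_const 2).rexp spos (S := Real.exp (1/8))
    (fun x hx => by
      simp only [hs]
      rw [← Real.exp_neg]
      refine Real.exp_le_exp.2 ?_
      have := hp0 x hx
      simp only [hφ2]
      nlinarith [sq_nonneg (ψ x - 1/2)]) hα (fun j x hx => hα0 j x fun h => hx h.2) hcl hg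
  set q : Cn n → ℝ := A.indicator (fun _ => c) with hq
  have hq0 : ∀ x, 0 ≤ q x := fun x => indicator_nonneg (fun _ _ => hc.le) x
  have hqc : ∀ x, q x ≤ c := fun x => indicator_le' (fun _ _ => le_rfl) (fun _ _ => hc.le) x
  have hqm : Measurable q := measurable_const.indicator hA
  have hlev : ∀ x ∈ D, ∀ X : Cn n,
      q x * ‖X‖^2 + 2 * ‖cderiv (fun y => φ y - φ2 y) x X‖^2 ≤ leviForm φ x X := by
    intro x hx X
    have e : (fun y => φ y - φ2 y) = ψ := by funext y; simp only [hφ, hφ2]; ring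
    have ψa : ContDiffAt ℝ 2 ψ x := hψc.contDiffAt (hD.mem_nhds hx)
    have τa : ContDiffAt ℝ 2 τ x := hτ.contDiffAt (hD.mem_nhds hx)
    have φa : ContDiffAt ℝ 2 φ0 x := hφ0.contDiffAt (hD.mem_nhds hx)
    rw [e, hφ, levi_add φa (ψa.pow 2), levi_sq ψa]
    have h1 := levi_chain (P := fun t => pc (t - t0)) (P' := fun t => 3 * (max (t-t0) 0)^2)
      (P'' := fun t => 6 * max (t-t0) 0) (fun t => (pc_d _).comp_sub_const t t0)
      (fun t => (pc_dd _).comp_sub_const t t0) τa X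
    have h2 : 0 ≤ leviForm ψ x X := by
      rw [hψ, h1]
      have := hτl x hx X
      positivity
    have := hl x hx X
    have := mul_nonneg (hψ0 x) h2
    linarith
  -- the cutoffs
  obtain ⟨C, hC⟩ := cutoff hD hτ hτc hgr t0 (le_max_right _ _)
  set ν : ℕ → ℝ := fun m => (m : ℝ) + 2 * t0 + 1 with hν
  have ht00 : 0 ≤ t0 := le_max_right _ _
  have hν1 : ∀ m, 1 ≤ ν m := fun m => by simp only [hν]; have : (0:ℝ) ≤ m := by positivity
                                         linarith
  have hν2 : ∀ m, 2 * t0 ≤ ν m := fun m => by simp only [hν]; have : (0:ℝ) ≤ m := by positivity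
                                              linarith
  choose η ηc η0 η1 ηoff ηon dηon dηb using fun m => hC (ν m) (hν1 m) (hν2 m)
  set Φ := ∑ j, ∫ x, ‖F j x‖^2 with hΦ
  have iF : ∀ j, Integrable (fun x => ‖F j x‖^2) := fun j => nsq_int (hF j)
  have iFs : Integrable (fun x => ∑ j, ‖F j x‖^2) := integrable_finsetSum _ fun j _ => iF j
  have id : Integrable (fun x => ‖d x‖^2) := nsq_int dL
  have ns : ∀ x, ‖(s x : ℂ)‖ = s x := fun x => by rw [Complex.norm_real, Real.norm_of_nonneg (spos x).le]
  have main : ∀ m, ∑ j, ∫ x, (η m x)^2 * (‖F j x‖^2 * (q x * Real.exp (-ψ x))) ≤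
      2 * Real.exp B * (∫ x, ‖d x‖^2) + 4 * n * (C / ν m) * Φ := by
    intro m
    have W := weakcore (s := s) (q := q) (η := η m) (F := F) (d := d) hD cφ cφ2 hq0 hqc hqm hlev (fun x => rfl) hF dc Fa Fb (ηc m) (hτc (2 * ν m))
      (fun x hx => hx.1) (fun x hx => ηoff m x hx)
    have e1 : ∀ j x, ‖(s x * η m x : ℂ) * F j x‖^2 * (q x * Real.exp (-φ x)) =
        (η m x)^2 * (‖F j x‖^2 * (q x * Real.exp (-ψ x))) := by
      intro j x
      rw [← seφ, norm_mul, norm_mul, ns, Complex.norm_real, Real.norm_of_nonneg (η0 m x)]; ring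
    simp only [e1] at W
    refine W.trans ?_
    have b1 : ∫ x, ‖(s x * s x * η m x : ℂ) * d x + ∑ j, (s x : ℂ) * dz j (toC (η m)) x * F j x‖^2 * Real.exp (-φ x)
        ≤ Real.exp B * (∫ x, ‖d x‖^2) + n * (C / ν m) * Φ := by
      have : Real.exp B * (∫ x, ‖d x‖^2) + n * (C / ν m) * Φ =
          ∫ x, (Real.exp B * ‖d x‖^2 + n * (C / ν m) * ∑ j, ‖F j x‖^2) := by
        rw [integral_add (id.const_mul _) (iFs.const_mul _), integral_const_mul, integral_const_mul,
          integral_finsetSum _ fun j _ => iF j]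
      rw [this]
      refine integral_mono_of_nonneg (Filter.Eventually.of_forall fun x => by simp only [Pi.zero_apply]; positivity)
        ((id.const_mul _).add (iFs.const_mul _)) (Filter.Eventually.of_forall fun x => ?_)
      simp only
      have hS : ‖∑ j, dz j (toC (η m)) x * F j x‖^2 * Real.exp (-ψ x) ≤ n * (C / ν m) * ∑ j, ‖F j x‖^2 := by
        calc _ ≤ ((∑ j, ‖dz j (toC (η m)) x‖^2) * ∑ j, ‖F j x‖^2) * Real.exp (-ψ x) := by
              gcongr; exact nsq_sum _ _
          _ = (∑ j, ‖dz j (toC (η m)) x‖^2 * Real.exp (-ψ x)) * ∑ j, ‖F j x‖^2 := by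
              rw [← Finset.sum_mul]; ring
          _ ≤ (∑ j : Fin n, C / ν m) * ∑ j, ‖F j x‖^2 := by
              gcongr with j _
              exact dηb m x j
          _ = _ := by simp
      have hS0 : 0 ≤ n * (C / ν m) * ∑ j, ‖F j x‖^2 := le_trans (by positivity) hS
      have es : ∑ j, (s x : ℂ) * dz j (toC (η m)) x * F j x = (s x : ℂ) * ∑ j, dz j (toC (η m)) x * F j x := by
        rw [Finset.mul_sum]; exact Finset.sum_congr rfl fun j _ => by ring
      by_cases hx : x ∈ K
      · have hxD := hKD hx
        have : ∑ j, dz j (toC (η m)) x * F j x = 0 := Finset.sum_eq_zero fun j _ => by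
          rw [dηon m x hxD (by linarith [htK x hx, hν2 m]) j, zero_mul]
        rw [es, this, mul_zero, add_zero]
        have h1 : s x^2 * (s x^2 * Real.exp (-φ x)) ≤ Real.exp B := by
          rw [seφ, s2, ← Real.exp_add]
          refine Real.exp_le_exp.2 ?_
          simp only [hφ2, hψK x hx]
          simpa using hB x hxD
        calc _ = (s x^2 * (s x^2 * Real.exp (-φ x))) * (η m x^2 * ‖d x‖^2) := by
              rw [norm_mul, norm_mul, norm_mul, ns, Complex.norm_real, Real.norm_of_nonneg (η0 m x)]; ring
          _ ≤ Real.exp B * (1 * ‖d x‖^2) := by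
              gcongr
              exact pow_le_one₀ (η0 m x) (η1 m x)
          _ ≤ _ := by linarith
      · rw [d0 x hx, mul_zero, zero_add, es, norm_mul, mul_pow, ns]
        calc _ = ‖∑ j, dz j (toC (η m)) x * F j x‖^2 * (s x^2 * Real.exp (-φ x)) := by ring
          _ ≤ _ := by rw [seφ]; simpa using hS
    have b2 : ∀ j k, ∫ x, ‖(s x : ℂ) * dzb j (toC (η m)) x * F k x - (s x : ℂ) * dzb k (toC (η m)) x * F j x‖^2 * Real.exp (-φ x)
        ≤ 2 * (C / ν m) * (∫ x, ‖F k x‖^2) + 2 * (C / ν m) * (∫ x, ‖F j x‖^2) := by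
      intro j k
      rw [← integral_const_mul, ← integral_const_mul, ← integral_add ((iF k).const_mul _) ((iF j).const_mul _)]
      refine integral_mono_of_nonneg (Filter.Eventually.of_forall fun x => by simp only [Pi.zero_apply]; positivity)
        (((iF k).const_mul _).add ((iF j).const_mul _)) (Filter.Eventually.of_forall fun x => ?_)
      simp only
      have hj : ∀ j, ‖dzb j (toC (η m)) x‖^2 * Real.exp (-ψ x) ≤ C / ν m := by
        intro j
        rw [dzb_toC, Complex.norm_conj]; exact dηb m x j
      calc _ ≤ (2 * ‖(s x : ℂ) * dzb j (toC (η m)) x * F k x‖^2 + 2 * ‖(s x : ℂ) * dzb k (toC (η m)) x * F j x‖^2) * Real.exp (-φ x) := by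
            gcongr; exact nsq_add
        _ = 2 * ((‖dzb j (toC (η m)) x‖^2 * (s x^2 * Real.exp (-φ x))) * ‖F k x‖^2)
            + 2 * ((‖dzb k (toC (η m)) x‖^2 * (s x^2 * Real.exp (-φ x))) * ‖F j x‖^2) := by
            simp only [norm_mul, ns]; ring
        _ ≤ 2 * ((C / ν m) * ‖F k x‖^2) + 2 * ((C / ν m) * ‖F j x‖^2) := by
            rw [seφ]
            gcongr
            · exact hj j
            · exact hj k
        _ = _ := by ring
    have b3 := Finset.sum_le_sum fun j (_ : j ∈ Finset.univ) => Finset.sum_le_sum fun k (_ : k ∈ Finset.univ) => b2 j k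
    have b4 : ∑ j : Fin n, ∑ k : Fin n, (2 * (C / ν m) * (∫ x, ‖F k x‖^2) + 2 * (C / ν m) * (∫ x, ‖F j x‖^2)) =
        4 * n * (C / ν m) * Φ := by
      simp only [Finset.sum_add_distrib, ← Finset.mul_sum, Finset.sum_const, Finset.card_univ, Fintype.card_fin, nsmul_eq_mul, ← hΦ]
      ring
    rw [b4] at b3
    linarith
  have lim1 : Tendsto (fun m => ∑ j, ∫ x, (η m x)^2 * (‖F j x‖^2 * (q x * Real.exp (-ψ x)))) atTop
      (nhds (∑ j, ∫ x, D.indicator (fun x => ‖F j x‖^2 * (q x * Real.exp (-ψ x))) x)) := by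
    have mψ : AEStronglyMeasurable (D.indicator fun x => Real.exp (-ψ x)) :=
      (aestronglyMeasurable_indicator_iff hD.measurableSet).2
        (hψc.continuousOn.neg.rexp.aestronglyMeasurable hD.measurableSet)
    refine tendsto_finsetSum _ fun j _ => ?_
    refine tendsto_integral_of_dominated_convergence (fun x => c * ‖F j x‖^2) ?_ ((iF j).const_mul c) ?_ ?_
    · intro m
      have : (fun x => (η m x)^2 * (‖F j x‖^2 * (q x * Real.exp (-ψ x)))) =
          fun x => (η m x)^2 * (‖F j x‖^2 * (q x * D.indicator (fun x => Real.exp (-ψ x)) x)) := by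
        funext x
        by_cases hx : x ∈ D
        · simp [hx]
        · simp [ηoff m x fun h => hx h.1]
      rw [this]
      exact ((ηc m).continuous.pow 2).aestronglyMeasurable.mul ((iF j).1.mul (hqm.aestronglyMeasurable.mul mψ))
    · intro m
      refine Filter.Eventually.of_forall fun x => ?_
      have h1 : Real.exp (-ψ x) ≤ 1 := Real.exp_le_one_iff.2 (by linarith [hψ0 x])
      have := hq0 x
      rw [Real.norm_of_nonneg (by positivity)]
      calc _ ≤ 1 * (‖F j x‖^2 * (c * 1)) := by
            gcongr
            · exact pow_le_one₀ (η0 m x) (η1 m x)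
            · exact hqc x
        _ = _ := by ring
    · refine Filter.Eventually.of_forall fun x => ?_
      by_cases hx : x ∈ D
      · refine tendsto_const_nhds.congr' ?_
        filter_upwards [Filter.eventually_ge_atTop ⌈τ x⌉₊] with m hm
        have : τ x ≤ ν m := by
          have := (Nat.le_ceil (τ x)).trans (Nat.cast_le.2 hm)
          simp only [hν]; linarith
        simp [hx, ηon m x hx this]
      · simp [hx, ηoff _ x fun h => hx h.1]
  have lim2 : Tendsto (fun m => 2 * Real.exp B * (∫ x, ‖d x‖^2) + 4 * n * (C / ν m) * Φ) atTop
      (nhds (2 * Real.exp B * (∫ x, ‖d x‖^2) + 4 * n * 0 * Φ)) := by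
    have : Tendsto ν atTop atTop := by
      simp only [hν, add_assoc]
      exact Filter.tendsto_atTop_add_const_right _ _ tendsto_natCast_atTop_atTop
    exact (((this.const_div_atTop C).const_mul _).mul_const _).const_add _
  have fin := le_of_tendsto_of_tendsto' lim1 lim2 main
  -- conclusion
  set h : Fin n → Cn n → ℂ := fun j x => (A ∩ D).indicator (fun x => ((s x : ℂ))⁻¹) x * F j x with hh
  have mh : AEStronglyMeasurable ((A ∩ D).indicator (fun x => ((s x : ℂ))⁻¹)) := by
    rw [← indicator_indicator]
    refine AEStronglyMeasurable.indicator ?_ hA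
    refine (aestronglyMeasurable_indicator_iff hD.measurableSet).2 (ContinuousOn.aestronglyMeasurable ?_ hD.measurableSet)
    have hsC : ContinuousOn (fun x => ((s x:ℝ):ℂ)) D :=
      Complex.continuous_ofReal.comp_continuousOn (cφ2.continuousOn.div_const 2).rexp
    exact hsC.inv₀ fun x _ => by exact_mod_cast (spos x).ne'
  have hsb : ∀ x ∈ D, (s x^2)⁻¹ ≤ Real.exp 1 * Real.exp (-ψ x) := by
    intro x hx
    rw [s2, ← Real.exp_neg, ← Real.exp_add]
    refine Real.exp_le_exp.2 ?_
    have := hp0 x hx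
    simp only [hφ2]
    nlinarith [sq_nonneg (ψ x - 1)]
  have hL : ∀ j, MemLp (h j) 2 := by
    intro j
    refine memLp_bmul (M := Real.exp 1) mh (fun x => ?_) (hF j)
    by_cases hx : x ∈ A ∩ D
    · rw [indicator_of_mem hx, norm_inv, ns]
      have h1 := hsb x hx.2
      have h2 : Real.exp (-ψ x) ≤ 1 := Real.exp_le_one_iff.2 (by linarith [hψ0 x])
      have h3 : (1:ℝ) ≤ Real.exp 1 := Real.one_le_exp (by norm_num)
      have h4 : ((s x)⁻¹)^2 ≤ Real.exp 1 ^2 := by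
        rw [inv_pow]
        nlinarith
      exact le_of_sq_le_sq h4 (by positivity)
    · rw [indicator_of_notMem hx]; simp; positivity
  have e1 : ∑ j, ∫ x, conj (((s x : ℂ))⁻¹ * α j x) * F j x = ∑ j, ∫ x, conj (α j x) * h j x := by
    refine Finset.sum_congr rfl fun j _ => ?_
    congr 1; funext x
    by_cases hx : x ∈ A ∩ D
    · simp only [hh, indicator_of_mem hx, map_mul, map_inv₀, Complex.conj_ofReal]; ring
    · simp [hα0 j x hx]
  have e2 : ‖∑ j, ∫ x, α j x * g j x‖ = ‖∑ j, ∫ x, conj (α j x) * h j x‖ := by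
    rw [← e1, Fd, Complex.norm_conj]
  rw [e2]
  refine (cs_fields hα hL).trans ?_
  have e3 : ∑ j, ∫ x, ‖h j x‖^2 ≤ Real.exp 1 / c * ∑ j, ∫ x, D.indicator (fun x => ‖F j x‖^2 * (q x * Real.exp (-ψ x))) x := by
    rw [Finset.mul_sum]
    refine Finset.sum_le_sum fun j _ => ?_
    rw [← integral_const_mul]
    refine integral_mono_of_nonneg (Filter.Eventually.of_forall fun x => by simp only [Pi.zero_apply]; positivity) ?_
      (Filter.Eventually.of_forall fun x => ?_)
    · refine Integrable.const_mul ?_ _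
      refine Integrable.mono' ((iF j).const_mul c) ?_ (Filter.Eventually.of_forall fun x => ?_)
      · refine (aestronglyMeasurable_indicator_iff hD.measurableSet).2 ?_
        exact (iF j).1.restrict.mul (hqm.aestronglyMeasurable.mul
          (hψc.continuousOn.neg.rexp.aestronglyMeasurable hD.measurableSet))
      · have h1 : Real.exp (-ψ x) ≤ 1 := Real.exp_le_one_iff.2 (by linarith [hψ0 x])
        have := hq0 x
        by_cases hx : x ∈ D
        · rw [indicator_of_mem hx, Real.norm_of_nonneg (by positivity)]
          calc _ ≤ (‖F j x‖^2 * (c * 1)) := by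
                gcongr
                exact hqc x
            _ = _ := by ring
        · rw [indicator_of_notMem hx]; simp; positivity
    · simp only
      by_cases hx : x ∈ A ∩ D
      · simp only [hh, indicator_of_mem hx, indicator_of_mem hx.2, hq, indicator_of_mem hx.1, norm_mul, norm_inv, ns]
        calc _ = (s x^2)⁻¹ * ‖F j x‖^2 := by rw [mul_pow, inv_pow]
          _ ≤ (Real.exp 1 * Real.exp (-ψ x)) * ‖F j x‖^2 := by gcongr; exact hsb x hx.2
          _ = _ := by field_simp
      · have h1 : h j x = 0 := by simp [hh, hx]
        rw [h1]
        have := hq0 x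
        have : 0 ≤ D.indicator (fun x => ‖F j x‖^2 * (q x * Real.exp (-ψ x))) x :=
          indicator_nonneg (fun x _ => by have := hq0 x; positivity) x
        simp; positivity
  have e4 : ∀ x, ‖d x‖ = ‖∑ j, dzb j (g j) x‖ := fun x => by simp only [hd]; rw [Complex.norm_conj]
  simp only [e4] at fin
  have e5 : ∑ j, ∫ x, ‖h j x‖^2 ≤ Real.exp 1 / c * (2 * Real.exp B * ∫ x, ‖∑ j, dzb j (g j) x‖^2) := by
    refine e3.trans ?_
    gcongr
    simpa using fin
  have a0 : 0 ≤ ∑ j, ∫ x, ‖α j x‖^2 := Finset.sum_nonneg fun j _ => integral_nonneg fun x => by positivity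
  calc _ ≤ (∑ j, ∫ x, ‖α j x‖^2) * (Real.exp 1 / c * (2 * Real.exp B * ∫ x, ‖∑ j, dzb j (g j) x‖^2)) := by gcongr
    _ = _ := by rw [Real.exp_add]; ring

end P10

section P11
open Filter (Tendsto atTop)

lemma taylor2 {v : Cn n → ℝ} {S : Set (Cn n)} (hS : IsOpen S) (hc : Convex ℝ S)
    (hv : ContDiffOn ℝ 2 v S) {x : Cn n} (hx : x ∈ S) {ε : ℝ}
    (he : ∀ y ∈ S, ‖fderiv ℝ (fderiv ℝ v) y - fderiv ℝ (fderiv ℝ v) x‖ ≤ ε) {y : Cn n} (hy : y ∈ S) :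
    |v y - v x - fderiv ℝ v x (y - x) - 1/2 * fderiv ℝ (fderiv ℝ v) x (y - x) (y - x)| ≤ ε * ‖y - x‖^2 := by
  have cd : ∀ z ∈ S, ContDiffAt ℝ 2 v z := fun z hz => hv.contDiffAt (hS.mem_nhds hz)
  set B := fderiv ℝ (fderiv ℝ v) x with hB
  have hd : ∀ z ∈ S, HasFDerivAt (fun z => fderiv ℝ v z - B z) (fderiv ℝ (fderiv ℝ v) z - B) z := fun z hz =>
    (((cd z hz).fderiv_right (m := 1) (by norm_num)).differentiableAt (by norm_num)).hasFDerivAt.sub B.hasFDerivAt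
  have h1 : ∀ z ∈ S, ‖fderiv ℝ v z - fderiv ℝ v x - B (z - x)‖ ≤ ε * ‖z - x‖ := by
    intro z hz
    have := hc.norm_image_sub_le_of_norm_hasFDerivWithin_le (fun z hz => (hd z hz).hasFDerivWithinAt) he hx hz
    refine le_trans (le_of_eq ?_) this
    rw [map_sub]; congr 1; abel
  have e0 : 0 ≤ ε := le_trans (by positivity) (he x hx)
  have h2 : ∀ z ∈ S, HasFDerivAt (fun z => v z - fderiv ℝ v x (z - x) - 1/2 * B (z - x) (z - x))
      (fderiv ℝ v z - fderiv ℝ v x - B (z - x)) z := by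
    intro z hz
    have a1 := ((cd z hz).differentiableAt (by norm_num)).hasFDerivAt
    have a0 : HasFDerivAt (fun z : Cn n => z - x) (ContinuousLinearMap.id ℝ (Cn n)) z := (hasFDerivAt_id z).sub_const x
    have a2 := (fderiv ℝ v x).hasFDerivAt.comp z a0
    have a3 := ((B.hasFDerivAt.comp z a0).clm_apply a0).const_mul (1/2 : ℝ)
    refine ((a1.sub a2).sub a3).congr_fderiv ?_
    ext w
    have := symm2 (cd x hx) w (z - x)
    simp only [← hB] at this
    simp only [map_sub, sub_apply] at this
    simp
    linarith
  have hT := (hc.inter (convex_closedBall x ‖y - x‖)).norm_image_sub_le_of_norm_hasFDerivWithin_le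
    (C := ε * ‖y - x‖) (fun z hz => (h2 z hz.1).hasFDerivWithinAt)
    (fun z hz => (h1 z hz.1).trans (by
      have := mem_closedBall_iff_norm.1 hz.2
      gcongr)) (x := x) (y := y) ⟨hx, by simp⟩ ⟨hy, by simp [dist_eq_norm]⟩
  simp only [sub_self, map_zero, mul_zero, sub_zero, Real.norm_eq_abs] at hT
  refine le_trans (le_of_eq ?_) (hT.trans (le_of_eq (by ring)))
  congr 1; ring

lemma cont_nd {G : Type*} [NormedAddCommGroup G] {f : Cn n → G} {x : Cn n} (hf : ContinuousAt f x) {ε : ℝ}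
    (hε : 0 < ε) : ∃ R > 0, ∀ y, dist y x < R → ‖f y - f x‖ < ε := by
  obtain ⟨R, h, h'⟩ := Metric.continuousAt_iff.1 hf ε hε
  exact ⟨R, h, fun y hy => by rw [← dist_eq_norm]; exact h' hy⟩

lemma exp_decomp (θ : ℝ) (r : ℝ) (X : Cn n) : ((r : ℂ) * Complex.exp (θ * Complex.I)) • X
    = (r * Real.cos θ) • X + (r * Real.sin θ) • (I • X) := by
  rw [← csmul1]; congr 1
  rw [Complex.exp_mul_I]
  apply Complex.ext <;> simp [← Complex.ofReal_cos, ← Complex.ofReal_sin]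

lemma circ_int (k a b c d e f : ℝ) : ∫ θ in (0:ℝ)..(2 * Real.pi), (k + (a * Real.cos θ + b * Real.sin θ +
    c * (d * Real.cos θ^2 + 2 * e * (Real.sin θ * Real.cos θ) + f * Real.sin θ^2))) = 2 * Real.pi * k + c * Real.pi * (d + f) := by
  have i1 : ∀ f : ℝ → ℝ, Continuous f → IntervalIntegrable f volume 0 (2 * Real.pi) := fun f hf => hf.intervalIntegrable _ _
  rw [intervalIntegral.integral_add (i1 _ (by fun_prop)) (i1 _ (by fun_prop)),
    intervalIntegral.integral_add (i1 _ (by fun_prop)) (i1 _ (by fun_prop)),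
    intervalIntegral.integral_add (i1 _ (by fun_prop)) (i1 _ (by fun_prop)), intervalIntegral.integral_const_mul c,
    intervalIntegral.integral_add (i1 _ (by fun_prop)) (i1 _ (by fun_prop)),
    intervalIntegral.integral_add (i1 _ (by fun_prop)) (i1 _ (by fun_prop))]
  simp only [intervalIntegral.integral_const_mul, integral_cos_sq, integral_sin_sq, integral_sin_mul_cos₁, integral_sin,
    integral_cos, intervalIntegral.integral_const, Real.sin_zero, Real.cos_zero, Real.sin_two_pi, Real.cos_two_pi, smul_eq_mul]
  ring

lemma levi_submean {v : Cn n → ℝ} (hv : ContDiff ℝ 2 v) {x X : Cn n} {r0 : ℝ} (hr0 : 0 < r0)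
    (h : ∀ r : ℝ, 0 < r → r < r0 → 2 * Real.pi * v x ≤
      ∫ θ in (0:ℝ)..(2 * Real.pi), v (x + ((r : ℂ) * Complex.exp (θ * Complex.I)) • X)) :
    0 ≤ leviForm v x X := by
  set B := fderiv ℝ (fderiv ℝ v) x with hB
  have hl : leviForm v x X = (B X X + B (I • X) (I • X)) / 4 := by
    rw [leviForm, fderiv_fderiv_app hv.contDiffAt, fderiv_fderiv_app hv.contDiffAt]
  have hcB : Continuous (fun y => fderiv ℝ (fderiv ℝ v) y) :=
    ((hv.fderiv_right (m := 1) (by norm_num)).continuous_fderiv (by norm_num))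
  by_contra hneg
  push Not at hneg
  set N := ‖X‖^2 + 1
  set ε := - leviForm v x X / (2 * N) with hε
  have Np : 0 < N := by positivity
  have εp : 0 < ε := by simp only [hε]; apply div_pos <;> linarith
  obtain ⟨R, Rp, hR⟩ := cont_nd (G := Cn n →L[ℝ] Cn n →L[ℝ] ℝ) hcB.continuousAt (x := x) εp
  set r := min (r0/2) (R/2/N)
  have rp : 0 < r := by positivity
  have h1 : ∀ θ : ℝ, ‖((r : ℂ) * Complex.exp (θ * Complex.I)) • X‖ = r * ‖X‖ := by
    intro θ
    rw [norm_smul, norm_mul, Complex.norm_exp_ofReal_mul_I, mul_one, Complex.norm_real, Real.norm_of_nonneg rp.le]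
  have hrX : r * ‖X‖ < R := by
    have : r * ‖X‖ ≤ R/2/N * N := by
      gcongr
      · exact min_le_right _ _
      · nlinarith [sq_nonneg (‖X‖ - 1), norm_nonneg X]
    rw [div_mul_cancel₀ _ Np.ne'] at this
    linarith
  have h2 : ∀ θ ∈ Icc (0:ℝ) (2 * Real.pi), v (x + ((r : ℂ) * Complex.exp (θ * Complex.I)) • X) ≤
      v x + ε * (r * ‖X‖)^2 + (r * fderiv ℝ v x X * Real.cos θ + r * fderiv ℝ v x (I • X) * Real.sin θ +
      r^2/2 * (B X X * Real.cos θ ^2 + 2 * B X (I • X) * (Real.sin θ * Real.cos θ) + B (I • X) (I • X) * Real.sin θ^2)) := by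
    intro θ _
    have := taylor2 (S := ball x R) isOpen_ball (convex_ball x R) hv.contDiffOn (mem_ball_self Rp)
      (ε := ε) (fun y hy => (hR y hy).le)
      (y := x + ((r : ℂ) * Complex.exp (θ * Complex.I)) • X) (by simp [h1, hrX])
    have := (abs_le.1 this).2
    rw [add_sub_cancel_left, h1, exp_decomp] at this
    have s := symm2 (hv.contDiffAt (x := x)) (I • X) X
    simp only [← hB] at this s
    simp only [map_add, map_smul, add_apply, smul_apply, smul_eq_mul, s] at this
    rw [exp_decomp]
    nlinarith
  have ci : Continuous fun θ : ℝ => v (x + ((r : ℂ) * Complex.exp (θ * Complex.I)) • X) :=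
    hv.continuous.comp (by fun_prop)
  have := (h r rp ((min_le_left _ _).trans_lt (by linarith))).trans
    (intervalIntegral.integral_mono_on (by positivity) (ci.intervalIntegrable _ _) (Continuous.intervalIntegrable (by fun_prop) _ _) h2)
  rw [circ_int] at this
  have e2 : ε * (2 * N) = - leviForm v x X := by simp only [hε]; field_simp
  have e3 : ε * ‖X‖^2 ≤ - leviForm v x X / 2 := by
    have : ‖X‖^2 ≤ N := by simp only [N]; linarith
    nlinarith
  have e4 : 0 ≤ 2 * Real.pi * r^2 * (ε * ‖X‖^2 + leviForm v x X) := by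
    rw [hl]; nlinarith
  have : 0 < 2 * Real.pi * r^2 := by positivity
  nlinarith

lemma mol_submean {b : Cn n → ℝ} (hb : Continuous b) {δ : ℝ} (hδ : 0 < δ) {x Y : Cn n}
    (h : ∀ w, ‖w‖ ≤ δ → 2 * Real.pi * b (x - w) ≤ ∫ θ in (0:ℝ)..(2 * Real.pi), b (x - w + (Complex.exp (θ * Complex.I)) • Y)) :
    2 * Real.pi * mol δ b x ≤ ∫ θ in (0:ℝ)..(2 * Real.pi), mol δ b (x + Complex.exp (θ * Complex.I) • Y) := by
  simp only [mol_eq, smul_eq_mul]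
  have hc : Continuous (Function.uncurry fun (θ : ℝ) (w : Cn n) => kap δ w * b (x + Complex.exp (θ * Complex.I) • Y - w)) := by
    have := (kap_cd (n := n) δ).continuous
    unfold Function.uncurry; fun_prop
  have hk : Integrable (Function.uncurry fun (θ : ℝ) (w : Cn n) => kap δ w * b (x + Complex.exp (θ * Complex.I) • Y - w))
      ((volume.restrict (Ioc 0 (2 * Real.pi))).prod volume) := by
    have h1 : IntegrableOn (Function.uncurry fun (θ : ℝ) (w : Cn n) => kap δ w * b (x + Complex.exp (θ * Complex.I) • Y - w))
        (Icc 0 (2 * Real.pi) ×ˢ closedBall 0 δ) (volume.prod volume) :=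
      hc.continuousOn.integrableOn_compact (isCompact_Icc.prod (isCompact_closedBall _ _))
    have h2 : IntegrableOn (Function.uncurry fun (θ : ℝ) (w : Cn n) => kap δ w * b (x + Complex.exp (θ * Complex.I) • Y - w))
        (Ioc 0 (2 * Real.pi) ×ˢ univ) (volume.prod volume) := by
      refine h1.of_forall_sdiff_eq_zero (measurableSet_Ioc.prod MeasurableSet.univ) ?_
      rintro ⟨θ, w⟩ ⟨hw, hw'⟩
      have : δ ≤ ‖w‖ := by
        by_contra hh; push Not at hh
        exact hw' ⟨Ioc_subset_Icc_self hw.1, by simpa using hh.le⟩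
      simp [Function.uncurry, kap_zero hδ this]
    rwa [IntegrableOn, ← Measure.prod_restrict, Measure.restrict_univ] at h2
  rw [intervalIntegral.integral_of_le (by positivity), integral_integral_swap hk, ← integral_const_mul]
  refine integral_mono_ae ?_ hk.integral_prod_right ?_
  · have : Continuous fun w => 2 * Real.pi * (kap δ w * b (x - w)) := by
      have := (kap_cd (n := n) δ).continuous
      fun_prop
    refine this.integrable_of_hasCompactSupport (HasCompactSupport.intro (isCompact_closedBall 0 δ) fun w hw => ?_)
    rw [kap_zero hδ (by simpa using (not_le.1 (by simpa using hw)).le)]; simp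
  · refine Filter.Eventually.of_forall fun w => ?_
    simp only
    rw [integral_const_mul, ← intervalIntegral.integral_of_le (by positivity)]
    rcases le_or_gt ‖w‖ δ with hw | hw
    · have := h w hw
      have k := kap_nonneg hδ w
      have e : ∀ θ : ℝ, x + Complex.exp (θ * Complex.I) • Y - w = x - w + Complex.exp (θ * Complex.I) • Y := fun θ => by abel
      simp only [e]
      nlinarith
    · simp [kap_zero hδ hw.le]

end P11

section P12
open Filter (Tendsto atTop)
lemma nsq_fd (p x : Cn n) : ∃ L : Cn n →L[ℝ] ℝ, HasFDerivAt (fun y : Cn n => ‖y - p‖^2) L x ∧ ∀ v, L v = 2 * inner ℝ (x - p) v := by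
  have : HasFDerivAt (fun y : Cn n => ‖y - p‖^2) _ x := (((hasFDerivAt_id x).sub_const p).norm_sq)
  refine ⟨_, this, fun v => ?_⟩
  simp [inner_sub_left]
lemma levi_nsq (p x X : Cn n) : leviForm (fun y => ‖y - p‖^2) x X = ‖X‖^2 := by
  have h1 : ∀ v x : Cn n, fderiv ℝ (fun y : Cn n => ‖y - p‖^2) x v = 2 * inner ℝ (x - p) v := fun v x => by
    obtain ⟨L, h, h'⟩ := nsq_fd p x
    rw [h.fderiv, h']
  have h2 : ∀ v : Cn n, fderiv ℝ (fun y : Cn n => 2 * inner ℝ (y - p) v) x v = 2 * ‖v‖^2 := by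
    intro v
    have : HasFDerivAt (fun y : Cn n => 2 * inner ℝ (y - p) v) _ x :=
      (((hasFDerivAt_id x).sub_const p).inner ℝ (hasFDerivAt_const v x)).const_mul 2
    rw [this.fderiv]
    simp
  simp only [leviForm, h1, h2, norm_smul, Complex.norm_I]
  ring

lemma nsq_cd (p : Cn n) : ContDiff ℝ 2 (fun y : Cn n => ‖y - p‖^2) :=
  (contDiff_norm_sq ℝ).comp (contDiff_id.sub contDiff_const)

lemma log_lip {η s t : ℝ} (hη : 0 < η) (hs : η ≤ s) (ht : η ≤ t) : |Real.log s - Real.log t| ≤ |s - t| / η := by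
  have key : ∀ s t : ℝ, η ≤ s → η ≤ t → Real.log s - Real.log t ≤ |s - t| / η := by
    intro s t hs ht
    have t0 : 0 < t := hη.trans_le ht
    rw [← Real.log_div (hη.trans_le hs).ne' t0.ne']
    refine (Real.log_le_sub_one_of_pos (div_pos (hη.trans_le hs) t0)).trans ?_
    rw [div_sub_one t0.ne']
    calc (s - t) / t ≤ |s - t| / t := by gcongr; exact le_abs_self _
      _ ≤ _ := by gcongr
  rw [abs_le]
  constructor
  · have := key t s ht hs; rw [abs_sub_comm] at this; linarith
  · exact key s t hs ht

lemma exhaust {Ω : Set (Cn n)} (hΩ : IsPseudoconvex Ω) {p : Cn n} (hp : p ∉ Ω) {K : Set (Cn n)} (hK : IsCompact K)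
    (hKΩ : K ⊆ Ω) : ∃ (D : Set (Cn n)) (τ : Cn n → ℝ) (M : ℝ), IsOpen D ∧ K ⊆ D ∧ D ⊆ Ω ∧ ContDiffOn ℝ 2 τ D ∧
      (∀ x ∈ D, ∀ X, 0 ≤ leviForm τ x X) ∧ (∀ c, IsCompact {x ∈ D | τ x ≤ c}) ∧
      (∀ x ∈ D, ∀ j, ‖dz j (toC τ) x‖ ≤ M * τ x^2) := by
  set d : Cn n → ℝ := fun x => infDist x Ωᶜ with hd
  have dl : ∀ x y, |d x - d y| ≤ ‖x - y‖ := fun x y => by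
    have := (lipschitz_infDist_pt (Ωᶜ)).dist_le_mul x y
    simpa [Real.dist_eq, dist_eq_norm] using this
  have dcont : Continuous d := continuous_infDist_pt _
  have hdΩ : ∀ x, 0 < d x → x ∈ Ω := fun x hx => by
    by_contra h
    exact hx.ne' (infDist_zero_of_mem h)
  have hΩd : ∀ x ∈ Ω, 0 < d x := fun x hx => by
    have hc : IsClosed Ωᶜ := hΩ.1.isClosed_compl
    refine (hc.notMem_iff_infDist_pos ⟨p, hp⟩).1 (by simpa using hx)
  have dub : ∀ x, d x ≤ ‖x‖ + ‖p‖ := fun x => (infDist_le_dist_of_mem (show p ∈ Ωᶜ from hp)).trans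
    ((dist_eq_norm _ _).trans_le (norm_sub_le _ _))
  have hbc : ContinuousOn (fun x => -Real.log (d x) + ‖x‖^2) K :=
    ((dcont.continuousOn.log fun x hx => (hΩd x (hKΩ hx)).ne').neg).add (by fun_prop)
  obtain ⟨a0, ha0⟩ := hK.bddAbove_image hbc
  set a := a0 + 2
  set η := Real.exp (-(a+1)) / 4 with hη
  have ηp : 0 < η := by positivity
  set ε := η/4 with hε
  have εp : 0 < ε := by positivity
  set b : Cn n → ℝ := fun x => -Real.log (max (d x) η) with hb
  have bc : Continuous b := ((dcont.max continuous_const).log fun x => (ηp.trans_le (le_max_right _ _)).ne').neg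
  have bl : ∀ x y, |b x - b y| ≤ ‖x - y‖ / η := fun x y => by
    have := log_lip ηp (le_max_right (d y) η) (le_max_right (d x) η)
    calc |b x - b y| = |Real.log (max (d y) η) - Real.log (max (d x) η)| := by simp only [hb]; congr 1; ring
      _ ≤ _ := this
      _ ≤ |d y - d x| / η := div_le_div_of_nonneg_right (abs_max_sub_max_le_abs _ _ _) ηp.le
      _ ≤ _ := by gcongr; rw [norm_sub_rev]; exact dl y x
  have bd : ∀ x, η ≤ d x → b x = -Real.log (d x) := fun x hx => by simp only [hb, max_eq_left hx]
  set m : Cn n → ℝ := mol ε b with hm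
  have mcd : ContDiff ℝ 2 m := (mol_cd εp bc.locallyIntegrable).of_le two_le_top
  have mb : ∀ x, |m x - b x| ≤ 1 := by
    intro x
    have e1 : m x - b x = ∫ t, kap ε t * (b (x - t) - b x) := by
      simp only [mul_sub]
      have i1 : Integrable (fun t => kap ε t * b (x - t)) :=
        ((kap_cd ε).continuous.mul (by fun_prop)).integrable_of_hasCompactSupport ((kap_cs εp).mul_right)
      rw [integral_sub i1 ((kap_integrable εp).mul_const _), integral_mul_const, kap_int εp, one_mul, hm, mol_eq]
      rfl
    rw [e1, ← Real.norm_eq_abs]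
    refine (norm_integral_le_of_norm_le (kap_integrable εp) (Filter.Eventually.of_forall fun t => ?_)).trans (kap_int εp).le
    rw [norm_mul, Real.norm_of_nonneg (kap_nonneg εp t)]
    rcases le_or_gt ε ‖t‖ with h | h
    · simp [kap_zero εp h]
    · refine mul_le_of_le_one_right (kap_nonneg εp t) ((bl _ _).trans ?_)
      rw [div_le_one ηp]
      simp only [sub_sub_cancel_left, norm_neg]; linarith
  have ml : ∀ x, 2 * η < d x → ∀ X, 0 ≤ leviForm m x X := by
    intro x hx X
    refine levi_submean mcd (r0 := ε / (‖X‖ + 1)) (by positivity) fun r rp hr => ?_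
    have hrX : r * ‖X‖ ≤ ε := by
      rw [lt_div_iff₀ (by positivity)] at hr
      nlinarith [norm_nonneg X]
    have := mol_submean bc εp (x := x) (Y := (r:ℂ) • X) (fun w hw => ?_)
    · simpa only [smul_smul, mul_comm] using this
    · have key : ∀ l : ℂ, ‖l‖ ≤ r → η ≤ d (x - w + l • X) := by
        intro l hl
        have h1 := (abs_le.1 (dl x (x - w + l • X))).2
        have h2 : ‖x - (x - w + l • X)‖ ≤ ε + ε := by
          rw [show x - (x - w + l • X) = w - l • X by abel]
          refine (norm_sub_le _ _).trans (add_le_add hw ?_)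
          rw [norm_smul]
          exact (by gcongr : ‖l‖ * ‖X‖ ≤ r * ‖X‖).trans hrX
        linarith
      have k0 := key 0 (by simpa using rp.le)
      rw [zero_smul, add_zero] at k0
      have := hΩ.2.2 (x - w) (hdΩ _ (ηp.trans_le k0)) X r rp fun l hl => hdΩ _ (ηp.trans_le (key l hl))
      rw [← sub_nonneg] at this
      rw [bd _ k0, ← sub_nonneg]
      have e : (∫ θ in (0:ℝ)..(2 * Real.pi), b (x - w + Complex.exp (θ * Complex.I) • (r:ℂ) • X)) =
          ∫ θ in (0:ℝ)..(2 * Real.pi), -Real.log (infDist (x - w + ((r : ℂ) * Complex.exp (θ * Complex.I)) • X) Ωᶜ) := by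
        congr 1; funext θ
        rw [smul_smul, mul_comm]
        refine bd _ (key _ ?_)
        simp [Complex.norm_exp_ofReal_mul_I, abs_of_pos rp]
      rw [e]
      have pp : (0:ℝ) < 2 * Real.pi := by positivity
      have := mul_nonneg pp.le this
      rw [mul_sub, ← mul_assoc, mul_one_div_cancel pp.ne', one_mul] at this
      exact this
  set u : Cn n → ℝ := fun x => m x + ‖x - 0‖^2 with hu
  have ucd : ContDiff ℝ 2 u := mcd.add (nsq_cd 0)
  have ul : ∀ x, 2 * η < d x → ∀ X, 0 ≤ leviForm u x X := fun x hx X => by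
    rw [hu, levi_add mcd.contDiffAt (nsq_cd 0).contDiffAt, levi_nsq]
    have := ml x hx X; positivity
  have d4 : ∀ x, 2 * η < d x → u x < a → 4 * η ≤ d x ∧ ‖x‖^2 < a + 1 + ‖x‖ + ‖p‖ := by
    intro x hx hux
    have h1 := (abs_le.1 (mb x)).1
    rw [bd x (by linarith)] at h1
    have dp : 0 < d x := by linarith
    simp only [hu, sub_zero] at hux
    constructor
    · have : -(a+1) ≤ Real.log (d x) := by nlinarith [sq_nonneg ‖x‖]
      have := (Real.le_log_iff_exp_le dp).1 this
      simp only [hη]; linarith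
    · have := Real.log_le_sub_one_of_pos dp
      have := dub x
      linarith
  have bdd : ∀ x, 2 * η < d x → u x < a → x ∈ closedBall (0 : Cn n) (|a| + 3 + ‖p‖) := by
    intro x hx hux
    have := (d4 x hx hux).2
    rw [mem_closedBall_zero_iff]
    by_contra h; push Not at h
    have h1 := le_abs_self a
    have h2 := norm_nonneg p
    have h3 := abs_nonneg a
    nlinarith
  obtain ⟨M, hM⟩ : ∃ M, ∀ j : Fin n, ∀ x ∈ closedBall (0 : Cn n) (|a| + 3 + ‖p‖), ‖dz j (toC u) x‖ ≤ M := by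
    have hh : ∀ j : Fin n, ∃ M, ∀ x ∈ closedBall (0 : Cn n) (|a| + 3 + ‖p‖), ‖dz j (toC u) x‖ ≤ M := fun j =>
      (isCompact_closedBall _ _).exists_bound_of_continuousOn
        (dz_contDiff j (two_of' (Complex.ofRealCLM.contDiff.comp ucd))).continuous.continuousOn
    choose M hM using hh
    obtain ⟨M', hM'⟩ := Finset.exists_le (Finset.univ.image M)
    exact ⟨M', fun j x hx => (hM j x hx).trans (hM' _ (by simp))⟩
  refine ⟨{x | 2 * η < d x ∧ u x < a}, fun x => (a - u x)⁻¹, M,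
    (isOpen_lt continuous_const dcont).inter (isOpen_lt ucd.continuous continuous_const),
    fun x hx => ?_, fun x hx => hdΩ x (by linarith [hx.1]), ?_, fun x hx X => ?_, fun c => ?_, fun x hx j => ?_⟩
  · have h1 : -Real.log (d x) + ‖x‖^2 ≤ a0 := ha0 ⟨x, hx, rfl⟩
    have h2 : -(a+1) ≤ Real.log (d x) := by simp only [a]; nlinarith [sq_nonneg ‖x‖]
    have h3 := (Real.le_log_iff_exp_le (hΩd x (hKΩ hx))).1 h2
    have h4 : 2 * η < d x := by simp only [hη] at ηp ⊢; linarith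
    refine ⟨h4, ?_⟩
    have h5 := (abs_le.1 (mb x)).2
    rw [bd x (by linarith)] at h5
    simp only [hu, sub_zero, a]; linarith
  · exact (contDiff_const.sub ucd).contDiffOn.inv fun x hx => (sub_pos.2 hx.2).ne'
  · have hx2 : 0 < a - u x := sub_pos.2 hx.2
    have hev : ∀ᶠ t in nhds (u x), HasDerivAt (fun t => (a - t)⁻¹) (((a - t)^2)⁻¹) t := by
      filter_upwards [Iio_mem_nhds hx.2] with t ht
      have : HasDerivAt (fun t => (a - t)⁻¹) (-(-1) / (a - t)^2) t :=
        ((hasDerivAt_id t).const_sub a).inv (sub_pos.2 ht).ne'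
      simpa using this
    have h2 : HasDerivAt (fun t => ((a - t)^2)⁻¹) (2 / (a - u x)^3) (u x) := by
      have := (((hasDerivAt_id (u x)).const_sub a).pow 2).inv (pow_pos hx2 2).ne'
      refine this.congr_deriv ?_
      simp; field_simp
    rw [levi_chain' hev h2 ucd.contDiffAt]
    have := ul x hx.1 X
    positivity
  · rcases le_or_gt c 0 with hc | hc
    · convert isCompact_empty
      ext x
      simp only [mem_ofPred_eq, mem_empty_iff_false, iff_false]
      rintro ⟨h1, h2⟩
      exact absurd (inv_pos.2 (sub_pos.2 h1.2)) (by linarith)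
    · have : {x | x ∈ {x | 2 * η < d x ∧ u x < a} ∧ (a - u x)⁻¹ ≤ c} = {x | 4 * η ≤ d x} ∩ {x | u x ≤ a - c⁻¹} := by
        ext x
        constructor
        · rintro ⟨h1, h2⟩
          refine ⟨(d4 x h1.1 h1.2).1, ?_⟩
          have := (inv_le_comm₀ (sub_pos.2 h1.2) hc).1 h2
          simp only [mem_ofPred_eq]; linarith
        · rintro ⟨h1, h2⟩
          simp only [mem_ofPred_eq] at h1 h2
          have h3 : c⁻¹ ≤ a - u x := by linarith
          have h4 := inv_pos.2 hc
          exact ⟨⟨by linarith, by linarith⟩, (inv_le_comm₀ (by linarith) hc).2 h3⟩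
      rw [this]
      refine (isCompact_closedBall _ _).of_isClosed_subset ((isClosed_le continuous_const dcont).inter
        (isClosed_le ucd.continuous continuous_const)) fun x hx => bdd x ?_ ?_
      · have : 4 * η ≤ d x := hx.1
        linarith
      · have h2 : u x ≤ a - c⁻¹ := hx.2
        have := inv_pos.2 hc
        linarith
  · have hx2 : 0 < a - u x := sub_pos.2 hx.2
    have h1 : HasDerivAt (fun t => (a - t)⁻¹) (((a - u x)^2)⁻¹) (u x) := by
      have : HasDerivAt (fun t => (a - t)⁻¹) (-(-1) / (a - u x)^2) (u x) :=
        ((hasDerivAt_id _).const_sub a).inv hx2.ne'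
      simpa using this
    rw [dz_chain j h1 (ucd.differentiable (by norm_num) x), norm_mul, Complex.norm_real, Real.norm_of_nonneg (by positivity),
      mul_comm, inv_pow]
    gcongr
    exact hM j x (bdd x hx.1 hx.2)

lemma core' {Ω : Set (Cn n)} (hΩ : IsPseudoconvex Ω) {p : Cn n} (hp : p ∉ Ω) {φ0 : Cn n → ℝ}
    (hφ0 : ContDiffOn ℝ 2 φ0 Ω) (hp0 : ∀ x ∈ Ω, 0 ≤ φ0 x) {B : ℝ} (hB : ∀ x ∈ Ω, φ0 x ≤ B)
    {A : Set (Cn n)} (hA : MeasurableSet A) {c : ℝ} (hc : 0 < c)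
    (hl : ∀ x ∈ Ω, ∀ X, A.indicator (fun _ => c) x * ‖X‖^2 ≤ leviForm φ0 x X)
    {α : Fin n → Cn n → ℂ} (hα : ∀ j, MemLp (α j) 2) (hα0 : ∀ j, ∀ x, x ∉ A → α j x = 0)
    (hcl : ∀ h, Tst Ω h → ∀ j k, ∫ x, α j x * dzb k h x = ∫ x, α k x * dzb j h x)
    {g : Fin n → Cn n → ℂ} (hg : ∀ j, Tst Ω (g j)) :
    ‖∑ j, ∫ x, α j x * g j x‖^2 ≤ 2 * Real.exp (1 + B) / c * (∑ j, ∫ x, ‖α j x‖^2)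
      * ∫ x, ‖∑ j, dzb j (g j) x‖^2 := by
  choose gc K hK hKΩ hg0 using hg
  obtain ⟨D, τ, M, hD, hKD, hDΩ, h1, h2, h3, h4⟩ := exhaust hΩ hp (isCompact_iUnion hK) (iUnion_subset hKΩ)
  have hT : ∀ j, Tst D (g j) := fun j => ⟨gc j, K j, hK j, (subset_iUnion K j).trans hKD, hg0 j⟩
  have z : ∀ (β h : Cn n → ℂ), (∀ x ∉ D, h x = 0) → ∫ x, D.indicator β x * h x = ∫ x, β x * h x := by
    intro β h h0
    congr 1; funext x
    by_cases hx : x ∈ D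
    · rw [indicator_of_mem hx]
    · rw [h0 x hx]; simp
  have off : ∀ {h}, Tst D h → ∀ x ∉ D, h x = 0 := fun ⟨_, K, _, hK, h0⟩ x hx => h0 x fun h => hx (hK h)
  have offb : ∀ {h}, Tst D h → ∀ j, ∀ x ∉ D, dzb j h x = 0 := fun ⟨_, K, hc, hK, h0⟩ j x hx =>
    dzb_zero_off j hc.isClosed h0 x fun h => hx (hK h)
  have := core hD h1 h2 h3 h4 (hφ0.mono hDΩ) (fun x hx => hp0 x (hDΩ hx)) (fun x hx => hB x (hDΩ hx)) hA hc
    (fun x hx => hl x (hDΩ hx)) (α := fun j => D.indicator (α j)) (fun j => (hα j).indicator hD.measurableSet)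
    (fun j x hx => by
      by_cases h : x ∈ D
      · rw [indicator_of_mem h]; exact hα0 j x fun h' => hx ⟨h', h⟩
      · rw [indicator_of_notMem h])
    (fun h hh j k => by
      rw [z _ _ (offb hh k), z _ _ (offb hh j)]
      obtain ⟨a, K, b, c, d⟩ := hh
      exact hcl h ⟨a, K, b, c.trans hDΩ, d⟩ j k) hT
  simp only [fun j => z (α j) (g j) (off (hT j))] at this
  refine this.trans ?_
  refine mul_le_mul_of_nonneg_right (mul_le_mul_of_nonneg_left (Finset.sum_le_sum fun j _ => ?_) (by positivity)) (by positivity)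
  refine integral_mono (nsq_int ((hα j).indicator hD.measurableSet)) (nsq_int (hα j)) fun x => ?_
  exact pow_le_pow_left₀ (norm_nonneg _) (norm_indicator_le_norm_self _ _) 2

end P12

section P13
open Filter (Tendsto atTop)

lemma riesz {M H : Type*} [AddCommGroup M] [Module ℂ M] [NormedAddCommGroup H] [InnerProductSpace ℂ H] [CompleteSpace H]
    (T : M →ₗ[ℂ] H) (l : M →ₗ[ℂ] ℂ) {C : ℝ} (hC : 0 ≤ C) (h : ∀ g, ‖l g‖^2 ≤ C * ‖T g‖^2) :
    ∃ u : H, ‖u‖^2 ≤ C ∧ ∀ g, inner ℂ u (T g) = l g := by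
  obtain ⟨S, hS⟩ := T.rangeRestrict.exists_rightInverse_of_surjective T.range_rangeRestrict
  have hS' : ∀ y, T (S y) = y := fun y => congrArg Subtype.val (LinearMap.congr_fun hS y)
  have hb : ∀ y, ‖(l ∘ₗ S) y‖ ≤ √C * ‖y‖ := fun y => by
    refine abs_le_of_sq_le_sq' ?_ (by positivity) |>.2
    rw [mul_pow, Real.sq_sqrt hC]
    have := h (S y); rw [hS'] at this; exact this
  obtain ⟨f, hf, hfn⟩ := exists_extension_norm_eq (LinearMap.range T) ((l ∘ₗ S).mkContinuous (√C) hb)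
  refine ⟨(InnerProductSpace.toDual ℂ H).symm f, ?_, fun g => ?_⟩
  · rw [LinearIsometryEquiv.norm_map, hfn]
    exact (pow_le_pow_left₀ (norm_nonneg _) (LinearMap.mkContinuous_norm_le _ (by positivity) hb) 2).trans (Real.sq_sqrt hC).le
  · rw [InnerProductSpace.toDual_symm_apply, hf ⟨T g, LinearMap.mem_range_self T g⟩]
    simp only [LinearMap.mkContinuous_apply, LinearMap.comp_apply]
    have := h (S ⟨T g, LinearMap.mem_range_self T g⟩ - g)
    rw [map_sub, map_sub, hS', sub_self, norm_zero] at this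
    have : ‖l (S ⟨T g, LinearMap.mem_range_self T g⟩) - l g‖ = 0 := by
      have h0 := norm_nonneg (l (S ⟨T g, LinearMap.mem_range_self T g⟩) - l g)
      nlinarith
    exact sub_eq_zero.1 (norm_eq_zero.1 this)

lemma Tst.add {D : Set (Cn n)} {f g : Cn n → ℂ} (hf : Tst D f) (hg : Tst D g) : Tst D (f + g) := by
  obtain ⟨a, K, b, c, d⟩ := hf
  obtain ⟨a', K', b', c', d'⟩ := hg
  refine ⟨a.add a', K ∪ K', b.union b', union_subset c c', fun x hx => ?_⟩
  simp only [mem_union, not_or] at hx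
  simp [d x hx.1, d' x hx.2]

lemma Tst.smul {D : Set (Cn n)} {f : Cn n → ℂ} (hf : Tst D f) (t : ℂ) : Tst D (t • f) := by
  obtain ⟨a, K, b, c, d⟩ := hf
  exact ⟨contDiff_const.mul a, K, b, c, fun x hx => by simp [d x hx]⟩

lemma Tst.zero {D : Set (Cn n)} : Tst D (0 : Cn n → ℂ) :=
  ⟨contDiff_const, ∅, isCompact_empty, empty_subset _, fun _ _ => rfl⟩

lemma Tst.memLp {D : Set (Cn n)} {f : Cn n → ℂ} (hf : Tst D f) : MemLp f 2 := by
  obtain ⟨a, K, b, _, d⟩ := hf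
  exact memLp_off isOpen_univ a.continuous.continuousOn b (subset_univ _) d

lemma Tst.dzb' {D : Set (Cn n)} {f : Cn n → ℂ} (hf : Tst D f) (j : Fin n) : MemLp (_root_.dzb j f) 2 := by
  obtain ⟨a, K, b, _, d⟩ := hf
  exact memLp_off isOpen_univ (dzb_contDiff j (two_of' a)).continuous.continuousOn b (subset_univ _)
    (dzb_zero_off j b.isClosed d)

lemma Tst.diff {D : Set (Cn n)} {f : Cn n → ℂ} (hf : Tst D f) (x : Cn n) : DifferentiableAt ℝ f x :=
  hf.1.differentiable (by norm_num) x

lemma dzb_add (j : Fin n) {f g : Cn n → ℂ} {x : Cn n} (hf : DifferentiableAt ℝ f x)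
    (hg : DifferentiableAt ℝ g x) : dzb j (f + g) x = dzb j f x + dzb j g x := by
  simp only [dzb, fderiv_add hf hg, add_apply]; ring

lemma dzb_smul (j : Fin n) {f : Cn n → ℂ} {x : Cn n} (t : ℂ) :
    dzb j (t • f) x = t * dzb j f x := by
  simp only [dzb, fderiv_const_smul_field t, FunLike.coe_smul, Pi.smul_apply, smul_eq_mul]; ring

lemma dzb_zero (j : Fin n) (x : Cn n) : dzb j (0 : Cn n → ℂ) x = 0 := by
  have := dzb_zero_off j (K := (∅ : Set (Cn n))) isClosed_empty (f := 0) (fun _ _ => rfl) x (by simp)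
  exact this

lemma dbar_solve {Ω : Set (Cn n)} {α : Fin n → Cn n → ℂ} (hα : ∀ j, MemLp (α j) 2) {C : ℝ} (hC : 0 ≤ C)
    (h : ∀ g : Fin n → Cn n → ℂ, (∀ j, Tst Ω (g j)) →
      ‖∑ j, ∫ x, α j x * g j x‖^2 ≤ C * ∫ x, ‖∑ j, dzb j (g j) x‖^2) :
    ∃ u : Cn n → ℂ, MemLp u 2 ∧ ∫ x, ‖u x‖^2 ≤ C ∧ ∀ h, Tst Ω h → ∀ j, ∫ x, u x * dzb j h x = - ∫ x, α j x * h x := by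
  let M : Submodule ℂ (Fin n → Cn n → ℂ) :=
    { carrier := {g | ∀ j, Tst Ω (g j)}
      add_mem' := fun ha hb j => (ha j).add (hb j)
      zero_mem' := fun j => Tst.zero
      smul_mem' := fun t g hg j => (hg j).smul t }
  have hdiv : ∀ g : M, MemLp (fun x => ∑ j, dzb j (g.1 j) x) 2 := fun g => memLp_finsetSum _ fun j _ => (g.2 j).dzb' j
  let T : M →ₗ[ℂ] Lp ℂ 2 (volume : Measure (Cn n)) :=
    { toFun := fun g => (hdiv g).toLp
      map_add' := fun f g => by
        rw [← MemLp.toLp_add]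
        congr 1; funext x
        simp only [Pi.add_apply, ← Finset.sum_add_distrib]
        exact Finset.sum_congr rfl fun j _ => dzb_add j ((f.2 j).diff x) ((g.2 j).diff x)
      map_smul' := fun t f => by
        rw [RingHom.id_apply, ← MemLp.toLp_const_smul]
        congr 1; funext x
        simp only [Pi.smul_apply, smul_eq_mul, Finset.mul_sum]
        exact Finset.sum_congr rfl fun j _ => dzb_smul j t }
  let l : M →ₗ[ℂ] ℂ :=
    { toFun := fun g => - ∑ j, ∫ x, α j x * g.1 j x
      map_add' := fun f g => by
        rw [← neg_add, ← Finset.sum_add_distrib]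
        congr 1
        refine Finset.sum_congr rfl fun j _ => ?_
        rw [← integral_add (memLp_mulint (hα j) (f.2 j).memLp) (memLp_mulint (hα j) (g.2 j).memLp)]
        simp [mul_add]
      map_smul' := fun t f => by
        simp only [RingHom.id_apply, smul_eq_mul, mul_neg, Finset.mul_sum, ← integral_const_mul]
        congr 1
        refine Finset.sum_congr rfl fun j _ => ?_
        congr 1; funext x
        simp; ring }
  have nT : ∀ g : M, ‖T g‖^2 = ∫ x, ‖∑ j, dzb j (g.1 j) x‖^2 := fun g => by
    have h1 : inner ℂ (T g) (T g) = ((‖T g‖^2 : ℝ) : ℂ) := by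
      rw [inner_self_eq_norm_sq_to_K]; norm_cast
    rw [L2.inner_def] at h1
    have h2 : ∫ x, inner ℂ ((T g) x) ((T g) x) = ((∫ x, ‖∑ j, dzb j (g.1 j) x‖^2 : ℝ) : ℂ) := by
      rw [← integral_complex_ofReal]
      refine integral_congr_ae ?_
      filter_upwards [(hdiv g).coeFn_toLp] with x hx
      rw [show (T g) x = ∑ j, dzb j (g.1 j) x from hx, inner_self_eq_norm_sq_to_K]
      norm_cast
    rw [h2] at h1
    exact_mod_cast h1.symm
  obtain ⟨u, hu, hu'⟩ := riesz T l hC fun g => by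
    rw [nT]
    refine le_trans (le_of_eq ?_) (h g.1 g.2)
    simp only [l, LinearMap.coe_mk, AddHom.coe_mk, norm_neg]
  have um : MemLp (u : Cn n → ℂ) 2 := Lp.memLp u
  refine ⟨fun x => conj (u x), memLp_conj um, ?_, fun h hh j => ?_⟩
  · refine le_trans (le_of_eq ?_) hu
    have h1 : inner ℂ u u = ((‖u‖^2 : ℝ) : ℂ) := by
      rw [inner_self_eq_norm_sq_to_K]; norm_cast
    rw [L2.inner_def] at h1
    have h2 : ∫ x, inner ℂ (u x) (u x) = ((∫ x, ‖conj (u x)‖^2 : ℝ) : ℂ) := by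
      rw [← integral_complex_ofReal]
      congr 1; funext x
      rw [inner_self_eq_norm_sq_to_K, RCLike.norm_conj]
      norm_cast
    rw [h2] at h1
    exact_mod_cast h1
  · let g : M := ⟨fun i => if i = j then h else 0, fun i => by
      simp only; split_ifs
      · exact hh
      · exact Tst.zero⟩
    have := hu' g
    have e : l g = - ∫ x, α j x * h x := by
      simp only [l, g, LinearMap.coe_mk, AddHom.coe_mk]
      congr 1
      rw [Finset.sum_eq_single j]
      · simp
      · intro b _ hb; simp [hb]
      · simp
    rw [e] at this
    rw [← this, L2.inner_def]
    refine integral_congr_ae ?_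
    filter_upwards [(hdiv g).coeFn_toLp] with x hx
    rw [show (T g) x = ∑ j, dzb j (g.1 j) x from hx, Finset.sum_eq_single j]
    · simp [g, mul_comm]
    · intro b _ hb; simp [g, hb, dzb_zero]
    · simp

end P13

section P14
open Filter (Tendsto atTop)
def rotE (a : ℂ) (ha : ‖a‖ = 1) : Cn n ≃ₗᵢ[ℝ] Cn n :=
  LinearIsometryEquiv.mk ((LinearEquiv.smulOfNeZero ℂ (Cn n) a (by rintro rfl; simp at ha)).restrictScalars ℝ)
    (fun x => by simp [norm_smul, ha])

lemma rot_int {F : Type*} [NormedAddCommGroup F] [NormedSpace ℝ F] (a : ℂ) (ha : ‖a‖ = 1) (G : Cn n → F) :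
    ∫ t, G (a • t) = ∫ t, G t := by
  have := (rotE (n := n) a ha).measurePreserving
  exact this.integral_comp (rotE a ha).toHomeomorph.measurableEmbedding G

lemma circ_mean {h : Cn n → ℂ} {x w : Cn n} {O : Set (Cn n)} (hh : DifferentiableOn ℂ h O)
    (hw : closedBall x ‖w‖ ⊆ O) :
    ∫ θ in (0:ℝ)..(2 * Real.pi), h (x - Complex.exp (θ * Complex.I) • w) = 2 * Real.pi * h x := by
  set f : ℂ → ℂ := fun l => h (x - l • w) with hf
  have hd : DifferentiableOn ℂ f (closedBall 0 1) := by
    refine hh.comp (by fun_prop) fun l hl => hw ?_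
    have : ‖l‖ ≤ 1 := by simpa using hl
    simp only [mem_closedBall, dist_eq_norm, sub_sub_cancel_left, norm_neg, norm_smul]
    nlinarith [norm_nonneg w]
  have := (DifferentiableOn.diffContOnCl (s := ball 0 |1|) (f := f) (by
    rw [abs_one, closure_ball _ one_ne_zero]; exact hd)).circleAverage
  rw [Real.circleAverage_def] at this
  simp only [hf, circleMap, zero_add, Complex.ofReal_one, one_mul, zero_smul, sub_zero] at this
  rw [← this]
  have hp : (2 * Real.pi : ℂ) ≠ 0 := by exact_mod_cast (by positivity : (2 * Real.pi) ≠ 0)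
  rw [Complex.real_smul, ← mul_assoc]; push_cast; rw [mul_inv_cancel₀ hp, one_mul]

lemma mvp {h : Cn n → ℂ} {x : Cn n} {O : Set (Cn n)} (hh : DifferentiableOn ℂ h O) (hO : IsOpen O) {δ : ℝ} (hδ : 0 < δ)
    (hw : closedBall x δ ⊆ O) : mol δ h x = h x := by
  rw [mol_eq]
  set G : Cn n → ℂ := fun t => kap δ t • h (x - t) with hG
  have hGc : Continuous G := by
    refine (cont_off (O := (fun t => x - t) ⁻¹' O) (K := closedBall 0 δ) (hO.preimage (by fun_prop)) ?_ (isCompact_closedBall _ _) ?_ ?_).1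
    · exact (kap_cd (n := n) δ).continuous.continuousOn.smul (hh.continuousOn.comp (by fun_prop) fun t ht => ht)
    · intro t ht; apply hw; simpa [dist_eq_norm] using ht
    · intro t ht; simp only [hG]; rw [kap_zero hδ (by simpa using (not_le.1 (by simpa using ht)).le), zero_smul]
  have hna : ∀ θ : ℝ, ‖Complex.exp (θ * Complex.I)‖ = 1 := Complex.norm_exp_ofReal_mul_I
  have hc : Continuous (Function.uncurry fun (θ : ℝ) (t : Cn n) => G (Complex.exp (θ * Complex.I) • t)) := by
    unfold Function.uncurry; fun_prop
  have hk : Integrable (Function.uncurry fun (θ : ℝ) (w : Cn n) => G (Complex.exp (θ * Complex.I) • w))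
      ((volume.restrict (Ioc 0 (2 * Real.pi))).prod volume) := by
    have h1 : IntegrableOn (Function.uncurry fun (θ : ℝ) (w : Cn n) => G (Complex.exp (θ * Complex.I) • w))
        (Icc 0 (2 * Real.pi) ×ˢ closedBall 0 δ) (volume.prod volume) :=
      hc.continuousOn.integrableOn_compact (isCompact_Icc.prod (isCompact_closedBall _ _))
    have h2 : IntegrableOn (Function.uncurry fun (θ : ℝ) (w : Cn n) => G (Complex.exp (θ * Complex.I) • w))
        (Ioc 0 (2 * Real.pi) ×ˢ univ) (volume.prod volume) := by
      refine h1.of_forall_sdiff_eq_zero (measurableSet_Ioc.prod MeasurableSet.univ) ?_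
      rintro ⟨θ, w⟩ ⟨hw, hw'⟩
      have : δ ≤ ‖w‖ := by
        by_contra hh; push Not at hh
        exact hw' ⟨Ioc_subset_Icc_self hw.1, by simpa using hh.le⟩
      simp only [Function.uncurry, hG]
      rw [kap_zero hδ (by rwa [norm_smul, hna, one_mul]), zero_smul]
    rwa [IntegrableOn, ← Measure.prod_restrict, Measure.restrict_univ] at h2
  have e1 : ∫ θ in (0:ℝ)..(2 * Real.pi), ∫ t, G (Complex.exp (θ * Complex.I) • t) = 2 * Real.pi * ∫ t, G t := by
    simp_rw [rot_int _ (hna _) G]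
    simp
  have e2 : ∫ θ in (0:ℝ)..(2 * Real.pi), ∫ t, G (Complex.exp (θ * Complex.I) • t) = ∫ t : Cn n, kap δ t • (2 * Real.pi * h x) := by
    rw [intervalIntegral.integral_of_le (by positivity), integral_integral_swap hk]
    congr 1; ext t
    rw [← intervalIntegral.integral_of_le (by positivity)]
    have : ∀ θ : ℝ, G (Complex.exp (θ * Complex.I) • t) = kap δ t • h (x - Complex.exp (θ * Complex.I) • t) := by
      intro θ; simp only [hG]; rw [kap_rad δ (y := t) (by rw [norm_smul, hna, one_mul])]
    simp_rw [this]
    rw [intervalIntegral.integral_smul]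
    rcases le_or_gt ‖t‖ δ with ht | ht
    · rw [circ_mean hh ((closedBall_subset_closedBall ht).trans hw)]
    · rw [kap_zero hδ ht.le]; simp
  rw [e2, integral_smul_const, kap_int hδ, one_smul] at e1
  have : (2 * Real.pi : ℂ) ≠ 0 := by exact_mod_cast (by positivity : (2 * Real.pi) ≠ 0)
  exact (mul_left_cancel₀ this e1).symm

lemma mol_congr {F : Type*} [NormedAddCommGroup F] [NormedSpace ℝ F] {f g : Cn n → F} {x : Cn n} {δ : ℝ} (hδ : 0 < δ)
    (h : ∀ t ∈ ball x δ, f t = g t) : mol δ f x = mol δ g x := by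
  refine integral_congr_ae (Filter.Eventually.of_forall fun t => ?_)
  simp only
  by_cases ht : t ∈ ball x δ
  · rw [h t ht]
  · rw [kap_zero hδ (by simpa [dist_eq_norm, norm_sub_rev] using ht), zero_smul, zero_smul]

lemma hol_cd {h : Cn n → ℂ} {O : Set (Cn n)} (hh : DifferentiableOn ℂ h O) (hO : IsOpen O) : ContDiffOn ℝ 2 h O := by
  intro x hx
  obtain ⟨δ, hδ, hb⟩ := Metric.isOpen_iff.1 hO x hx
  set g := (closedBall x (2*δ/3)).indicator h
  have hli : LocallyIntegrable g := by
    refine Integrable.locallyIntegrable ?_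
    rw [integrable_indicator_iff isClosed_closedBall.measurableSet]
    exact (hh.continuousOn.mono ((closedBall_subset_ball (by linarith)).trans hb)).integrableOn_compact (isCompact_closedBall _ _)
  have h1 := (mol_cd (by positivity : 0 < δ/3) hli).contDiffAt (x := x)
  refine ContDiffAt.contDiffWithinAt ((h1.of_le two_le_top).congr_of_eventuallyEq ?_)
  filter_upwards [ball_mem_nhds x (by positivity : 0 < δ/3)] with y hy
  rw [mem_ball] at hy
  rw [← mvp hh hO (by positivity : 0 < δ/3) (x := y)]
  · refine mol_congr (by positivity) fun t ht => ?_
    rw [mem_ball] at ht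
    refine (indicator_of_mem (s := closedBall x (2*δ/3)) ?_ h).symm
    have := dist_triangle t y x
    simp only [mem_closedBall]; linarith
  · refine Subset.trans (fun t ht => ?_) hb
    rw [mem_closedBall] at ht
    have := dist_triangle t y x
    simp only [mem_ball]; linarith

lemma dzb_hol {h : Cn n → ℂ} {x : Cn n} (hh : DifferentiableAt ℂ h x) (j : Fin n) : dzb j h x = 0 := by
  have := hh.hasFDerivAt.restrictScalars ℝ
  rw [dzb, this.fderiv]
  simp only [ContinuousLinearMap.coe_restrictScalars', map_smul, smul_eq_mul, ← mul_assoc, Complex.I_mul_I]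
  simp

lemma hol_of_dzb {h : Cn n → ℂ} {x : Cn n} (hh : DifferentiableAt ℝ h x) (hz : ∀ j, dzb j h x = 0) : DifferentiableAt ℂ h x := by
  rw [differentiableAt_iff_restrictScalars ℝ hh]
  set D := fderiv ℝ h x with hD
  refine ⟨∑ j, (D (ee j)) • (EuclideanSpace.proj j : Cn n →L[ℂ] ℂ), ?_⟩
  have hI : ∀ j, D (I • ee j) = I * D (ee j) := by
    intro j
    have := hz j
    rw [dzb, ← hD] at this
    have h2 : D (ee j) + I * D (I • ee j) = 0 := by
      rcases div_eq_zero_iff.1 this with h | h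
      · exact h
      · norm_num at h
    linear_combination (-I) * h2 + D (I • ee j) * Complex.I_mul_I
  ext X
  conv_rhs => rw [sum_ee X]
  simp only [ContinuousLinearMap.coe_restrictScalars', sum_apply, map_sum]
  refine Finset.sum_congr rfl fun j _ => ?_
  have : X j • ee j = (X j).re • ee j + (X j).im • (I • ee j) := by rw [← csmul1]
  rw [this, map_add, map_smul, map_smul, hI]
  simp only [FunLike.coe_smul, Pi.smul_apply, smul_eq_mul, EuclideanSpace.coe_proj, Complex.real_smul]
  conv_lhs => rw [← Complex.re_add_im (X j)]
  ring

end P14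

section P15
open Filter (Tendsto atTop)
lemma mol_hol {Ω : Set (Cn n)} {v : Cn n → ℂ} (hv : MemLp v 2)
    (hz : ∀ h, Tst Ω h → ∀ j, ∫ x, v x * dzb j h x = 0) {ε : ℝ} (hε : 0 < ε) {y : Cn n} (hy : closedBall y ε ⊆ Ω) :
    DifferentiableAt ℂ (mol ε v) y := by
  have hl := li_of_L2 hv
  refine hol_of_dzb ((mol_cd hε hl).differentiable (by simp) y) fun j => ?_
  rw [mol_dzb hε hl, hz _ ⟨kt_cd ε y, _, isCompact_closedBall y ε, hy, kt_zero hε y⟩, neg_zero]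

lemma weyl_loc {Ω : Set (Cn n)} {v : Cn n → ℂ} (hv : MemLp v 2)
    (hz : ∀ h, Tst Ω h → ∀ j, ∫ x, v x * dzb j h x = 0) {δ : ℝ} (hδ : 0 < δ) {x : Cn n} (hx : closedBall x (3 * δ) ⊆ Ω) :
    mol δ v =ᵐ[volume.restrict (ball x δ)] v := by
  have hl := li_of_L2 hv
  have hb : ∀ ε, 0 < ε → ε < δ → eLpNorm (mol δ v - v) 2 (volume.restrict (ball x δ)) ≤ 2 * eLpNorm (mol ε v - v) 2 volume := by
    intro ε hε hεδ
    have hc := (mol_cd hε hl).continuous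
    have hl2 : LocallyIntegrable (mol ε v) := hc.locallyIntegrable
    have e1 : (mol δ v - v) =ᵐ[volume.restrict (ball x δ)] (-(mol δ (mol ε v - v)) + (mol ε v - v)) := by
      refine (ae_restrict_iff' measurableSet_ball).2 (Filter.Eventually.of_forall fun y hy => ?_)
      have : mol δ (mol ε v) y = mol ε v y := by
        refine mvp (O := ball x (2 * δ)) (fun w hw => ?_) isOpen_ball hδ ?_
        · refine (mol_hol hv hz hε ?_).differentiableWithinAt
          refine Subset.trans (fun t ht => ?_) hx
          rw [mem_closedBall] at *; rw [mem_ball] at hw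
          have := dist_triangle t w x; linarith
        · intro t ht
          rw [mem_closedBall] at ht; rw [mem_ball] at *
          have := dist_triangle t y x; linarith
      simp only [mol_sub hδ hl2 hl, Pi.sub_apply, Pi.add_apply, Pi.neg_apply, this]; ring
    rw [eLpNorm_congr_ae e1]
    have hm : AEStronglyMeasurable (mol ε v - v) := hc.aestronglyMeasurable.sub hv.1
    have hm2 : AEStronglyMeasurable (mol δ (mol ε v - v)) := (mol_cd hδ (hl2.sub hl)).continuous.aestronglyMeasurable
    refine (eLpNorm_mono_measure _ Measure.restrict_le_self).trans ((eLpNorm_add_le hm2.neg hm (by norm_num)).trans ?_)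
    rw [eLpNorm_neg, two_mul]
    gcongr
    exact young hδ hm
  have h0 : eLpNorm (mol δ v - v) 2 (volume.restrict (ball x δ)) = 0 := by
    have t := ENNReal.Tendsto.const_mul (mol_L2 hv) (Or.inr ENNReal.ofNat_ne_top : (0:ℝ≥0∞) ≠ 0 ∨ (2:ℝ≥0∞) ≠ ⊤)
    rw [mul_zero] at t
    refine le_antisymm (ge_of_tendsto t ?_) bot_le
    filter_upwards [Ioo_mem_nhdsGT hδ] with ε hε using hb ε hε.1 hε.2
  rw [eLpNorm_eq_zero_iff (((mol_cd hδ hl).continuous.aestronglyMeasurable.sub hv.1).mono_measure Measure.restrict_le_self) (by norm_num)] at h0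
  filter_upwards [h0] with y hy
  simpa [sub_eq_zero] using hy

lemma weyl {Ω : Set (Cn n)} (hΩ : IsOpen Ω) {v : Cn n → ℂ} (hv : MemLp v 2)
    (hz : ∀ h, Tst Ω h → ∀ j, ∫ x, v x * dzb j h x = 0) :
    ∃ F : Cn n → ℂ, DifferentiableOn ℂ F Ω ∧ F =ᵐ[volume.restrict Ω] v := by
  have hl := li_of_L2 hv
  have hex : ∀ x ∈ Ω, ∃ r > 0, closedBall x (4 * r) ⊆ Ω := by
    intro x hx
    obtain ⟨r, hr, h⟩ := Metric.isOpen_iff.1 hΩ x hx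
    exact ⟨r / 5, by positivity, (closedBall_subset_ball (by linarith)).trans h⟩
  choose! r hr hrb using hex
  have key : ∀ y ∈ Ω, ∀ δ > 0, closedBall y (3 * δ) ⊆ Ω → mol (r y) v y = mol δ v y := by
    intro y hy δ hδ hb
    set s := min δ (r y)
    have hs : 0 < s := lt_min hδ (hr y hy)
    have a1 : mol δ v =ᵐ[volume.restrict (ball y s)] v := ae_restrict_of_ae_restrict_of_subset (ball_subset_ball (min_le_left δ (r y))) (weyl_loc hv hz hδ hb)
    have a2 : mol (r y) v =ᵐ[volume.restrict (ball y s)] v := ae_restrict_of_ae_restrict_of_subset (ball_subset_ball (min_le_right δ (r y))) (weyl_loc hv hz (hr y hy)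
      ((closedBall_subset_closedBall (by linarith [hr y hy])).trans (hrb y hy)))
    exact Measure.eqOn_open_of_ae_eq (a2.trans a1.symm) isOpen_ball (mol_cd (hr y hy) hl).continuous.continuousOn
      (mol_cd hδ hl).continuous.continuousOn (mem_ball_self hs)
  have key2 : ∀ x ∈ Ω, ∀ y ∈ ball x (r x), mol (r y) v y = mol (r x) v y := by
    intro x hx y hy
    have hb : closedBall y (3 * r x) ⊆ Ω := by
      refine Subset.trans (fun t ht => ?_) (hrb x hx)
      rw [mem_closedBall] at *; rw [mem_ball] at hy
      have := dist_triangle t y x; linarith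
    exact key y (hb (mem_closedBall_self (by linarith [hr x hx]))) _ (hr x hx) hb
  refine ⟨fun y => mol (r y) v y, fun x hx => ?_, ?_⟩
  · refine DifferentiableAt.differentiableWithinAt ?_
    refine (mol_hol hv hz (hr x hx) ((closedBall_subset_closedBall (by linarith [hr x hx])).trans (hrb x hx))).congr_of_eventuallyEq ?_
    filter_upwards [ball_mem_nhds x (hr x hx)] with y hy using key2 x hx y hy
  · rw [Filter.EventuallyEq, ae_restrict_iff' hΩ.measurableSet, ae_iff]
    refine measure_null_of_locally_null _ fun x hx => ?_
    have hx' : x ∈ Ω := by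
      by_contra h; exact hx (fun h' => absurd h' h)
    refine ⟨ball x (r x) ∩ {y | ¬ mol (r x) v y = v y}, ?_, ?_⟩
    · rw [mem_nhdsWithin]
      refine ⟨ball x (r x), isOpen_ball, mem_ball_self (hr x hx'), fun y hy => ⟨hy.1, fun h => hy.2 fun _ => ?_⟩⟩
      rw [key2 x hx' y hy.1]; exact h
    · have := weyl_loc hv hz (hr x hx') ((closedBall_subset_closedBall (by linarith [hr x hx'])).trans (hrb x hx'))
      rw [Filter.EventuallyEq, ae_restrict_iff' measurableSet_ball, ae_iff] at this
      convert this using 2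
      ext y; simp

end P15

section P16
open Filter (Tendsto atTop)
abbrev dimR (n : ℕ) : ℕ := Module.finrank ℝ (Cn n)

lemma kr_scale {δ : ℝ} (hδ : 0 < δ) : ∫ y : Cn n, kr δ y = δ^dimR n * ∫ y : Cn n, kr 1 y := by
  have : ∀ y : Cn n, kr δ y = kr 1 (δ⁻¹ • y) := by
    intro y
    simp only [kr, norm_smul, norm_inv, Real.norm_of_nonneg hδ.le]
    congr 2; field_simp
  simp_rw [this]
  rw [Measure.integral_comp_inv_smul, abs_of_pos (by positivity), smul_eq_mul]

def C0 (n : ℕ) : ℝ := (∫ y : Cn n, kr 1 y)⁻¹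
lemma C0_pos : 0 < C0 n := inv_pos.2 (kr_int_pos one_pos)

lemma cauchy0 {h : Cn n → ℂ} {O : Set (Cn n)} (hO : IsOpen O) (hh : DifferentiableOn ℂ h O) {x : Cn n} {δ : ℝ} (hδ : 0 < δ)
    (hb : closedBall x δ ⊆ O) {E : ℝ} (hE : 0 ≤ E) (hI : ∫⁻ t in O, ‖h t‖ₑ^2 ≤ ENNReal.ofReal E) :
    ‖h x‖^2 ≤ C0 n / δ^dimR n * E := by
  set g := O.indicator h with hg
  have hgm : AEMeasurable g := by
    rw [aemeasurable_indicator_iff hO.measurableSet]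
    exact hh.continuousOn.aemeasurable hO.measurableSet
  have e1 : h x = mol δ g x := by
    rw [← mvp hh hO hδ hb]
    exact mol_congr hδ fun t ht => (indicator_of_mem (hb (ball_subset_closedBall ht)) h).symm
  have e2 : ‖h x‖ₑ ≤ ∫⁻ t, ENNReal.ofReal (kap δ (x - t)) * ‖g t‖ₑ := by
    rw [e1, mol]
    refine (enorm_integral_le_lintegral_enorm _).trans (le_of_eq (lintegral_congr fun t => ?_))
    rw [enorm_smul, Real.enorm_of_nonneg (kap_nonneg hδ _)]
  have km : Measurable fun t : Cn n => ENNReal.ofReal (kap δ (x - t)) := (kap_meas δ).comp (measurable_const.sub measurable_id)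
  have ki : ∫⁻ t, ENNReal.ofReal (kap δ (x - t)) = 1 := by
    rw [lintegral_sub_left_eq_self (fun t => ENNReal.ofReal (kap δ t)) x, kap_lint hδ]
  have kb : ∀ t : Cn n, kap δ t ≤ C0 n / δ^dimR n := by
    intro t
    have h1 : kr δ t ≤ 1 := Real.smoothTransition.le_one _
    have := kr_int_pos (n := n) one_pos
    rw [kap, kr_scale hδ, C0, div_le_iff₀ (by positivity)]
    have e : (∫ y : Cn n, kr 1 y)⁻¹ / δ^dimR n * (δ^dimR n * ∫ y : Cn n, kr 1 y) = 1 := by field_simp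
    rw [e]; exact h1
  have e3 : ‖h x‖ₑ^2 ≤ ENNReal.ofReal (C0 n / δ^dimR n) * ENNReal.ofReal E := by
    calc ‖h x‖ₑ^2 ≤ (∫⁻ t, ENNReal.ofReal (kap δ (x - t)) * ‖g t‖ₑ)^2 := by gcongr
      _ ≤ (∫⁻ t, ENNReal.ofReal (kap δ (x - t))) * ∫⁻ t, ENNReal.ofReal (kap δ (x - t)) * ‖g t‖ₑ^2 := cs_lint km hgm.enorm
      _ = ∫⁻ t, ENNReal.ofReal (kap δ (x - t)) * ‖g t‖ₑ^2 := by rw [ki, one_mul]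
      _ ≤ ∫⁻ t, ENNReal.ofReal (C0 n / δ^dimR n) * O.indicator (fun t => ‖h t‖ₑ^2) t := by
        refine lintegral_mono fun t => ?_
        have : ‖g t‖ₑ^2 = O.indicator (fun t => ‖h t‖ₑ^2) t := by
          by_cases ht : t ∈ O <;> simp [hg, ht]
        rw [this]
        exact mul_le_mul_left (ENNReal.ofReal_le_ofReal (kb _)) _
      _ = ENNReal.ofReal (C0 n / δ^dimR n) * ∫⁻ t in O, ‖h t‖ₑ^2 := by
        rw [lintegral_const_mul' _ _ ENNReal.ofReal_ne_top, lintegral_indicator hO.measurableSet]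
      _ ≤ _ := by gcongr
  rw [← ENNReal.ofReal_mul (by have := C0_pos (n := n); positivity), ← ofReal_norm, ← ENNReal.ofReal_pow (norm_nonneg _)] at e3
  exact (ENNReal.ofReal_le_ofReal_iff (by have := C0_pos (n := n); positivity)).1 e3

lemma cauchy1 {h : Cn n → ℂ} {O : Set (Cn n)} (hO : IsOpen O) (hh : DifferentiableOn ℂ h O) {x : Cn n} {δ : ℝ} (hδ : 0 < δ)
    (hb : closedBall x (2 * δ) ⊆ O) {E : ℝ} (hE : 0 ≤ E) (hI : ∫⁻ t in O, ‖h t‖ₑ^2 ≤ ENNReal.ofReal E) (X : Cn n) :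
    ‖fderiv ℂ h x X‖^2 ≤ C0 n / δ^(dimR n + 2) * E * ‖X‖^2 := by
  rcases eq_or_ne X 0 with rfl | hX
  · simp
  have hXn : 0 < ‖X‖ := norm_pos_iff.2 hX
  set M := Real.sqrt (C0 n / δ^dimR n * E) with hM
  have hC := C0_pos (n := n)
  have hpt : ∀ y ∈ closedBall x δ, ‖h y‖ ≤ M := by
    intro y hy
    refine Real.le_sqrt_of_sq_le (cauchy0 hO hh hδ (Subset.trans (fun t ht => ?_) hb) hE hI)
    rw [mem_closedBall] at *
    have := dist_triangle t y x; linarith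
  set R := δ / ‖X‖ with hR
  have Rp : 0 < R := by positivity
  have hin : ∀ l : ℂ, ‖l‖ ≤ R → x + l • X ∈ closedBall x δ := by
    intro l hl
    rw [mem_closedBall, dist_eq_norm, add_sub_cancel_left, norm_smul]
    rwa [hR, le_div_iff₀ hXn] at hl
  have hsub : closedBall x δ ⊆ O := (closedBall_subset_closedBall (by linarith)).trans hb
  have hd : DifferentiableOn ℂ (fun l : ℂ => h (x + l • X)) (closedBall 0 R) :=
    hh.comp (by fun_prop) fun l hl => hsub (hin l (by simpa using hl))
  have h1 := Complex.norm_deriv_le_of_forall_mem_sphere_norm_le Rp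
    (DifferentiableOn.diffContOnCl (s := ball 0 R) (by rwa [closure_ball _ Rp.ne']))
    (C := M) (fun l hl => hpt _ (hin l (by simpa using (mem_sphere_zero_iff_norm.1 hl).le)))
  have h2 : deriv (fun l : ℂ => h (x + l • X)) 0 = fderiv ℂ h x X := by
    have hx : DifferentiableAt ℂ h (x + (0:ℂ) • X) := by
      rw [zero_smul, add_zero]; exact hh.differentiableAt (hO.mem_nhds (hsub (mem_closedBall_self hδ.le)))
    have h3 : HasDerivAt (fun l : ℂ => x + l • X) X 0 := by
      simpa using ((hasDerivAt_id (0:ℂ)).smul_const X).const_add x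
    have := (hx.hasFDerivAt.comp_hasDerivAt 0 h3).deriv
    rw [zero_smul, add_zero] at this
    exact this
  rw [h2] at h1
  calc ‖fderiv ℂ h x X‖^2 ≤ (M / R)^2 := by gcongr
    _ = _ := by
      rw [div_pow, hM, Real.sq_sqrt (by positivity), hR, pow_add]
      field_simp

end P16

section P17
open Filter (Tendsto atTop)
lemma lint_sq {f : Cn n → ℂ} (hf : MemLp f 2) : ∫⁻ x, ‖f x‖ₑ^2 = ENNReal.ofReal (∫ x, ‖f x‖^2) := by
  rw [ofReal_integral_eq_lintegral_ofReal (nsq_int hf) (Filter.Eventually.of_forall fun x => by positivity)]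
  refine lintegral_congr fun x => ?_
  rw [← ofReal_norm, ENNReal.ofReal_pow (norm_nonneg _)]

lemma memLp_lint {f : Cn n → ℂ} (hm : AEStronglyMeasurable f) (h : ∫⁻ x, ‖f x‖ₑ^2 < ⊤) : MemLp f 2 := by
  refine ⟨hm, ?_⟩
  rw [eLp2]
  exact ENNReal.rpow_lt_top_of_nonneg (by norm_num) h.ne

lemma extend {Ω : Set (Cn n)} (hΩ : IsPseudoconvex Ω) {p : Cn n} (hp : p ∉ Ω) {φ0 : Cn n → ℝ}
    (hφ0 : ContDiffOn ℝ 2 φ0 Ω) (hp0 : ∀ x ∈ Ω, 0 ≤ φ0 x) {B : ℝ} (hB : ∀ x ∈ Ω, φ0 x ≤ B)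
    {T : Set (Cn n)} (hT : MeasurableSet T) {c : ℝ} (hc : 0 < c)
    (hl : ∀ x ∈ Ω, ∀ X, T.indicator (fun _ => c) x * ‖X‖^2 ≤ leviForm φ0 x X)
    {χ : Cn n → ℝ} (hχ : ContDiff ℝ 2 χ) {O K : Set (Cn n)} (hO : IsOpen O) (hK : IsCompact K) (hKO : K ⊆ O)
    (hχ0 : ∀ x ∉ K, χ x = 0) (hχT : ∀ x ∉ T, ∀ j, dzb j (toC χ) x = 0) {M : ℝ} (hM : ∀ x j, ‖dzb j (toC χ) x‖ ≤ M)
    {F0 : Cn n → ℂ} (hF : DifferentiableOn ℂ F0 (Ω ∩ O)) (hF2 : ∫⁻ t in Ω ∩ O, ‖F0 t‖ₑ^2 < ⊤) {E : ℝ} (hE : 0 ≤ E)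
    (hFE : ∫⁻ t in Ω ∩ O ∩ T, ‖F0 t‖ₑ^2 ≤ ENNReal.ofReal E) :
    ∃ F : Cn n → ℂ, DifferentiableOn ℂ F Ω ∧
      ∫⁻ t in Ω, ‖χ t * (Ω ∩ O).indicator F0 t - F t‖ₑ^2 ≤ ENNReal.ofReal (2 * Real.exp (1 + B) / c * (n * (M^2 * E))) := by
  have hD : IsOpen (Ω ∩ O) := hΩ.1.inter hO
  set G := (Ω ∩ O).indicator F0 with hG
  have hGm : AEStronglyMeasurable G := by
    rw [hG, aestronglyMeasurable_indicator_iff hD.measurableSet]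
    exact hF.continuousOn.aestronglyMeasurable hD.measurableSet
  have hGe : ∀ t, ‖G t‖ₑ^2 = (Ω ∩ O).indicator (fun t => ‖F0 t‖ₑ^2) t := by
    intro t; by_cases ht : t ∈ Ω ∩ O
    · simp only [hG, indicator_of_mem ht]
    · simp only [hG, indicator_of_notMem ht]; simp
  have hG2 : MemLp G 2 := by
    refine memLp_lint hGm ?_
    simp_rw [hGe]
    rwa [lintegral_indicator hD.measurableSet]
  have hχC : ContDiff ℝ 2 (toC χ) := Complex.ofRealCLM.contDiff.comp hχ
  have hdχ : ∀ j, ContDiff ℝ 1 (dzb j (toC χ)) := fun j => dzb_contDiff j (two_of' hχC)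
  have hχC0 : ∀ x ∉ K, toC χ x = 0 := fun x hx => by simp [toC, hχ0 x hx]
  have hdχ0 : ∀ j, ∀ x ∉ K, dzb j (toC χ) x = 0 := fun j => dzb_zero_off j hK.isClosed hχC0
  have hα : ∀ j, MemLp (fun x => dzb j (toC χ) x * G x) 2 := fun j =>
    memLp_off_mul isOpen_univ (hdχ j).continuous.continuousOn hK (subset_univ _) (hdχ0 j) hG2
  have hχG : MemLp (fun x => toC χ x * G x) 2 :=
    memLp_off_mul isOpen_univ hχC.continuous.continuousOn hK (subset_univ _) hχC0 hG2
  have orth : ∀ (j : Fin n) (g : Cn n → ℂ) (L : Set (Cn n)), ContDiff ℝ 1 g → IsCompact L → L ⊆ Ω ∩ O → (∀ x ∉ L, g x = 0) →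
      ∫ x, G x * dzb j g x = 0 := by
    intro j g L hg hL hLO h0
    have h1 := ibp_dzb j hD ((hol_cd hF hD).of_le (by norm_num)) hg hL hLO h0
    have h2 : ∀ x, dzb j F0 x * g x = 0 := by
      intro x
      by_cases hx : x ∈ L
      · rw [dzb_hol (hF.differentiableAt (hD.mem_nhds (hLO hx))), zero_mul]
      · rw [h0 x hx, mul_zero]
    simp only [h2, integral_zero, neg_zero] at h1
    rw [← h1]
    refine integral_congr_ae (Filter.Eventually.of_forall fun x => ?_)
    simp only
    by_cases hx : x ∈ L
    · rw [hG, indicator_of_mem (hLO hx)]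
    · rw [dzb_zero_off j hL.isClosed h0 x hx, mul_zero, mul_zero]
  have iG : ∀ g : Cn n → ℂ, Continuous g → HasCompactSupport g → Integrable (fun x => G x * g x) := fun g h1 h2 => memLp_csmul h1 h2 hG2
  have hcl : ∀ h, Tst Ω h → ∀ j k, ∫ x, dzb j (toC χ) x * G x * dzb k h x = ∫ x, dzb k (toC χ) x * G x * dzb j h x := by
    rintro h ⟨h1, L, hL, hLΩ, h0⟩
    have key : ∀ j k, ∫ x, dzb j (toC χ) x * G x * dzb k h x = - ∫ x, G x * (toC χ x * dzb j (dzb k h) x) := by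
      intro j k
      have hdh : ContDiff ℝ 1 (dzb k h) := dzb_contDiff k (two_of' h1)
      have h0' := dzb_zero_off k hL.isClosed h0
      have h3 : ∀ x, dzb j (fun y => toC χ y * dzb k h y) x = dzb j (toC χ) x * dzb k h x + toC χ x * dzb j (dzb k h) x :=
        fun x => dzb_mul j (hχC.differentiable (by norm_num) x) (hdh.differentiable (by norm_num) x)
      have h2 := orth j (fun y => toC χ y * dzb k h y) (L ∩ K) ((hχC.of_le (by norm_num)).mul hdh) (hL.inter hK)
        (fun x hx => ⟨hLΩ hx.1, hKO hx.2⟩) (fun x hx => by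
          by_cases hx' : x ∈ L
          · rw [hχC0 x (fun h => hx ⟨hx', h⟩), zero_mul]
          · rw [h0' x hx', mul_zero])
      simp_rw [h3, mul_add] at h2
      have c2 : Continuous (dzb j (dzb k h)) := (dzb_contDiff (m := 0) j (by simpa using hdh)).continuous
      have hcsh : HasCompactSupport h := HasCompactSupport.intro hL h0
      rw [integral_add (iG (fun x => dzb j (toC χ) x * dzb k h x) ((hdχ j).continuous.mul hdh.continuous) ((dzb_cs k hcsh).mul_left))
        (iG (fun x => toC χ x * dzb j (dzb k h) x) (hχC.continuous.mul c2) ((dzb_cs j (dzb_cs k hcsh)).mul_left))] at h2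
      rw [← eq_neg_iff_add_eq_zero] at h2
      rw [← h2]
      congr 1; ext x; ring
    intro j k
    rw [key, key]
    congr 2; ext x
    rw [dzb_dzb_comm h1.contDiffAt]
  set Q := ∑ j, ∫ x, ‖dzb j (toC χ) x * G x‖^2 with hQ
  have hQE : Q ≤ n * (M^2 * E) := by
    have : ∀ j, ∫ x, ‖dzb j (toC χ) x * G x‖^2 ≤ M^2 * E := by
      intro j
      rw [← ENNReal.ofReal_le_ofReal_iff (by positivity), ← lint_sq (hα j)]
      calc ∫⁻ x, ‖dzb j (toC χ) x * G x‖ₑ^2 ≤ ∫⁻ x, ENNReal.ofReal (M^2) * (Ω ∩ O ∩ T).indicator (fun t => ‖F0 t‖ₑ^2) x := by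
            refine lintegral_mono fun x => ?_
            by_cases hx : x ∈ T
            · rw [enorm_mul, mul_pow, hGe]
              have e : (Ω ∩ O ∩ T).indicator (fun t => ‖F0 t‖ₑ^2) x = (Ω ∩ O).indicator (fun t => ‖F0 t‖ₑ^2) x := by
                by_cases hx' : x ∈ Ω ∩ O
                · rw [indicator_of_mem hx', indicator_of_mem (show x ∈ Ω ∩ O ∩ T from ⟨hx', hx⟩)]
                · rw [indicator_of_notMem hx', indicator_of_notMem (show x ∉ Ω ∩ O ∩ T from fun h => hx' h.1)]
              rw [e]
              refine mul_le_mul_left ?_ _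
              rw [← ofReal_norm, ← ENNReal.ofReal_pow (norm_nonneg _)]
              exact ENNReal.ofReal_le_ofReal (pow_le_pow_left₀ (norm_nonneg _) (hM x j) 2)
            · simp only [hχT x hx j, zero_mul]; simp
        _ = ENNReal.ofReal (M^2) * ∫⁻ t in Ω ∩ O ∩ T, ‖F0 t‖ₑ^2 := by
            rw [lintegral_const_mul' _ _ ENNReal.ofReal_ne_top, lintegral_indicator (hD.measurableSet.inter hT)]
        _ ≤ _ := by rw [ENNReal.ofReal_mul (by positivity)]; gcongr
    calc Q ≤ ∑ j : Fin n, M^2 * E := Finset.sum_le_sum fun j _ => this j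
      _ = _ := by simp
  have hQ0 : 0 ≤ Q := Finset.sum_nonneg fun j _ => integral_nonneg fun x => by positivity
  obtain ⟨u, hu, huQ, huw⟩ := dbar_solve hα (C := 2 * Real.exp (1 + B) / c * Q) (by positivity) (fun g hg =>
    core' hΩ hp hφ0 hp0 hB hT hc hl hα (fun j x hx => by simp [hχT x hx j]) hcl hg)
  obtain ⟨F, hFd, hFe⟩ := weyl hΩ.1 (v := fun x => toC χ x * G x - u x) (hχG.sub hu) (by
    intro h hh j
    have hh' := hh
    obtain ⟨h1, L, hL, hLΩ, h0⟩ := hh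
    have h3 : ∀ x, dzb j (fun y => toC χ y * h y) x = dzb j (toC χ) x * h x + toC χ x * dzb j h x :=
      fun x => dzb_mul j (hχC.differentiable (by norm_num) x) (h1.differentiable (by norm_num) x)
    have h2 := orth j (fun y => toC χ y * h y) (L ∩ K) ((hχC.mul h1).of_le (by norm_num)) (hL.inter hK)
      (fun x hx => ⟨hLΩ hx.1, hKO hx.2⟩) (fun x hx => by
        by_cases hx' : x ∈ L
        · rw [hχC0 x (fun h => hx ⟨hx', h⟩), zero_mul]
        · rw [h0 x hx', mul_zero])
    simp_rw [h3, mul_add] at h2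
    have hcsh : HasCompactSupport h := HasCompactSupport.intro hL h0
    have cd : Continuous (dzb j h) := (dzb_contDiff j (two_of' h1)).continuous
    rw [integral_add (iG (fun x => dzb j (toC χ) x * h x) ((hdχ j).continuous.mul h1.continuous) (hcsh.mul_left))
        (iG (fun x => toC χ x * dzb j h x) (hχC.continuous.mul cd) ((dzb_cs j hcsh).mul_left))] at h2
    simp_rw [sub_mul]
    rw [integral_sub (memLp_csmul cd (dzb_cs j hcsh) hχG) (memLp_csmul cd (dzb_cs j hcsh) hu), huw h hh' j, sub_neg_eq_add, ← h2, add_comm]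
    congr 1 <;> congr 1 <;> ext x <;> ring)
  refine ⟨F, hFd, ?_⟩
  calc ∫⁻ t in Ω, ‖χ t * G t - F t‖ₑ^2 = ∫⁻ t in Ω, ‖u t‖ₑ^2 := by
        refine lintegral_congr_ae ?_
        filter_upwards [hFe] with t ht
        rw [ht]; simp [toC]
    _ ≤ ∫⁻ t, ‖u t‖ₑ^2 := setLIntegral_le_lintegral _ _
    _ ≤ _ := by
      rw [lint_sq hu]
      refine ENNReal.ofReal_le_ofReal (huQ.trans ?_)
      exact mul_le_mul_of_nonneg_left hQE (by positivity)

end P17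

section P18
open Filter (Tendsto atTop)
def beta (B : Cn n →L[ℝ] Cn n →L[ℝ] ℝ) (X Y : Cn n) : ℂ :=
  ((B X Y : ℂ) - (B (I • X) (I • Y) : ℂ) - I * ((B (I • X) Y : ℂ) + (B X (I • Y) : ℂ))) / 4

lemma beta_smul_left (B : Cn n →L[ℝ] Cn n →L[ℝ] ℝ) (c : ℂ) (X Y : Cn n) :
    beta B (c • X) Y = c * beta B X Y := by
  obtain ⟨s, t⟩ := c
  have h3 : (⟨s, t⟩ : ℂ) = s + t * I := by apply Complex.ext <;> simp
  simp only [beta, csmul2]; simp only [csmul1]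
  rw [h3]
  simp only [map_add, map_sub, map_smul, smul_eq_mul, add_apply, sub_apply, smul_apply]
  push_cast
  linear_combination ((t:ℂ)/4 * ((B (I • X) Y : ℂ) + (B X (I • Y) : ℂ))) * Complex.I_mul_I

lemma beta_smul_right (B : Cn n →L[ℝ] Cn n →L[ℝ] ℝ) (c : ℂ) (X Y : Cn n) :
    beta B X (c • Y) = c * beta B X Y := by
  obtain ⟨s, t⟩ := c
  have h3 : (⟨s, t⟩ : ℂ) = s + t * I := by apply Complex.ext <;> simp
  simp only [beta, csmul2]; simp only [csmul1]
  rw [h3]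
  simp only [map_add, map_sub, map_smul, smul_eq_mul, add_apply, sub_apply, smul_apply]
  push_cast
  linear_combination ((t:ℂ)/4 * ((B (I • X) Y : ℂ) + (B X (I • Y) : ℂ))) * Complex.I_mul_I

lemma levi_poly (ℓ : Cn n →L[ℝ] ℝ) (B : Cn n →L[ℝ] Cn n →L[ℝ] ℝ) (q : Cn n) : ∃ P : Cn n → ℂ, Differentiable ℂ P ∧
    ∀ ζ, (P ζ).re = ℓ (ζ - q) + (B (ζ - q) (ζ - q) - B (I • (ζ - q)) (I • (ζ - q))) / 4 := by
  let L1 : Cn n →ₗ[ℂ] ℂ :=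
    { toFun := fun X => (ℓ X : ℂ) - I * ℓ (I • X)
      map_add' := fun a b => by simp only [smul_add, map_add]; push_cast; ring
      map_smul' := fun c X => by
        obtain ⟨s, t⟩ := c
        have h3 : (⟨s, t⟩ : ℂ) = s + t * I := by apply Complex.ext <;> simp
        simp only [csmul2]; simp only [csmul1, RingHom.id_apply, smul_eq_mul]
        rw [h3]
        simp only [map_add, map_sub, map_smul, smul_eq_mul]
        push_cast
        linear_combination ((t:ℂ) * (ℓ (I • X) : ℂ)) * Complex.I_mul_I }
  let L2 (Y : Cn n) : Cn n →ₗ[ℂ] ℂ :=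
    { toFun := fun X => beta B X Y
      map_add' := fun a b => by simp only [beta, smul_add, map_add, add_apply]; push_cast; ring
      map_smul' := fun c a => beta_smul_left B c a Y }
  let L3 (X : Cn n) : Cn n →ₗ[ℂ] ℂ :=
    { toFun := fun Y => beta B X Y
      map_add' := fun a b => by simp only [beta, smul_add, map_add]; push_cast; ring
      map_smul' := fun c a => beta_smul_right B c X a }
  have hd : ∀ L : Cn n →ₗ[ℂ] ℂ, Differentiable ℂ (fun ζ => L (ζ - q)) := by
    intro L
    exact (LinearMap.toContinuousLinearMap L).differentiable.comp (differentiable_id.sub_const q)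
  have hs : ∀ X, beta B X X = ∑ k, X k * L2 (ee k) X := by
    intro X
    change L3 X X = _
    conv_lhs => rw [sum_ee X]
    rw [map_sum, ← sum_ee X]
    refine Finset.sum_congr rfl fun k _ => ?_
    rw [map_smul, smul_eq_mul]
    rfl
  refine ⟨fun ζ => L1 (ζ - q) + ∑ k, (ζ - q) k * L2 (ee k) (ζ - q), ?_, fun ζ => ?_⟩
  · have hk : ∀ k, Differentiable ℂ (fun ζ : Cn n => (ζ - q) k) := fun k =>
      (EuclideanSpace.proj k : Cn n →L[ℂ] ℂ).differentiable.comp (differentiable_id.sub_const q)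
    exact (hd L1).add (Differentiable.fun_sum fun k _ => (hk k).mul (hd (L2 (ee k))))
  · simp only [← hs]
    simp [L1, beta]

lemma levi_B {r : Cn n → ℝ} {x : Cn n} (h : ContDiffAt ℝ 2 r x) (X : Cn n) :
    leviForm r x X = (fderiv ℝ (fderiv ℝ r) x X X + fderiv ℝ (fderiv ℝ r) x (I • X) (I • X)) / 4 := by
  rw [leviForm, fderiv_fderiv_app h, fderiv_fderiv_app h]

lemma bil_bd (B : Cn n →L[ℝ] Cn n →L[ℝ] ℝ) (X : Cn n) : |B X X| ≤ ‖B‖ * ‖X‖^2 := by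
  have := B.le_opNorm₂ X X
  rw [Real.norm_eq_abs] at this
  linarith [this, (by ring : ‖B‖ * ‖X‖ * ‖X‖ = ‖B‖ * ‖X‖^2)]

lemma nI (X : Cn n) : ‖I • X‖ = ‖X‖ := by rw [norm_smul, Complex.norm_I, one_mul]

lemma levi_near {r : Cn n → ℝ} {x y : Cn n} (hx : ContDiffAt ℝ 2 r x) (hy : ContDiffAt ℝ 2 r y) {ε : ℝ}
    (h : ‖fderiv ℝ (fderiv ℝ r) x - fderiv ℝ (fderiv ℝ r) y‖ ≤ ε) (X : Cn n) :
    leviForm r y X - ε * ‖X‖^2 ≤ leviForm r x X := by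
  rw [levi_B hx, levi_B hy]
  set B := fderiv ℝ (fderiv ℝ r) x - fderiv ℝ (fderiv ℝ r) y with hB
  have h1 := (abs_le.1 (bil_bd B X)).1
  have h2 := (abs_le.1 (bil_bd B (I • X))).1
  rw [nI] at h2
  have h3 := mul_le_mul_of_nonneg_right h (sq_nonneg ‖X‖)
  have h4 : 0 ≤ ‖B‖ * ‖X‖^2 := by positivity
  have a1 : B X X = fderiv ℝ (fderiv ℝ r) x X X - fderiv ℝ (fderiv ℝ r) y X X := rfl
  have a2 : B (I • X) (I • X) = fderiv ℝ (fderiv ℝ r) x (I • X) (I • X) - fderiv ℝ (fderiv ℝ r) y (I • X) (I • X) := rfl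
  linarith

lemma strict_levi {ρ : Cn n → ℝ} {p : Cn n} (h : ContDiffAt ℝ 2 ρ p)
    (hL : ∀ X : Cn n, X ≠ 0 → cderiv ρ p X = 0 → 0 < leviForm ρ p X) :
    ∃ A > 0, ∃ c > 0, ∀ X : Cn n, c * ‖X‖^2 ≤ leviForm ρ p X + A * ‖cderiv ρ p X‖^2 := by
  set B := fderiv ℝ (fderiv ℝ ρ) p
  have cB : Continuous fun X : Cn n => B X X := by fun_prop
  have cf : Continuous (leviForm ρ p) := by
    have : leviForm ρ p = fun X => (B X X + B (I • X) (I • X)) / 4 := funext (levi_B h)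
    rw [this]
    exact (cB.add (cB.comp (continuous_const_smul I))).div_const _
  have cg : Continuous (fun X => ‖cderiv ρ p X‖^2) := by
    have : Continuous (cderiv ρ p) := by unfold cderiv; fun_prop
    fun_prop
  have hsc : IsCompact (sphere (0 : Cn n) 1) := isCompact_sphere _ _
  have key : ∃ A > 0, ∃ c > 0, ∀ X ∈ sphere (0 : Cn n) 1, c ≤ leviForm ρ p X + A * ‖cderiv ρ p X‖^2 := by
    obtain ⟨A, hA, hpos⟩ : ∃ A > 0, ∀ X ∈ sphere (0 : Cn n) 1, 0 < leviForm ρ p X + A * ‖cderiv ρ p X‖^2 := by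
      set S := sphere (0 : Cn n) 1 ∩ {X | leviForm ρ p X ≤ 0}
      have hS : IsCompact S := hsc.inter_right (isClosed_le cf continuous_const)
      rcases S.eq_empty_or_nonempty with h0 | h0
      · refine ⟨1, one_pos, fun X hX => ?_⟩
        have : 0 < leviForm ρ p X := by
          by_contra hh; push Not at hh
          have : X ∈ S := ⟨hX, hh⟩
          rw [h0] at this; exact this
        positivity
      · obtain ⟨X1, hX1, h1⟩ := hS.exists_isMinOn h0 cg.continuousOn
        obtain ⟨X2, hX2, h2⟩ := hS.exists_isMinOn h0 cf.continuousOn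
        set m := ‖cderiv ρ p X1‖^2
        have mp : 0 < m := by
          have : cderiv ρ p X1 ≠ 0 := fun h0 => by
            have hne : X1 ≠ 0 := by rintro rfl; simpa using hX1.1
            have := hL X1 hne h0
            have h3 : leviForm ρ p X1 ≤ 0 := hX1.2
            linarith
          positivity
        set l := leviForm ρ p X2
        refine ⟨(|l| + 1) / m, by positivity, fun X hX => ?_⟩
        by_cases hh : leviForm ρ p X ≤ 0
        · have a1 : m ≤ ‖cderiv ρ p X‖^2 := h1 ⟨hX, hh⟩
          have a2 : l ≤ leviForm ρ p X := h2 ⟨hX, hh⟩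
          have : |l| + 1 ≤ (|l| + 1) / m * ‖cderiv ρ p X‖^2 := by
            calc |l| + 1 = (|l| + 1) / m * m := by field_simp
              _ ≤ _ := mul_le_mul_of_nonneg_left a1 (by positivity)
          linarith [neg_abs_le l]
        · push Not at hh; positivity
    rcases (sphere (0 : Cn n) 1).eq_empty_or_nonempty with h0 | h0
    · exact ⟨A, hA, 1, one_pos, fun X hX => by rw [h0] at hX; exact absurd hX (notMem_empty _)⟩
    · obtain ⟨X, hX, hm⟩ := hsc.exists_isMinOn h0 (cf.add (cg.const_mul A)).continuousOn
      exact ⟨A, hA, _, hpos X hX, fun Y hY => hm hY⟩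
  obtain ⟨A, hA, c, hc, hk⟩ := key
  refine ⟨A, hA, c, hc, fun X => ?_⟩
  rcases eq_or_ne X 0 with rfl | hX
  · rw [levi_B h]; simp; positivity
  have hXn : 0 < ‖X‖ := norm_pos_iff.2 hX
  have h1 := hk (‖X‖⁻¹ • X) (by simp [norm_smul, hXn.ne'])
  have e1 : leviForm ρ p (‖X‖⁻¹ • X) = (‖X‖⁻¹)^2 * leviForm ρ p X := by
    rw [levi_B h, levi_B h, smul_comm I (‖X‖⁻¹) X]
    simp only [map_smul, smul_apply, smul_eq_mul]; ring
  have e2 : cderiv ρ p (‖X‖⁻¹ • X) = ‖X‖⁻¹ * cderiv ρ p X := by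
    simp only [cderiv, smul_comm I (‖X‖⁻¹) X, map_smul, smul_eq_mul]; push_cast; ring
  rw [e1, e2, norm_mul, mul_pow] at h1
  have e3 : ‖((‖X‖⁻¹ : ℝ) : ℂ)‖ = ‖X‖⁻¹ := by simp
  rw [e3] at h1
  calc c * ‖X‖^2 ≤ ((‖X‖⁻¹)^2 * leviForm ρ p X + A * ((‖X‖⁻¹)^2 * ‖cderiv ρ p X‖^2)) * ‖X‖^2 := by
        exact mul_le_mul_of_nonneg_right h1 (by positivity)
    _ = _ := by field_simp

end P18

section P19
open Filter (Tendsto atTop)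

lemma nd3 {G : Type*} [NormedAddCommGroup G] {a b d : G} {e e1 : ℝ} (h : ‖a - b‖ ≤ e) (h1 : ‖d - b‖ ≤ e1) :
    ‖a - d‖ ≤ e + e1 := by
  rw [norm_sub_rev d b] at h1
  linarith [norm_sub_le_norm_sub_add_norm_sub a b d]

lemma local_def {Ω : Set (Cn n)} {p : Cn n} (hO : IsOpen Ω) (hp : IsStrictPscPtC2 Ω p) :
    ∃ (r : Cn n → ℝ) (R c L : ℝ), 0 < R ∧ 0 < c ∧ 0 < L ∧ ContDiffOn ℝ 2 r (ball p R) ∧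
      (∀ x ∈ ball p R, ∀ X, c * ‖X‖^2 ≤ leviForm r x X) ∧ (∀ x ∈ Ω ∩ ball p R, r x < 0) ∧ r p = 0 ∧
      ∀ q ∈ frontier Ω ∩ ball p R, ∃ P : Cn n → ℂ, Differentiable ℂ P ∧ ∀ ζ ∈ ball p R,
        (ζ ∈ Ω → (P ζ).re ≤ -(c / 2) * ‖ζ - q‖^2) ∧ -L * ‖ζ - q‖ ≤ (P ζ).re := by
  obtain ⟨hpf, W, hW, hpW, ρ, hρ, hΩ, -, hL⟩ := hp
  have hz : ∀ q ∈ frontier Ω ∩ W, ρ q = 0 := by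
    rintro q ⟨hq, hqW⟩
    have hc : ContinuousAt ρ q := hρ.continuousOn.continuousAt (hW.mem_nhds hqW)
    apply le_antisymm
    · by_contra hh; push Not at hh
      have h1 : ∀ᶠ y in nhds q, 0 < ρ y ∧ y ∈ W := (hc.eventually (lt_mem_nhds hh)).and (hW.mem_nhds hqW)
      obtain ⟨y, hy, hyΩ⟩ := mem_closure_iff_nhds.1 (frontier_subset_closure hq) _ h1
      have : y ∈ {z ∈ W | ρ z < 0} := hΩ ▸ ⟨hyΩ, hy.2⟩
      linarith [this.2, hy.1]
    · by_contra hh; push Not at hh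
      have : q ∈ Ω ∩ W := by rw [hΩ]; exact ⟨hqW, hh⟩
      rw [hO.frontier_eq] at hq
      exact hq.2 this.1
  have hρp : ContDiffAt ℝ 2 ρ p := hρ.contDiffAt (hW.mem_nhds hpW)
  obtain ⟨A, hA, c, hc, hAc⟩ := strict_levi hρp (hL p ⟨hpf, hpW⟩)
  set Q : ℝ → ℝ := fun t => t + A / 2 * t^2 with hQ
  have hQc : ContDiff ℝ 2 Q := by rw [hQ]; fun_prop
  have hQ1 : ∀ t, HasDerivAt Q (1 + A * t) t := fun t => by
    refine ((hasDerivAt_id t).add ((hasDerivAt_pow 2 t).const_mul (A/2))).congr_deriv ?_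
    push_cast; ring
  have hQ2 : ∀ t, HasDerivAt (fun t => 1 + A * t) ((fun _ => A) t) t := fun t => by
    simpa using ((hasDerivAt_id t).const_mul A).const_add 1
  set r : Cn n → ℝ := fun x => Q (ρ x) with hr
  have hrC : ContDiffOn ℝ 2 r W := hQc.comp_contDiffOn hρ
  have hrA : ∀ x ∈ W, ContDiffAt ℝ 2 r x := fun x hx => hrC.contDiffAt (hW.mem_nhds hx)
  have hlp : ∀ X, c * ‖X‖^2 ≤ leviForm r p X := fun X => by
    have := levi_chain hQ1 hQ2 hρp X
    rw [hr, this, hz p ⟨hpf, hpW⟩]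
    linarith [hAc X]
  have c1 : ContDiffAt ℝ 1 (fderiv ℝ r) p := (hrA p hpW).fderiv_right (by norm_num)
  have c2 : ContDiffAt ℝ 0 (fderiv ℝ (fderiv ℝ r)) p := c1.fderiv_right (by norm_num)
  obtain ⟨R1, hR1, h1⟩ := cont_nd (G := Cn n →L[ℝ] Cn n →L[ℝ] ℝ) c2.continuousAt (ε := c / 8) (by positivity)
  obtain ⟨R2, hR2, h2⟩ := cont_nd (G := Cn n →L[ℝ] ℝ) c1.continuousAt (ε := 1) one_pos
  obtain ⟨R3, hR3, h3⟩ := cont_nd (G := ℝ) hρp.continuousAt (ε := 1 / A) (by positivity)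
  obtain ⟨R4, hR4, h4⟩ := Metric.isOpen_iff.1 hW p hpW
  set R := min (min (min R1 R2) (min R3 R4)) 1 with hRd
  have hR : 0 < R := by positivity
  have g1 : R ≤ R1 := (min_le_left _ _).trans ((min_le_left _ _).trans (min_le_left _ _))
  have g2 : R ≤ R2 := (min_le_left _ _).trans ((min_le_left _ _).trans (min_le_right _ _))
  have g3 : R ≤ R3 := (min_le_left _ _).trans ((min_le_right _ _).trans (min_le_left _ _))
  have g4 : R ≤ R4 := (min_le_left _ _).trans ((min_le_right _ _).trans (min_le_right _ _))
  have g5 : R ≤ 1 := min_le_right _ _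
  have hbW : ball p R ⊆ W := (ball_subset_ball g4).trans h4
  have hb1 : ∀ x ∈ ball p R, ‖fderiv ℝ (fderiv ℝ r) x - fderiv ℝ (fderiv ℝ r) p‖ ≤ c / 8 :=
    fun x hx => (h1 x ((mem_ball.1 hx).trans_le g1)).le
  have hlev : ∀ x ∈ ball p R, ∀ X, c / 2 * ‖X‖^2 ≤ leviForm r x X := fun x hx X => by
    have := levi_near (hrA x (hbW hx)) (hrA p hpW) (hb1 x hx) X
    nlinarith [hlp X, sq_nonneg ‖X‖]
  have hneg : ∀ x ∈ Ω ∩ ball p R, r x < 0 := fun x hx => by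
    have a1 : x ∈ {z ∈ W | ρ z < 0} := hΩ ▸ ⟨hx.1, hbW hx.2⟩
    have a2 := h3 x ((mem_ball.1 hx.2).trans_le g3)
    rw [hz p ⟨hpf, hpW⟩, sub_zero, Real.norm_eq_abs, lt_div_iff₀ hA] at a2
    have a3 := neg_abs_le (ρ x)
    have a4 := a1.2
    have : r x = ρ x * (1 + A / 2 * ρ x) := by simp only [hr, hQ]; ring
    rw [this]
    exact mul_neg_of_neg_of_pos a4 (by nlinarith)
  set L : ℝ := ‖fderiv ℝ r p‖ + 1 + (‖fderiv ℝ (fderiv ℝ r) p‖ + c) with hLd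
  have n1 : 0 ≤ ‖fderiv ℝ r p‖ := by positivity
  have n2 : 0 ≤ ‖fderiv ℝ (fderiv ℝ r) p‖ := by positivity
  refine ⟨r, R, c / 2, L, hR, by positivity, by positivity, hrC.mono hbW, hlev, hneg, ?_, ?_⟩
  · simp [hr, hQ, hz p ⟨hpf, hpW⟩]
  rintro q ⟨hqf, hqb⟩
  obtain ⟨P, hP, hPe⟩ := levi_poly (fderiv ℝ r q) (fderiv ℝ (fderiv ℝ r) q) q
  refine ⟨P, hP, fun ζ hζ => ?_⟩
  set B := fderiv ℝ (fderiv ℝ r) q with hB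
  have hrq : r q = 0 := by simp [hr, hQ, hz q ⟨hqf, hbW hqb⟩]
  constructor
  · intro hζΩ
    have t := taylor2 (ε := c / 4) isOpen_ball (convex_ball p R) (hrC.mono hbW) hqb (fun y hy => by
      have := nd3 (G := Cn n →L[ℝ] Cn n →L[ℝ] ℝ) (hb1 y hy) (hb1 q hqb)
      have e : c / 8 + c / 8 = c / 4 := by ring
      rwa [e] at this) hζ
    have t1 := (abs_le.1 t).1
    have l1 := hlev q hqb (ζ - q)
    rw [levi_B (hrA q (hbW hqb))] at l1
    rw [hPe]
    have := hneg ζ ⟨hζΩ, hζ⟩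
    linarith
  · rw [hPe]
    have e1 := (fderiv ℝ r q).le_opNorm (ζ - q)
    rw [Real.norm_eq_abs] at e1
    have e2 := bil_bd B (ζ - q)
    have e3 := bil_bd B (I • (ζ - q))
    rw [nI] at e3
    have e4 : ‖fderiv ℝ r q‖ ≤ ‖fderiv ℝ r p‖ + 1 := by
      have := (h2 q ((mem_ball.1 hqb).trans_le g2)).le
      linarith [norm_le_norm_add_norm_sub (fderiv ℝ r p) (fderiv ℝ r q), norm_sub_rev (fderiv ℝ r p) (fderiv ℝ r q)]
    have e5 : ‖B‖ ≤ ‖fderiv ℝ (fderiv ℝ r) p‖ + c := by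
      have := hb1 q hqb
      linarith [norm_le_norm_add_norm_sub (fderiv ℝ (fderiv ℝ r) p) (fderiv ℝ (fderiv ℝ r) q), norm_sub_rev (fderiv ℝ (fderiv ℝ r) p) (fderiv ℝ (fderiv ℝ r) q)]
    set w := ‖ζ - q‖ with hw
    have hw0 : 0 ≤ w := norm_nonneg _
    have hw2 : w ≤ 2 := by
      rw [hw, ← dist_eq_norm]
      have a := dist_triangle_right ζ q p
      linarith [mem_ball.1 hζ, mem_ball.1 hqb]
    have e6 : ‖B‖ * w^2 ≤ ‖B‖ * (2 * w) := by
      have : 0 ≤ ‖B‖ := by positivity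
      exact mul_le_mul_of_nonneg_left (by nlinarith) this
    have e7 := mul_le_mul_of_nonneg_right e4 hw0
    have e8 := mul_le_mul_of_nonneg_right e5 hw0
    have f1 := (abs_le.1 e1).1
    have f2 := (abs_le.1 e2).1
    have f3 := (abs_le.1 e3).2
    rw [hLd]
    linarith

end P19

section P20
open Filter (Tendsto atTop)

lemma levi_cg {a b : Cn n → ℝ} {x : Cn n} (h : a =ᶠ[nhds x] b) (X : Cn n) : leviForm a x X = leviForm b x X := by
  have h1 : ∀ Y : Cn n, (fun w => fderiv ℝ a w Y) =ᶠ[nhds x] (fun w => fderiv ℝ b w Y) := fun Y =>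
    (h.fderiv (𝕜 := ℝ)).mono fun w hw => by simp only [hw]
  rw [leviForm, leviForm, (h1 X).fderiv_eq, (h1 (I • X)).fderiv_eq]

lemma weight {Ω : Set (Cn n)} {p : Cn n} (hO : IsOpen Ω) {r : Cn n → ℝ} {R c : ℝ} (hR : 0 < R) (hc : 0 < c)
    (hr : ContDiffOn ℝ 2 r (ball p R)) (hl : ∀ x ∈ ball p R, ∀ X, c * ‖X‖^2 ≤ leviForm r x X)
    (hneg : ∀ x ∈ Ω ∩ ball p R, r x < 0) (hr0 : r p = 0) :
    ∃ (φ0 : Cn n → ℝ) (B s c1 : ℝ), 0 < s ∧ 0 < c1 ∧ ContDiffOn ℝ 2 φ0 Ω ∧ (∀ x ∈ Ω, 0 ≤ φ0 x) ∧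
      (∀ x ∈ Ω, φ0 x ≤ B) ∧ ∀ T ⊆ ball p s, ∀ x ∈ Ω, ∀ X, T.indicator (fun _ => c1) x * ‖X‖^2 ≤ leviForm φ0 x X := by
  set e : ℝ := c / 2 * (R / 2)^2 with he
  have e0 : 0 < e := by positivity
  set ψ : Cn n → ℝ := fun x => r x + (-(c / 2) * ‖x - p‖^2 + e) with hψ
  classical
  set φ0 : Cn n → ℝ := fun x => if x ∈ ball p R then pc (ψ x) else 0 with hφ
  have hψc : ContDiffOn ℝ 2 ψ (ball p R) :=
    hr.add ((contDiff_const.mul (nsq_cd p)).add contDiff_const).contDiffOn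
  have hψa : ∀ x ∈ ball p R, ContDiffAt ℝ 2 ψ x := fun x hx => hψc.contDiffAt (isOpen_ball.mem_nhds hx)
  have hloc : ∀ x ∈ ball p R, φ0 =ᶠ[nhds x] fun y => pc (ψ y) := fun x hx => by
    filter_upwards [isOpen_ball.mem_nhds hx] with y hy
    simp only [hφ, if_pos hy]
  have hout : ∀ x ∈ Ω, x ∉ ball p R → φ0 =ᶠ[nhds x] fun _ => 0 := fun x hx hxb => by
    have h1 : IsOpen {y : Cn n | R / 2 < dist y p} := isOpen_lt continuous_const (by fun_prop)
    have h2 : x ∈ {y : Cn n | R / 2 < dist y p} := by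
      rw [mem_ball] at hxb; change R / 2 < dist x p; linarith
    filter_upwards [h1.mem_nhds h2, hO.mem_nhds hx] with y hy hyΩ
    have hy' : R / 2 < ‖y - p‖ := by rw [← dist_eq_norm]; exact hy
    by_cases hb : y ∈ ball p R
    · simp only [hφ, if_pos hb]
      apply pc_neg
      have := hneg y ⟨hyΩ, hb⟩
      have : (R / 2)^2 ≤ ‖y - p‖^2 := by gcongr
      simp only [hψ, he]; nlinarith
    · simp only [hφ, if_neg hb]
  have hlψ : ∀ x ∈ ball p R, ∀ X, c / 2 * ‖X‖^2 ≤ leviForm ψ x X := fun x hx X => by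
    have h1 : ∀ t, HasDerivAt (fun t : ℝ => -(c / 2) * t + e) ((fun _ => -(c / 2)) t) t := fun t => by
      simpa using ((hasDerivAt_id t).const_mul (-(c / 2))).add_const e
    have h2 : ∀ t : ℝ, HasDerivAt (fun _ : ℝ => -(c / 2)) ((fun _ => (0:ℝ)) t) t := fun t => hasDerivAt_const _ _
    have h3 := levi_chain h1 h2 (nsq_cd p).contDiffAt (x := x) X
    have h4 := levi_add (hr.contDiffAt (isOpen_ball.mem_nhds hx))
      (((contDiff_const.mul (nsq_cd p)).add contDiff_const).contDiffAt : ContDiffAt ℝ 2 (fun y : Cn n => -(c / 2) * ‖y - p‖^2 + e) x) X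
    rw [levi_nsq] at h3
    rw [hψ, h4, h3]
    linarith [hl x hx X]
  have hlφ : ∀ x ∈ ball p R, ∀ X, 3 * (max (ψ x) 0)^2 * (c / 2 * ‖X‖^2) ≤ leviForm φ0 x X := fun x hx X => by
    rw [levi_cg (hloc x hx), levi_chain pc_d pc_dd (hψa x hx)]
    have a1 := mul_le_mul_of_nonneg_left (hlψ x hx X) (by positivity : 0 ≤ 3 * (max (ψ x) 0)^2)
    have a2 : 0 ≤ 6 * max (ψ x) 0 * ‖cderiv ψ x X‖^2 := by positivity
    linarith
  have hrc : ContinuousAt r p := (hr.contDiffAt (isOpen_ball.mem_nhds (mem_ball_self hR))).continuousAt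
  obtain ⟨s1, hs1, h1⟩ := cont_nd (G := ℝ) hrc (ε := e / 4) (by positivity)
  refine ⟨φ0, e^3, min s1 (R / 4), 3 * (e / 2)^2 * (c / 2), by positivity, by positivity, fun x hx => ?_, fun x hx => ?_,
    fun x hx => ?_, fun T hT x hx X => ?_⟩
  · by_cases hb : x ∈ ball p R
    · exact ((pc_cd.contDiffAt.comp x (hψa x hb)).congr_of_eventuallyEq (hloc x hb)).contDiffWithinAt
    · exact (contDiffAt_const.congr_of_eventuallyEq (hout x hx hb)).contDiffWithinAt
  · simp only [hφ]; split_ifs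
    · exact pc_nonneg _
    · exact le_rfl
  · simp only [hφ]; split_ifs with hb
    · unfold pc
      have := hneg x ⟨hx, hb⟩
      have : max (ψ x) 0 ≤ e := max_le (by simp only [hψ]; nlinarith [sq_nonneg ‖x - p‖]) e0.le
      gcongr
    · positivity
  · by_cases hb : x ∈ ball p R
    · refine le_trans ?_ (hlφ x hb X)
      by_cases hxT : x ∈ T
      · rw [indicator_of_mem hxT]
        have hs := mem_ball.1 (hT hxT)
        have a1 := h1 x (hs.trans_le (min_le_left _ _))
        rw [hr0, sub_zero, Real.norm_eq_abs] at a1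
        have a2 : ‖x - p‖ ≤ R / 4 := by rw [← dist_eq_norm]; exact (hs.trans_le (min_le_right _ _)).le
        have a3 : ‖x - p‖^2 ≤ (R / 4)^2 := by gcongr
        have a4 : e / 2 ≤ ψ x := by
          have := neg_abs_le (r x)
          simp only [hψ]; rw [he] at a1 ⊢; nlinarith
        have a5 : e / 2 ≤ max (ψ x) 0 := a4.trans (le_max_left _ _)
        have a6 : (e / 2)^2 ≤ (max (ψ x) 0)^2 := by gcongr
        have a7 := mul_le_mul_of_nonneg_right a6 (by positivity : 0 ≤ 3 * (c / 2 * ‖X‖^2))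
        linarith
      · rw [indicator_of_notMem hxT, zero_mul]; positivity
    · have hT' : x ∉ T := fun h => hb (ball_subset_ball ((min_le_right _ _).trans (by linarith)) (hT h))
      rw [indicator_of_notMem hT', zero_mul, levi_cg (hout x hx hb)]
      simp [leviForm]

end P20

section P21
open Filter (Tendsto atTop)

lemma lint_le {S D : Set (Cn n)} (hS : MeasurableSet S) (hSD : S ⊆ D) {f g : Cn n → ℂ} {k : ℝ} (hk : 0 ≤ k)
    (h : ∀ x ∈ S, ‖g x‖ ≤ k * ‖f x‖) : ∫⁻ x in S, ‖g x‖ₑ^2 ≤ ENNReal.ofReal (k^2) * ∫⁻ x in D, ‖f x‖ₑ^2 := by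
  calc ∫⁻ x in S, ‖g x‖ₑ^2 ≤ ∫⁻ x in S, ENNReal.ofReal (k^2) * ‖f x‖ₑ^2 := by
        refine setLIntegral_mono' hS fun x hx => ?_
        rw [ENNReal.ofReal_pow hk, ← mul_pow, ← ofReal_norm, ← ofReal_norm, ← ENNReal.ofReal_mul hk]
        gcongr
        exact h x hx
    _ = ENNReal.ofReal (k^2) * ∫⁻ x in S, ‖f x‖ₑ^2 := lintegral_const_mul' _ _ ENNReal.ofReal_ne_top
    _ ≤ _ := by gcongr

lemma cut_p (p : Cn n) {s : ℝ} (hs : 0 < s) : ∃ χ : Cn n → ℝ, ContDiff ℝ 2 χ ∧ (∀ x, 0 ≤ χ x ∧ χ x ≤ 1) ∧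
    (∀ x ∈ ball p (s / 2), χ x = 1) ∧ (∀ x ∉ closedBall p (3 * s / 4), χ x = 0) := by
  refine ⟨fun x => Real.smoothTransition (9 / 5 - 16 / 5 / s^2 * ‖x - p‖^2), ?_, ?_, ?_, ?_⟩
  · exact Real.smoothTransition.contDiff.comp (contDiff_const.sub (contDiff_const.mul (nsq_cd p)))
  · exact fun x => ⟨Real.smoothTransition.nonneg _, Real.smoothTransition.le_one _⟩
  · intro x hx
    apply Real.smoothTransition.one_of_one_le
    rw [mem_ball, dist_eq_norm] at hx
    have h1 : ‖x - p‖^2 ≤ (s / 2)^2 := by gcongr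
    have h2 := mul_le_mul_of_nonneg_left h1 (by positivity : 0 ≤ 16 / 5 / s^2)
    have h3 : 16 / 5 / s^2 * (s / 2)^2 = 4 / 5 := by field_simp; norm_num
    linarith
  · intro x hx
    apply Real.smoothTransition.zero_of_nonpos
    rw [mem_closedBall, dist_eq_norm, not_le] at hx
    have h1 : (3 * s / 4)^2 ≤ ‖x - p‖^2 := by gcongr
    have h2 := mul_le_mul_of_nonneg_left h1 (by positivity : 0 ≤ 16 / 5 / s^2)
    have h3 : 16 / 5 / s^2 * (3 * s / 4)^2 = 9 / 5 := by field_simp; norm_num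
    linarith

lemma ext1 {Ω : Set (Cn n)} (hΩ : IsPseudoconvex Ω) {p : Cn n} (hp : IsStrictPscPtC2 Ω p) {V : Set (Cn n)}
    (hV : V ∈ nhds p) : ∃ (s κ L M0 : ℝ) (χ : Cn n → ℝ), 0 < s ∧ 0 < κ ∧ 0 < L ∧ 0 < M0 ∧ ball p s ⊆ V ∧
      (∀ x, 0 ≤ χ x ∧ χ x ≤ 1) ∧ (∀ x ∈ ball p (s / 2), χ x = 1) ∧ Continuous χ ∧
      ∀ q ∈ frontier Ω ∩ ball p (s / 4), ∃ P : Cn n → ℂ, Differentiable ℂ P ∧ (∀ ζ ∈ ball p s, -L * ‖ζ - q‖ ≤ (P ζ).re) ∧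
        (∀ ζ ∈ Ω ∩ ball p s, (P ζ).re ≤ 0) ∧ ∀ t : ℝ, 0 ≤ t → ∀ f : Cn n → ℂ, DifferentiableOn ℂ f (Ω ∩ V) →
        L2normSq (Ω ∩ V) f ≤ 1 → ∃ F : Cn n → ℂ, DifferentiableOn ℂ F Ω ∧
          ∫⁻ x in Ω, ‖(χ x : ℂ) * (Ω ∩ ball p s).indicator (fun ζ => f ζ * Complex.exp (t * P ζ)) x - F x‖ₑ^2
            ≤ ENNReal.ofReal (M0 * Real.exp (-κ * t)^2) := by
  obtain ⟨r, R, c, L, hR, hc, hL, hr, hl, hneg, hr0, hP⟩ := local_def hΩ.1 hp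
  obtain ⟨φ0, B, s1, c1, hs1, hc1, hφ, hφ0, hφB, hφl⟩ := weight hΩ.1 hR hc hr hl hneg hr0
  obtain ⟨s2, hs2, hV2⟩ := Metric.mem_nhds_iff.1 hV
  set s := min (min s1 s2) R with hsd
  have hs : 0 < s := by positivity
  have g1 : s ≤ s1 := (min_le_left _ _).trans (min_le_left _ _)
  have g2 : s ≤ s2 := (min_le_left _ _).trans (min_le_right _ _)
  have g3 : s ≤ R := min_le_right _ _
  obtain ⟨χ, hχ, hχ01, hχ1, hχ0⟩ := cut_p p hs
  have hχc : ContDiff ℝ 2 (toC χ) := Complex.ofRealCLM.contDiff.comp hχ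
  have hK : IsCompact (closedBall p (3 * s / 4)) := isCompact_closedBall _ _
  have hχ0' : ∀ x ∉ closedBall p (3 * s / 4), toC χ x = 0 := fun x hx => by simp [toC, hχ0 x hx]
  have hMj : ∀ j : Fin n, ∃ M, ∀ x, ‖dzb j (toC χ) x‖ ≤ M := fun j => by
    have h1 : Continuous (dzb j (toC χ)) := (dzb_contDiff (m := 1) j (hχc.of_le (by norm_num))).continuous
    have h2 := cont_off isOpen_univ h1.continuousOn hK (subset_univ _) (dzb_zero_off j hK.isClosed hχ0')
    exact h1.bounded_above_of_compact_support h2.2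
  choose Mj hMj using hMj
  set M := ∑ j, |Mj j| with hM
  have hMb : ∀ x j, ‖dzb j (toC χ) x‖ ≤ M := fun x j =>
    (hMj j x).trans ((le_abs_self _).trans (Finset.single_le_sum (f := fun j => |Mj j|) (fun i _ => abs_nonneg _) (Finset.mem_univ j)))
  have hKO : closedBall p (3 * s / 4) ⊆ ball p s := closedBall_subset_ball (by linarith)
  set T := ball p s \ ball p (s / 2) with hT
  have hTm : MeasurableSet T := measurableSet_ball.diff measurableSet_ball
  have hχT : ∀ x ∉ T, ∀ j, dzb j (toC χ) x = 0 := fun x hx j => by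
    by_cases h1 : x ∈ ball p s
    · have h2 : x ∈ ball p (s / 2) := by by_contra h2; exact hx ⟨h1, h2⟩
      have h3 : toC χ =ᶠ[nhds x] fun _ => 1 := by
        filter_upwards [isOpen_ball.mem_nhds h2] with y hy
        simp [toC, hχ1 y hy]
      have h4 : fderiv ℝ (toC χ) x = 0 := by rw [h3.fderiv_eq]; simp
      simp [dzb, h4]
    · exact dzb_zero_off j hK.isClosed hχ0' x fun h => h1 (hKO h)
  have hsV : ball p s ⊆ V := (ball_subset_ball g2).trans hV2
  have hpΩ : p ∉ Ω := by
    have := hp.1; rw [hΩ.1.frontier_eq] at this; exact this.2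
  refine ⟨s, c / 2 * (s / 4)^2, L, 2 * Real.exp (1 + B) / c1 * (n * (M^2 * 1)) + 1, χ, hs, by positivity, hL, by positivity, hsV, hχ01, hχ1, hχ.continuous, ?_⟩
  rintro q ⟨hq, hqb⟩
  obtain ⟨P, hPd, hP2⟩ := hP q ⟨hq, ball_subset_ball (by linarith) hqb⟩
  refine ⟨P, hPd, fun ζ hζ => (hP2 ζ (ball_subset_ball g3 hζ)).2, fun ζ hζ => ?_, ?_⟩
  · have := (hP2 ζ (ball_subset_ball g3 hζ.2)).1 hζ.1
    nlinarith [sq_nonneg ‖ζ - q‖]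
  intro t ht f hf hf2
  set κ := c / 2 * (s / 4)^2 with hκ
  have hsub : Ω ∩ ball p s ⊆ Ω ∩ V := inter_subset_inter_right _ hsV
  have hn : ∀ ζ, ‖f ζ * Complex.exp (t * P ζ)‖ = Real.exp (t * (P ζ).re) * ‖f ζ‖ := fun ζ => by
    rw [norm_mul, Complex.norm_exp, mul_comm]; simp
  have hf2' : ∫⁻ x in Ω ∩ V, ‖f x‖ₑ^2 ≤ 1 := hf2
  have hA1 : ∫⁻ x in Ω ∩ ball p s, ‖f x * Complex.exp (t * P x)‖ₑ^2 < ⊤ := by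
    refine (lint_le (k := 1) (hΩ.1.inter isOpen_ball).measurableSet hsub zero_le_one fun x hx => ?_).trans_lt
      (lt_of_le_of_lt (mul_le_mul_right hf2' _) (by simp))
    rw [hn]
    gcongr
    rw [Real.exp_le_one_iff]
    have := (hP2 x (ball_subset_ball g3 hx.2)).1 hx.1
    nlinarith [sq_nonneg ‖x - q‖, mul_nonneg hc.le (sq_nonneg ‖x - q‖)]
  have hA2 : ∫⁻ x in Ω ∩ ball p s ∩ T, ‖f x * Complex.exp (t * P x)‖ₑ^2 ≤ ENNReal.ofReal (Real.exp (-κ * t)^2) := by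
    refine (lint_le (k := Real.exp (-κ * t)) ((hΩ.1.inter isOpen_ball).measurableSet.inter hTm) (inter_subset_left.trans hsub)
      (by positivity) fun x hx => ?_).trans ((mul_le_mul_right hf2' _).trans (by simp))
    rw [hn]
    refine mul_le_mul_of_nonneg_right (Real.exp_le_exp.2 ?_) (norm_nonneg _)
    have h1 := (hP2 x (ball_subset_ball g3 hx.1.2)).1 hx.1.1
    have h2 : s / 4 ≤ ‖x - q‖ := by
      rw [← dist_eq_norm]
      have a1 := dist_triangle x q p
      have a2 : s / 2 ≤ dist x p := not_lt.1 hx.2.2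
      have a3 := mem_ball.1 hqb
      linarith
    have h3 : (s / 4)^2 ≤ ‖x - q‖^2 := by gcongr
    have h4 : (P x).re ≤ -κ := by rw [hκ]; nlinarith
    nlinarith
  obtain ⟨F, hF, hF2⟩ := extend (T := T) (c := c1) (O := ball p s) (K := closedBall p (3 * s / 4)) (M := M)
    (F0 := fun ζ => f ζ * Complex.exp (t * P ζ)) (E := Real.exp (-κ * t)^2) hΩ hpΩ hφ hφ0 hφB hTm hc1
    (hφl T (sdiff_subset.trans (ball_subset_ball g1))) hχ isOpen_ball hK hKO hχ0 hχT hMb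
    ((hf.mono hsub).mul ((hPd.const_mul (t:ℂ)).cexp).differentiableOn) hA1 (by positivity) hA2
  refine ⟨F, hF, hF2.trans (ENNReal.ofReal_le_ofReal ?_)⟩
  have : 0 ≤ Real.exp (-κ * t)^2 := by positivity
  linarith

end P21

section P22
open Filter (Tendsto atTop)

lemma l2_add {D : Set (Cn n)} {f u : Cn n → ℂ} (hf : AEMeasurable (fun x => ‖f x‖ₑ^2) (volume.restrict D)) {η : ℝ} (hη : 0 < η) :
    ∫⁻ x in D, ‖f x - u x‖ₑ^2 ≤ ENNReal.ofReal (1 + η) * (∫⁻ x in D, ‖f x‖ₑ^2)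
      + ENNReal.ofReal (1 + 1 / η) * ∫⁻ x in D, ‖u x‖ₑ^2 := by
  calc ∫⁻ x in D, ‖f x - u x‖ₑ^2 ≤ ∫⁻ x in D, (ENNReal.ofReal (1 + η) * ‖f x‖ₑ^2 + ENNReal.ofReal (1 + 1 / η) * ‖u x‖ₑ^2) := by
        refine lintegral_mono fun x => ?_
        simp only [← ofReal_norm, ← ENNReal.ofReal_pow (norm_nonneg _)]
        rw [← ENNReal.ofReal_mul (by positivity), ← ENNReal.ofReal_mul (by positivity), ← ENNReal.ofReal_add (by positivity) (by positivity)]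
        apply ENNReal.ofReal_le_ofReal
        have h1 : ‖f x - u x‖^2 ≤ (‖f x‖ + ‖u x‖)^2 := by gcongr; exact norm_sub_le _ _
        have h2 : (1 + η) * ‖f x‖^2 + (1 + 1 / η) * ‖u x‖^2 - (‖f x‖ + ‖u x‖)^2 = (η * ‖f x‖ - ‖u x‖)^2 / η := by
          field_simp; ring
        have h3 : 0 ≤ (η * ‖f x‖ - ‖u x‖)^2 / η := by positivity
        linarith
    _ = _ := by
        rw [lintegral_add_left' (hf.const_mul _), lintegral_const_mul' _ _ ENNReal.ofReal_ne_top, lintegral_const_mul' _ _ ENNReal.ofReal_ne_top]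

lemma ae_of_diff {D : Set (Cn n)} (hD : IsOpen D) {f : Cn n → ℂ} (hf : DifferentiableOn ℂ f D) :
    AEMeasurable (fun x => ‖f x‖ₑ^2) (volume.restrict D) :=
  ((hf.continuousOn.aemeasurable hD.measurableSet).enorm).pow_const _

lemma geom {Ω : Set (Cn n)} (hO : IsOpen Ω) (hf : (frontier Ω).Nonempty) {z : Cn n} (hz : z ∈ Ω) :
    0 < bdist Ω z ∧ ball z (bdist Ω z) ⊆ Ω ∧ ∃ q ∈ frontier Ω, dist z q = bdist Ω z := by
  obtain ⟨q, hq, hd⟩ := isClosed_frontier.exists_infDist_eq_dist hf z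
  have h0 : 0 < bdist Ω z := by
    rw [bdist, hd, dist_pos]; rintro rfl
    rw [hO.frontier_eq] at hq; exact hq.2 hz
  refine ⟨h0, ?_, q, hq, hd.symm⟩
  refine IsPreconnected.subset_left_of_subset_union hO isClosed_closure.isOpen_compl (v := (closure Ω)ᶜ) ?_ ?_
    ⟨z, mem_ball_self h0, hz⟩ (convex_ball z _).isPreconnected
  · exact disjoint_compl_right.mono_left subset_closure
  · intro x hx
    by_contra hh
    rw [mem_union, not_or, notMem_compl_iff] at hh
    have : x ∈ frontier Ω := by rw [hO.frontier_eq]; exact ⟨hh.2, hh.1⟩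
    exact (disjoint_left.1 disjoint_ball_infDist) hx this

lemma approx {Ω : Set (Cn n)} (hΩ : IsPseudoconvex Ω) {p : Cn n} (hp : IsStrictPscPtC2 Ω p) {V : Set (Cn n)}
    (hV : V ∈ nhds p) (m : ℕ) : ∃ (s C : ℝ), 0 < s ∧ 0 < C ∧ ball p s ⊆ V ∧ ∀ z ∈ Ω ∩ ball p s,
      0 < bdist Ω z ∧ bdist Ω z < s ∧ bdist Ω z < 1 / 2 ∧ ball z (bdist Ω z) ⊆ Ω ∩ V ∧ ∃ a : ℂ, ‖a‖ ≤ 1 ∧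
      1 + C * bdist Ω z * Real.log (bdist Ω z) ≤ ‖a‖ ∧
      ∀ f : Cn n → ℂ, DifferentiableOn ℂ f (Ω ∩ V) → L2normSq (Ω ∩ V) f ≤ 1 → ∃ F : Cn n → ℂ, DifferentiableOn ℂ F Ω ∧
        L2normSq Ω F ≤ ENNReal.ofReal (1 + C * bdist Ω z^m) ∧ ‖a * f z - F z‖ ≤ C * bdist Ω z^m ∧
        (f z = 0 → ∀ X, ‖a * fderiv ℂ f z X - fderiv ℂ F z X‖ ≤ C * bdist Ω z^m * ‖X‖) := by
  obtain ⟨s, κ, L, M0, χ, hs, hκ, hL, hM0, hsV, hχ01, hχ1, hχc, H⟩ := ext1 hΩ hp hV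
  set N := m + dimR n + 2 with hN
  set C1 := Real.sqrt (C0 n * 4^(dimR n + 2) * M0) with hC1
  have hC0 := C0_pos (n := n)
  refine ⟨min (s / 8) (1 / 2), N / κ * L + C1 + (1 + 2 * M0), by positivity, by positivity,
    (ball_subset_ball ((min_le_left _ _).trans (by linarith))).trans hsV, ?_⟩
  rintro z ⟨hzΩ, hzb⟩
  obtain ⟨hδ, hbΩ, q, hq, hzq⟩ := geom hΩ.1 ⟨p, hp.1⟩ hzΩ
  have hδp : bdist Ω z ≤ dist z p := infDist_le_dist_of_mem hp.1
  set δ := bdist Ω z with hδd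
  rw [mem_ball] at hzb
  have z1 : dist z p < s / 8 := hzb.trans_le (min_le_left _ _)
  have z2 : dist z p < 1 / 2 := hzb.trans_le (min_le_right _ _)
  have hb4 : ball z δ ⊆ ball p (s / 4) := fun x hx => by
    rw [mem_ball] at hx ⊢; linarith [dist_triangle x z p]
  have hbs : ball z δ ⊆ ball p s := hb4.trans (ball_subset_ball (by linarith))
  have hbV : ball z δ ⊆ Ω ∩ V := fun x hx => ⟨hbΩ hx, hsV (hbs hx)⟩
  have hqb : q ∈ ball p (s / 4) := by
    rw [mem_ball]; linarith [dist_triangle_left q p z]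
  obtain ⟨P, hP, hPl, hPu, HF⟩ := H q ⟨hq, hqb⟩
  have hzs : z ∈ ball p s := hbs (mem_ball_self hδ)
  have hlog : Real.log δ ≤ 0 := Real.log_nonpos hδ.le (by linarith)
  set t : ℝ := N / κ * (-Real.log δ) with ht
  have ht0 : 0 ≤ t := mul_nonneg (by positivity) (by linarith)
  set η := δ^N with hη
  have hη0 : 0 < η := by positivity
  have hexp : Real.exp (-κ * t) = η := by
    have : -κ * t = N * Real.log δ := by rw [ht]; field_simp
    rw [this, mul_comm, Real.exp_mul, Real.exp_log hδ, Real.rpow_natCast]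
  have hδ1 : δ ≤ 1 := by linarith
  have hηm : η ≤ δ^m := pow_le_pow_of_le_one hδ.le hδ1 (by omega)
  have hm0 : 0 < δ^m := by positivity
  have hη1 : η ≤ 1 := pow_le_one₀ hδ.le hδ1
  set a := Complex.exp (t * P z) with ha
  have han : ‖a‖ = Real.exp (t * (P z).re) := by rw [ha, Complex.norm_exp]; simp
  have hCa : C1 ≤ N / κ * L + C1 + (1 + 2 * M0) := by
    have : 0 ≤ N / κ * L := by positivity
    linarith
  have hCb : 1 + 2 * M0 ≤ N / κ * L + C1 + (1 + 2 * M0) := by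
    have : 0 ≤ N / κ * L := by positivity
    have : 0 ≤ C1 := Real.sqrt_nonneg _
    linarith
  have hCc : N / κ * L ≤ N / κ * L + C1 + (1 + 2 * M0) := by
    have : 0 ≤ C1 := Real.sqrt_nonneg _
    linarith
  have hest : C0 n / (δ / 4)^(dimR n + 2) * (M0 * η^2) ≤ (C1 * δ^m)^2 := by
    rw [mul_pow, hC1, Real.sq_sqrt (by positivity)]
    have e1 : C0 n / (δ / 4)^(dimR n + 2) * (M0 * η^2) = C0 n * 4^(dimR n + 2) * M0 * (η^2 / δ^(dimR n + 2)) := by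
      rw [div_pow]; field_simp
    have e2 : η^2 / δ^(dimR n + 2) = η * δ^m := by
      rw [div_eq_iff (by positivity), hη, hN]; ring
    rw [e1, e2]
    apply mul_le_mul_of_nonneg_left _ (by positivity)
    rw [sq]
    gcongr
  refine ⟨hδ, lt_of_le_of_lt hδp hzb, by linarith, hbV, a, ?_, ?_, fun f hf hf2 => ?_⟩
  · rw [han, Real.exp_le_one_iff]
    exact mul_nonpos_of_nonneg_of_nonpos ht0 (hPu z ⟨hzΩ, hzs⟩)
  · rw [han]
    have h1 := hPl z hzs
    rw [← dist_eq_norm, hzq] at h1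
    have h2 := mul_le_mul_of_nonneg_left h1 ht0
    have h3 := Real.add_one_le_exp (t * (P z).re)
    have h4 : t * (-L * δ) = N / κ * L * (δ * Real.log δ) := by rw [ht]; ring
    have h5 : δ * Real.log δ ≤ 0 := mul_nonpos_of_nonneg_of_nonpos hδ.le hlog
    have h6 := mul_le_mul_of_nonpos_right hCc h5
    linarith
  · obtain ⟨F, hF, hF2⟩ := HF t ht0 f hf hf2
    rw [hexp] at hF2
    set g : Cn n → ℂ := fun x => (χ x : ℂ) * (Ω ∩ ball p s).indicator (fun ζ => f ζ * Complex.exp (t * P ζ)) x with hg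
    change ∫⁻ x in Ω, ‖g x - F x‖ₑ^2 ≤ _ at hF2
    set v : Cn n → ℂ := fun x => f x * Complex.exp (t * P x) - F x with hv
    have hPe : Differentiable ℂ fun x => Complex.exp (t * P x) := (hP.const_mul (t:ℂ)).cexp
    have hvd : DifferentiableOn ℂ v (ball z δ) :=
      ((hf.mono hbV).mul hPe.differentiableOn).sub (hF.mono hbΩ)
    have hv2 : ∫⁻ x in ball z δ, ‖v x‖ₑ^2 ≤ ENNReal.ofReal (M0 * η^2) := by
      refine le_trans ?_ ((lintegral_mono_set hbΩ).trans hF2)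
      refine le_of_eq (setLIntegral_congr_fun measurableSet_ball fun x hx => ?_)
      have : g x = f x * Complex.exp (t * P x) := by
        simp only [hg]
        rw [hχ1 x (ball_subset_ball (by linarith) (hb4 hx)), indicator_of_mem (show x ∈ Ω ∩ ball p s from ⟨hbΩ hx, hbs hx⟩)]
        simp
      simp only [hv, this]
    have hc0 := cauchy0 isOpen_ball hvd (x := z) (δ := δ / 2) (by positivity) (closedBall_subset_ball (by linarith)) (by positivity) hv2
    have hc1 := fun X => cauchy1 isOpen_ball hvd (x := z) (δ := δ / 4) (by positivity) (closedBall_subset_ball (by linarith)) (by positivity) hv2 X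
    have hfz : DifferentiableAt ℂ f z := hf.differentiableAt (Filter.mem_of_superset (ball_mem_nhds z hδ) hbV)
    have hFz : DifferentiableAt ℂ F z := hF.differentiableAt (hΩ.1.mem_nhds hzΩ)
    have hC1' : 0 ≤ C1 := Real.sqrt_nonneg _
    refine ⟨F, hF, ?_, ?_, ?_⟩
    · have hgm : AEMeasurable g := by
        refine (Complex.measurable_ofReal.comp hχc.measurable).aemeasurable.mul ?_
        have hop : MeasurableSet (Ω ∩ ball p s) := (hΩ.1.inter isOpen_ball).measurableSet
        rw [aemeasurable_indicator_iff hop]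
        exact ((hf.mono (inter_subset_inter_right _ hsV)).mul hPe.differentiableOn).continuousOn.aemeasurable hop
      have hg1 : ∫⁻ x in Ω, ‖g x‖ₑ^2 ≤ 1 := by
        have hop : MeasurableSet (Ω ∩ ball p s) := (hΩ.1.inter isOpen_ball).measurableSet
        have e1 : ∀ x, ‖g x‖ ≤ 1 * ‖(Ω ∩ ball p s).indicator f x‖ := fun x => by
          simp only [hg]
          by_cases hx : x ∈ Ω ∩ ball p s
          · rw [indicator_of_mem hx, indicator_of_mem hx, norm_mul, norm_mul, Complex.norm_exp]
            have b1 : ‖(χ x : ℂ)‖ ≤ 1 := by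
              rw [Complex.norm_real, Real.norm_eq_abs, abs_of_nonneg (hχ01 x).1]; exact (hχ01 x).2
            have b2 : Real.exp ((t * P x : ℂ).re) ≤ 1 := by
              rw [Real.exp_le_one_iff]; simpa using mul_nonpos_of_nonneg_of_nonpos ht0 (hPu x hx)
            calc ‖(χ x : ℂ)‖ * (‖f x‖ * Real.exp ((t * P x : ℂ).re)) ≤ 1 * (‖f x‖ * 1) := by gcongr
              _ = _ := by ring
          · rw [indicator_of_notMem hx, indicator_of_notMem hx]; simp
        have e2 := lint_le hΩ.1.measurableSet subset_rfl zero_le_one fun x _ => e1 x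
        have e3 : ∀ x, ‖(Ω ∩ ball p s).indicator f x‖ₑ^2 = (Ω ∩ ball p s).indicator (fun x => ‖f x‖ₑ^2) x := fun x => by
          by_cases hx : x ∈ Ω ∩ ball p s
          · rw [indicator_of_mem hx, indicator_of_mem hx]
          · rw [indicator_of_notMem hx, indicator_of_notMem hx]; simp
        simp only [e3, one_pow, ENNReal.ofReal_one, one_mul] at e2
        refine e2.trans ((setLIntegral_le_lintegral _ _).trans ?_)
        rw [lintegral_indicator hop]
        exact (lintegral_mono_set (inter_subset_inter_right _ hsV)).trans hf2
      have h1 := l2_add (D := Ω) (f := g) (u := fun x => g x - F x) ((hgm.restrict.enorm).pow_const _) hη0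
      simp only [sub_sub_cancel] at h1
      change ∫⁻ x in Ω, ‖F x‖ₑ^2 ≤ _
      refine h1.trans ?_
      calc _ ≤ ENNReal.ofReal (1 + η) * 1 + ENNReal.ofReal (1 + 1 / η) * ENNReal.ofReal (M0 * η^2) := by gcongr
        _ = ENNReal.ofReal (1 + η + (1 + 1 / η) * (M0 * η^2)) := by
          rw [mul_one, ← ENNReal.ofReal_mul (by positivity), ← ENNReal.ofReal_add (by positivity) (by positivity)]
        _ ≤ _ := by
          apply ENNReal.ofReal_le_ofReal
          have e : (1 + 1 / η) * (M0 * η^2) = M0 * (η * η) + M0 * η := by field_simp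
          have e2 : η * η ≤ η := mul_le_of_le_one_right hη0.le hη1
          have e3 := mul_le_mul_of_nonneg_left e2 hM0.le
          have e4 := mul_le_mul hCb hηm hη0.le (by linarith)
          linarith
    · have h1 : ‖v z‖^2 ≤ (C1 * δ^m)^2 := by
        have q1 : (δ / 4)^(dimR n + 2) ≤ (δ / 2)^(dimR n) :=
          (pow_le_pow_of_le_one (by positivity) (by linarith) (by omega)).trans (pow_le_pow_left₀ (by positivity) (by linarith) _)
        exact hc0.trans (le_trans (mul_le_mul_of_nonneg_right (div_le_div_of_nonneg_left hC0.le (by positivity) q1) (by positivity)) hest)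
      have h2 := (sq_le_sq₀ (norm_nonneg _) (by positivity)).1 h1
      have h3 : a * f z - F z = v z := by simp only [hv, ha]; ring
      rw [h3]
      exact h2.trans (by gcongr)
    · intro hf0 X
      have h1 : ‖fderiv ℂ v z X‖^2 ≤ (C1 * δ^m * ‖X‖)^2 := by
        refine (hc1 X).trans ?_
        rw [mul_pow _ ‖X‖]
        gcongr
      have h2 := (sq_le_sq₀ (norm_nonneg _) (by positivity)).1 h1
      have h3 : fderiv ℂ v z X = a * fderiv ℂ f z X - fderiv ℂ F z X := by
        have := ((hfz.hasFDerivAt.mul (hPe z).hasFDerivAt).sub hFz.hasFDerivAt).fderiv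
        change fderiv ℂ (fun x => f x * Complex.exp (t * P x) - F x) z X = _
        rw [show (fun x => f x * Complex.exp (t * P x) - F x) = (f * fun x => Complex.exp (t * P x)) - F from rfl, this]
        simp [hf0, ha]
      rw [← h3]
      exact h2.trans (by gcongr)

end P22

section P23
open Filter (Tendsto atTop)

lemma fin_arith {S J b e w C C7 C8 : ℝ} (hS : 0 < S) (hJ : 0 ≤ J) (he : 0 ≤ e) (hew : e ≤ w) (hC : 0 ≤ C) (hC7 : 0 ≤ C7)
    (hC8 : 0 ≤ C8) (hA : b * S ≤ Real.sqrt (J * (1 + C7 * e)) + C8 * e * S) (hb : 1 - C * w ≤ b)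
    (hpos : 0 ≤ 1 - 2 * (C + C8) * w) : 1 - (2 * (C + C8) + C7) * w ≤ J / S^2 := by
  set A := Real.sqrt (J * (1 + C7 * e))
  have hA2 : A^2 = J * (1 + C7 * e) := Real.sq_sqrt (by positivity)
  have hw : 0 ≤ w := he.trans hew
  set y := (C + C8) * w with hy
  have hy0 : 0 ≤ y := by positivity
  have h1 : (1 - y) * S ≤ A := by
    have a1 := mul_le_mul_of_nonneg_right hb hS.le
    have a2 : C8 * e * S ≤ C8 * w * S := by gcongr
    rw [hy]; linarith
  have h2 : ((1 - y) * S)^2 ≤ A^2 := by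
    have : 0 ≤ (1 - y) * S := mul_nonneg (by linarith) hS.le
    gcongr
  have h3 : (1 - 2 * y) * S^2 ≤ J * (1 + C7 * e) := by
    rw [← hA2]; refine le_trans ?_ h2
    nlinarith [mul_nonneg (sq_nonneg y) (sq_nonneg S)]
  have h4 : (1 - 2 * y) ≤ J / S^2 * (1 + C7 * e) := by
    rw [div_mul_eq_mul_div, le_div_iff₀ (by positivity)]; exact h3
  set Q := J / S^2
  have hQ : 0 ≤ Q := by positivity
  have h5 : 1 + C7 * e ≤ 1 + C7 * w := by gcongr
  have hz : 0 ≤ C7 * w := by positivity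
  have h6 : 1 - 2 * y ≤ Q * (1 + C7 * w) := h4.trans (mul_le_mul_of_nonneg_left h5 hQ)
  have goal : 1 - 2 * y - C7 * w ≤ Q := by
    by_contra hh; push Not at hh
    have : Q ≤ 1 := by linarith
    nlinarith
  linarith

lemma L2_bd {D B : Set (Cn n)} (hDB : D ⊆ B) (hB : MeasurableSet B) (hv : volume B < ⊤) {f : Cn n → ℂ} {K : ℝ} (hK : 0 ≤ K)
    (hf : ∀ x ∈ B, ‖f x‖ ≤ K) (hK2 : K^2 * (volume B).toReal ≤ 1) : L2normSq D f ≤ 1 := by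
  change ∫⁻ x in D, ‖f x‖ₑ^2 ≤ 1
  refine (lintegral_mono_set hDB).trans ((lint_le (f := fun _ => 1) hB subset_rfl hK (by simpa using hf)).trans ?_)
  simp only [enorm_one, one_pow, lintegral_const, one_mul, Measure.restrict_apply MeasurableSet.univ, univ_inter]
  rw [← ENNReal.ofReal_toReal hv.ne, ← ENNReal.ofReal_mul (by positivity), ← ENNReal.ofReal_one]
  exact ENNReal.ofReal_le_ofReal hK2

lemma J1_bdd {D : Set (Cn n)} {z : Cn n} {δ : ℝ} (hδ : 0 < δ) (hb : ball z δ ⊆ D) (X : Cn n) :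
    BddAbove {v : ℝ | ∃ f : Cn n → ℂ, DifferentiableOn ℂ f D ∧ L2normSq D f ≤ 1 ∧ f z = 0 ∧ v = ‖fderiv ℂ f z X‖ ^ 2} := by
  refine ⟨C0 n / (δ / 4)^(dimR n + 2) * 1 * ‖X‖^2, ?_⟩
  rintro v ⟨f, hf, hf2, -, rfl⟩
  refine cauchy1 isOpen_ball (hf.mono hb) (by positivity) (closedBall_subset_ball (by linarith)) zero_le_one ?_ X
  rw [ENNReal.ofReal_one]
  exact (lintegral_mono_set hb).trans hf2

lemma J1_nonneg (D : Set (Cn n)) (z X : Cn n) : 0 ≤ J1 D z X :=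
  Real.sSup_nonneg (by rintro v ⟨f, -, -, -, rfl⟩; positivity)

lemma J1_ge {Ω : Set (Cn n)} (hO : IsOpen Ω) {z : Cn n} (hz : z ∈ Ω) {δ : ℝ} (hδ : 0 < δ) (hb : ball z δ ⊆ Ω) {F : Cn n → ℂ}
    (hF : DifferentiableOn ℂ F Ω) (hF0 : F z = 0) {E : ℝ} (hE : 0 < E) (hF2 : L2normSq Ω F ≤ ENNReal.ofReal E) (X : Cn n) :
    ‖fderiv ℂ F z X‖^2 ≤ J1 Ω z X * E := by
  have hs : 0 < Real.sqrt E := Real.sqrt_pos.2 hE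
  set k : ℂ := (((Real.sqrt E)⁻¹ : ℝ) : ℂ) with hk
  have hkn : ‖k‖ = (Real.sqrt E)⁻¹ := by rw [hk, Complex.norm_real, Real.norm_eq_abs, abs_of_pos (by positivity)]
  have hk2 : ((Real.sqrt E)⁻¹)^2 = E⁻¹ := by rw [inv_pow, Real.sq_sqrt hE.le]
  have h1 : ‖fderiv ℂ (fun x => k * F x) z X‖^2 ≤ J1 Ω z X := by
    refine le_csSup (J1_bdd hδ hb X) ⟨fun x => k * F x, hF.const_mul k, ?_, by simp [hF0], rfl⟩
    refine (lint_le (f := F) (k := (Real.sqrt E)⁻¹) hO.measurableSet subset_rfl (by positivity) fun x _ => by rw [norm_mul, hkn]).trans ?_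
    rw [hk2]
    refine (mul_le_mul_right (show ∫⁻ x in Ω, ‖F x‖ₑ^2 ≤ _ from hF2) _).trans ?_
    rw [← ENNReal.ofReal_mul (by positivity), inv_mul_cancel₀ hE.ne', ENNReal.ofReal_one]
  rw [fderiv_const_mul (hF.differentiableAt (hO.mem_nhds hz))] at h1
  simp only [smul_apply, smul_eq_mul, norm_mul, mul_pow, hkn, hk2] at h1
  rw [inv_mul_le_iff₀ hE] at h1
  linarith

lemma J1_low {D : Set (Cn n)} {p : Cn n} {R k : ℝ} (hR : 0 < R) (hD : D ⊆ ball p R) (hk : 0 < k)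
    (hk2 : k^2 * (volume (ball p R)).toReal ≤ 1) {z : Cn n} {δ : ℝ} (hδ : 0 < δ) (hb : ball z δ ⊆ D) {X : Cn n} (hX : X ≠ 0) :
    (k / (2 * R) * ‖X‖)^2 ≤ J1 D z X := by
  have hXn : 0 < ‖X‖ := norm_pos_iff.2 hX
  set l : ℝ := k / (2 * R) / ‖X‖ with hl
  have hl0 : 0 < l := by positivity
  have hd : ∀ x, HasFDerivAt (fun ζ => (l : ℂ) * inner ℂ X (ζ - z)) ((l : ℂ) • innerSL ℂ X) x := fun x => by
    have := (((innerSL ℂ X).hasFDerivAt (x := x - z)).comp x ((hasFDerivAt_id x).sub_const z)).const_mul (l:ℂ)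
    simp only [ContinuousLinearMap.comp_id] at this
    exact this
  refine le_csSup (J1_bdd hδ hb X) ⟨fun ζ => (l : ℂ) * inner ℂ X (ζ - z), fun x _ => (hd x).differentiableAt.differentiableWithinAt, ?_, by simp, ?_⟩
  · refine L2_bd hD measurableSet_ball measure_ball_lt_top (K := k) hk.le (fun x hx => ?_) hk2
    have hz := hD (hb (mem_ball_self hδ))
    rw [norm_mul, Complex.norm_real, Real.norm_eq_abs, abs_of_pos hl0]
    have h1 := norm_inner_le_norm (𝕜 := ℂ) X (x - z)
    have h2 : ‖x - z‖ ≤ 2 * R := by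
      rw [← dist_eq_norm]; linarith [dist_triangle_right x z p, mem_ball.1 hx, mem_ball.1 hz]
    calc l * ‖inner ℂ X (x - z)‖ ≤ l * (‖X‖ * (2 * R)) := by gcongr; exact h1.trans (by gcongr)
      _ = k := by rw [hl]; field_simp
  · rw [(hd z).fderiv]
    simp only [smul_apply, smul_eq_mul, innerSL_apply_apply, inner_self_eq_norm_sq_to_K, norm_mul, norm_pow]
    have : ‖((l:ℝ):ℂ)‖ = l := by rw [Complex.norm_real, Real.norm_eq_abs, abs_of_pos hl0]
    rw [this, hl]
    simp
    field_simp

end P23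

section P24
open Filter (Tendsto atTop)

lemma key_ar {e dm C Cb : ℝ} (he0 : 0 < e) (he1 : e ≤ 1) (hdm : 0 < dm) (hme : dm ≤ e) (hC : 0 < C) (hCb0 : 0 < Cb) :
    (1 + e) * (1 + C * dm) + (1 + 1 / e) * ((Cb * dm)^2 * (1 + C)) ≤ 1 + (1 + 2 * C + 2 * Cb^2 * (1 + C)) * e := by
  have b1 : (1 + 1 / e) * ((Cb * dm)^2 * (1 + C)) ≤ (1 + 1 / e) * ((Cb * e)^2 * (1 + C)) := by gcongr
  have b2 : (1 + 1 / e) * ((Cb * e)^2 * (1 + C)) = Cb^2 * (1 + C) * (e * e + e) := by field_simp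
  have b3 : e * e ≤ e := by nlinarith
  have b4 : Cb^2 * (1 + C) * (e * e + e) ≤ Cb^2 * (1 + C) * (e + e) := by gcongr
  have b5 : (1 + e) * (1 + C * dm) ≤ (1 + e) * (1 + C * e) := by gcongr
  have b6 : C * (e * e) ≤ C * e := by gcongr
  linarith

lemma key_in {Ω D : Set (Cn n)} (hO : IsOpen Ω) {z X : Cn n} (hz : z ∈ Ω) {δ e dm C C4 Cb k : ℝ} (hδ : 0 < δ) (hbΩ : ball z δ ⊆ Ω)
    (he0 : 0 < e) (he1 : e ≤ 1) (hdm : 0 < dm) (hme : dm ≤ e) (hC : 0 < C) (hC40 : 0 ≤ C4) (hCb0 : 0 < Cb) (hk0 : 0 < k)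
    (hCb : Cb = 4 / k * C) {a : ℂ} (ha2 : 1 / 2 ≤ ‖a‖) {G : Cn n → ℂ} (hG : DifferentiableOn ℂ G Ω)
    (hG3 : L2normSq Ω G ≤ ENNReal.ofReal (1 + C)) (hGn : k / 4 ≤ ‖G z‖) (hGX : dm * ‖fderiv ℂ G z X‖ ≤ C4 * e * ‖X‖)
    (HF : ∀ f : Cn n → ℂ, DifferentiableOn ℂ f D → L2normSq D f ≤ 1 → ∃ F : Cn n → ℂ, DifferentiableOn ℂ F Ω ∧
        L2normSq Ω F ≤ ENNReal.ofReal (1 + C * dm) ∧ ‖a * f z - F z‖ ≤ C * dm ∧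
        (f z = 0 → ∀ X, ‖a * fderiv ℂ f z X - fderiv ℂ F z X‖ ≤ C * dm * ‖X‖)) :
    ‖a‖ * Real.sqrt (J1 D z X) ≤ Real.sqrt (J1 Ω z X * (1 + (1 + 2 * C + 2 * Cb^2 * (1 + C)) * e)) + (C + Cb * C4) * e * ‖X‖ := by
  have hGn0 : 0 < ‖G z‖ := lt_of_lt_of_le (by positivity) hGn
  have hGne : G z ≠ 0 := norm_pos_iff.1 hGn0
  set A := Real.sqrt (J1 Ω z X * (1 + (1 + 2 * C + 2 * Cb^2 * (1 + C)) * e)) with hA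
  have hA0 : 0 ≤ A := Real.sqrt_nonneg _
  have hQ : 0 ≤ (A + (C + Cb * C4) * e * ‖X‖) / ‖a‖ := by positivity
  suffices h : J1 (D) z X ≤ ((A + (C + Cb * C4) * e * ‖X‖) / ‖a‖)^2 by
    have h1 := Real.sqrt_le_sqrt h
    rw [Real.sqrt_sq hQ, le_div_iff₀ (by linarith)] at h1
    linarith
  refine csSup_le ⟨0, fun _ => 0, differentiableOn_const _, by simp [L2normSq], rfl, by simp⟩ ?_
  rintro u ⟨f, hf, hf2, hf0, rfl⟩
  obtain ⟨F, hF, hF2, hFz, hFX⟩ := HF f hf hf2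
  have hFX := hFX hf0 X
  rw [hf0, mul_zero, zero_sub, norm_neg] at hFz
  set β := F z / G z with hβ
  have hβn : ‖β‖ ≤ Cb * dm := by
    rw [hβ, norm_div, div_le_iff₀ hGn0]
    calc ‖F z‖ ≤ C * dm := hFz
      _ = Cb * dm * (k / 4) := by rw [hCb]; field_simp
      _ ≤ _ := by gcongr
  have hFd : DifferentiableAt ℂ F z := hF.differentiableAt (hO.mem_nhds hz)
  have hGd : DifferentiableAt ℂ G z := hG.differentiableAt (hO.mem_nhds hz)
  have hF1 : L2normSq Ω (fun x => F x - β * G x) ≤ ENNReal.ofReal (1 + (1 + 2 * C + 2 * Cb^2 * (1 + C)) * e) := by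
    have hβG : ∫⁻ x in Ω, ‖β * G x‖ₑ^2 ≤ ENNReal.ofReal ((Cb * dm)^2 * (1 + C)) := by
      refine (lint_le (f := G) (k := Cb * dm) hO.measurableSet subset_rfl (by positivity) fun x _ => by
        rw [norm_mul]; gcongr).trans ?_
      rw [ENNReal.ofReal_mul (by positivity)]
      exact mul_le_mul_right hG3 _
    have hF2' : ∫⁻ x in Ω, ‖F x‖ₑ^2 ≤ ENNReal.ofReal (1 + C * dm) := hF2
    refine (l2_add (ae_of_diff hO hF) he0).trans ?_
    calc _ ≤ ENNReal.ofReal (1 + e) * ENNReal.ofReal (1 + C * dm) + ENNReal.ofReal (1 + 1 / e) * ENNReal.ofReal ((Cb * dm)^2 * (1 + C)) := by gcongr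
      _ = ENNReal.ofReal ((1 + e) * (1 + C * dm) + (1 + 1 / e) * ((Cb * dm)^2 * (1 + C))) := by
        rw [← ENNReal.ofReal_mul (by positivity), ← ENNReal.ofReal_mul (by positivity), ← ENNReal.ofReal_add (by positivity) (by positivity)]
      _ ≤ _ := by
        exact ENNReal.ofReal_le_ofReal (key_ar he0 he1 hdm hme hC hCb0)
  have hJ1 := J1_ge hO hz hδ hbΩ (F := fun x => F x - β * G x) (hF.sub (hG.const_mul β))
    (by simp only [hβ]; field_simp; ring) (by positivity) hF1 X
  have hfd : fderiv ℂ (fun x => F x - β * G x) z X = fderiv ℂ F z X - β * fderiv ℂ G z X := by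
    have := (hFd.hasFDerivAt.sub (hGd.hasFDerivAt.const_mul β)).fderiv
    rw [show (fun x => F x - β * G x) = F - fun x => β * G x from rfl, this]
    simp
  rw [hfd] at hJ1
  have h1 : ‖fderiv ℂ F z X - β * fderiv ℂ G z X‖ ≤ A := Real.le_sqrt_of_sq_le hJ1
  have h2 : ‖β * fderiv ℂ G z X‖ ≤ Cb * C4 * e * ‖X‖ := by
    rw [norm_mul]
    calc ‖β‖ * ‖fderiv ℂ G z X‖ ≤ Cb * dm * ‖fderiv ℂ G z X‖ := by gcongr
      _ = Cb * (dm * ‖fderiv ℂ G z X‖) := by ring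
      _ ≤ Cb * (C4 * e * ‖X‖) := by gcongr
      _ = _ := by ring
  have h3 : C * dm * ‖X‖ ≤ C * e * ‖X‖ := by gcongr
  have h4 : ‖a * fderiv ℂ f z X‖ ≤ ‖a * fderiv ℂ f z X - fderiv ℂ F z X‖ + ‖fderiv ℂ F z X - β * fderiv ℂ G z X‖ + ‖β * fderiv ℂ G z X‖ := by
    have : a * fderiv ℂ f z X = (a * fderiv ℂ f z X - fderiv ℂ F z X) + (fderiv ℂ F z X - β * fderiv ℂ G z X) + β * fderiv ℂ G z X := by ring
    conv_lhs => rw [this]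
    exact norm_add₃_le
  rw [norm_mul] at h4
  have h5 : ‖fderiv ℂ f z X‖ ≤ (A + (C + Cb * C4) * e * ‖X‖) / ‖a‖ := by
    rw [le_div_iff₀ (by linarith)]
    linarith
  gcongr

set_option maxHeartbeats 1000000 in
theorem loc_main (n : ℕ) (Ω : Set (Cn n)) (hpsc : IsPseudoconvex Ω) (_hconn : IsConnected Ω)
    (p : Cn n) (hp : IsStrictPscPtC2 Ω p)
    (V : Set (Cn n)) (hV : V ∈ nhds p) (hVbdd : Bornology.IsBounded V) :
    ∃ (U : Set (Cn n)) (C : ℝ), U ⊆ V ∧ U ∈ nhds p ∧ 0 < C ∧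
      ∀ z ∈ Ω ∩ U, ∀ X : Cn n, X ≠ 0 →
        J1 Ω z X / J1 (Ω ∩ V) z X ≤ 1 ∧ 1 + C * bdist Ω z * Real.log (bdist Ω z) ≤ J1 Ω z X / J1 (Ω ∩ V) z X := by
  obtain ⟨s, C, hs, hC, hsV, H⟩ := approx hpsc hp hV (dimR n + 4)
  obtain ⟨R, hR, hVR⟩ := hVbdd.subset_ball_lt 0 p
  have hDR : Ω ∩ V ⊆ ball p R := inter_subset_right.trans hVR
  set v := (volume (ball p R)).toReal with hv
  have hv0 : 0 ≤ v := ENNReal.toReal_nonneg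
  set k : ℝ := 1 / (1 + v) with hk
  have hk0 : 0 < k := by positivity
  have hk2 : k^2 * v ≤ 1 := by
    rw [hk, div_pow, one_pow, div_mul_eq_mul_div, one_mul, div_le_one (by positivity)]; nlinarith
  have hC0 := C0_pos (n := n)
  set C4 := Real.sqrt (C0 n * 4^(dimR n + 2) * (1 + C)) with hC4
  have hC40 : 0 ≤ C4 := Real.sqrt_nonneg _
  set Cb := 4 / k * C with hCb
  have hCb0 : 0 < Cb := by positivity
  set C5 := C + Cb * C4 with hC5
  set c0 := k / (2 * R) with hc0
  have hc00 : 0 < c0 := by positivity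
  set C8 := C5 / c0 with hC8
  set C7 := 1 + 2 * C + 2 * Cb^2 * (1 + C) with hC7
  refine ⟨ball p s, 2 * (C + C8) + C7 + 2 * C + 4 * C / k, hsV, ball_mem_nhds p hs, by positivity, ?_⟩
  intro z hz X hX
  obtain ⟨hδ, -, hδ2, hbV, a, ha1, ha, HF⟩ := H z hz
  set δ := bdist Ω z with hδd
  have hbΩ : ball z δ ⊆ Ω := hbV.trans inter_subset_left
  have hXn : 0 < ‖X‖ := norm_pos_iff.2 hX
  have hJ := J1_nonneg Ω z X
  have hlow := J1_low hR hDR hk0 hk2 hδ hbV hX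
  have hJD : 0 < J1 (Ω ∩ V) z X := lt_of_lt_of_le (by positivity) hlow
  refine ⟨div_le_one_of_le₀ (csSup_le_csSup (J1_bdd hδ hbV X) ⟨0, fun _ => 0, differentiableOn_const _, by simp [L2normSq], rfl, by simp⟩ ?_) hJD.le, ?_⟩
  · rintro u ⟨f, hf, hf2, hf0, rfl⟩
    exact ⟨f, hf.mono inter_subset_left, (lintegral_mono_set inter_subset_left).trans hf2, hf0, rfl⟩
  set w := δ * (-Real.log δ) with hw
  set e := δ^2 with he
  have he0 : 0 < e := by positivity
  have hew : e ≤ w := by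
    rw [he, hw, sq]
    have := Real.log_le_sub_one_of_pos hδ
    exact mul_le_mul_of_nonneg_left (by linarith) hδ.le
  have hme : δ^(dimR n + 4) ≤ e := pow_le_pow_of_le_one hδ.le (by linarith) (by omega)
  have hm0 : 0 < δ^(dimR n + 4) := by positivity
  have he1 : e ≤ 1 := pow_le_one₀ hδ.le (by linarith)
  have ht : 1 + (2 * (C + C8) + C7 + 2 * C + 4 * C / k) * δ * Real.log δ = 1 - (2 * (C + C8) + C7) * w - 2 * (C * w) - 4 / k * (C * w) := by
    rw [hw]; ring
  rw [ht]
  have hw0 : 0 < w := he0.trans_le hew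
  have hCw : 0 < C * w := by positivity
  have hkC : 0 < 4 / k * (C * w) := by positivity
  have hC8w : 0 ≤ (C + C8) * w := by positivity
  have hC7w : 0 ≤ C7 * w := by positivity
  have hratio : 0 ≤ J1 Ω z X / J1 (Ω ∩ V) z X := by positivity
  by_cases hbig : 1 ≤ (2 * (C + C8) + C7) * w + 2 * (C * w) + 4 / k * (C * w)
  · linarith
  push Not at hbig
  have ha' : 1 - C * w ≤ ‖a‖ := by rw [hw]; linarith
  have ha2 : 1 / 2 ≤ ‖a‖ := by linarith
  have hCk : C * δ^(dimR n + 4) ≤ k / 4 := by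
    have h1 : C * δ^(dimR n + 4) ≤ C * w := by gcongr; exact hme.trans hew
    have h2 : 4 / k * (C * w) ≤ 1 := by linarith
    rw [div_mul_eq_mul_div, div_le_one hk0] at h2
    linarith
  set m := dimR n + 4 with hm
  obtain ⟨G, hG, hG2, hGz, -⟩ := HF (fun _ => (k : ℂ)) (differentiableOn_const _)
    (L2_bd hDR measurableSet_ball measure_ball_lt_top hk0.le (fun x _ => by simp [abs_of_pos hk0]) hk2)
  have hkn : ‖(k : ℂ)‖ = k := by simp [abs_of_pos hk0]
  have hGn : k / 4 ≤ ‖G z‖ := by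
    have h1 := norm_sub_norm_le (a * k) (G z)
    rw [norm_mul, hkn] at h1
    have h2 := mul_le_mul_of_nonneg_right ha2 hk0.le
    linarith
  have hG3 : L2normSq Ω G ≤ ENNReal.ofReal (1 + C) := hG2.trans (ENNReal.ofReal_le_ofReal (add_le_add_right (mul_le_of_le_one_right hC.le (hme.trans he1)) 1))
  have hGX : δ^m * ‖fderiv ℂ G z X‖ ≤ C4 * e * ‖X‖ := by
    have h1 := cauchy1 hpsc.1 hG (x := z) (δ := δ / 4) (by positivity) ((closedBall_subset_ball (by linarith)).trans hbΩ)
      (by positivity : 0 ≤ 1 + C) hG3 X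
    rw [← sq_le_sq₀ (by positivity) (by positivity)]
    calc (δ^m * ‖fderiv ℂ G z X‖)^2 = (δ^m)^2 * ‖fderiv ℂ G z X‖^2 := by ring
      _ ≤ (δ^m)^2 * (C0 n / (δ / 4)^(dimR n + 2) * (1 + C) * ‖X‖^2) := by gcongr
      _ = C4^2 * (e * δ^m) * ‖X‖^2 := by
        rw [hC4, Real.sq_sqrt (by positivity), he, hm, div_pow]
        field_simp
        ring
      _ ≤ C4^2 * (e * e) * ‖X‖^2 := by gcongr
      _ = _ := by ring
  have key := key_in hpsc.1 hz.1 hδ hbΩ he0 he1 hm0 hme hC hC40 hCb0 hk0 hCb ha2 hG hG3 hGn hGX HF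
  have hS0 : 0 < Real.sqrt (J1 (Ω ∩ V) z X) := Real.sqrt_pos.2 hJD
  have hSX : ‖X‖ ≤ Real.sqrt (J1 (Ω ∩ V) z X) / c0 := by
    rw [le_div_iff₀ hc00]
    have := Real.le_sqrt_of_sq_le hlow
    linarith
  have fa := fin_arith (S := Real.sqrt (J1 (Ω ∩ V) z X)) (J := J1 Ω z X) (b := ‖a‖) (e := e) (w := w) (C := C) (C7 := C7) (C8 := C8)
    hS0 hJ he0.le hew hC.le (by positivity) (by positivity) (key.trans (by
      have : C5 * e * ‖X‖ ≤ C5 * e * (Real.sqrt (J1 (Ω ∩ V) z X) / c0) := by gcongr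
      have e2 : C5 * e * (Real.sqrt (J1 (Ω ∩ V) z X) / c0) = C8 * e * Real.sqrt (J1 (Ω ∩ V) z X) := by rw [hC8]; ring
      linarith)) ha' (by linarith)
  rw [Real.sq_sqrt hJD.le] at fa
  linarith

end P24

end Helpers

/-- Localization of `J¹` near a `C²`-smooth strictly pseudoconvex boundary
point of a pseudoconvex domain. -/
theorem localization_J1 (n : ℕ) (Ω : Set (Cn n)) (hpsc : IsPseudoconvex Ω) (hconn : IsConnected Ω)
    (p : Cn n) (hp : IsStrictPscPtC2 Ω p)
    (V : Set (Cn n)) (hV : V ∈ nhds p) (hVbdd : Bornology.IsBounded V) :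
    ∃ (U : Set (Cn n)) (C : ℝ), U ⊆ V ∧ U ∈ nhds p ∧ 0 < C ∧
      ∀ z ∈ Ω ∩ U, ∀ X : Cn n, X ≠ 0 →
        J1 Ω z X / J1 (Ω ∩ V) z X ≤ 1 ∧ 1 + C * bdist Ω z * Real.log (bdist Ω z) ≤ J1 Ω z X / J1 (Ω ∩ V) z X := by
  exact loc_main n Ω hpsc hconn p hp V hV hVbdd

end
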